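/- arXiv:1610.02955 — 2 statements merged into one kernel-verified Lean document; each statement's English description precedes it below -/
import Mathlib

section
/- For any K > 0 and ε > 0, there exists a map H̃ : [0,T] × 𝒫₂ → ℝ satisfying (A1) such that for all t ∈ [0,T] and all m ∈ 𝒫₂ with |m|₂² ≤ K, one has |H(t,m) − H̃(t,m)| ≤ ε. -/
open MeasureTheory Filter Set
open scoped Topology ENNReal NNReal BoundedContinuousFunction

noncomputable section

/-- Euclidean space `ℝ^d`. -/
abbrev Ed (d : ℕ) : Type := EuclideanSpace ℝ (Fin d)

/-- `m ∈ 𝒫_p` : Borel probability measure on `ℝ^d` with finite `p`-th moment. -/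
def MemP (d : ℕ) (p : ℝ) (m : Measure (Ed d)) : Prop :=
  IsProbabilityMeasure m ∧ Integrable (fun x => ‖x‖ ^ p) m

/-- `γ` is a coupling of `m` and `m'`. -/
def IsCoupling (d : ℕ) (γ : Measure (Ed d × Ed d)) (m m' : Measure (Ed d)) : Prop :=
  γ.map Prod.fst = m ∧ γ.map Prod.snd = m'

/-- The `p`-Wasserstein distance. -/
def wdist (d : ℕ) (p : ℝ) (m m' : Measure (Ed d)) : ℝ :=
  sInf { c : ℝ | ∃ γ : Measure (Ed d × Ed d), IsProbabilityMeasure γ ∧ IsCoupling d γ m m' ∧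
      c = (∫ q, ‖q.1 - q.2‖ ^ p ∂γ) ^ (1 / p) }

/-- The Gaussian kernel `ρ_δ`. -/
def gaussDensity (d : ℕ) (δ : ℝ) (x : Ed d) : ℝ :=
  (2 * Real.pi * δ) ^ (-(d : ℝ) / 2) * Real.exp (-‖x‖ ^ 2 / (2 * δ))

/-- The centered Gaussian measure with variance `δ` on `ℝ^d`. -/
def gaussMeasure (d : ℕ) (δ : ℝ) : Measure (Ed d) :=
  volume.withDensity fun x => ENNReal.ofReal (gaussDensity d δ x)

/-- The heat flow `p^{t,m}_s` : the law at time `s` of a Brownian motion started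
at time `t` with initial law `m`. -/
def heatFlow (d : ℕ) (t s : ℝ) (m : Measure (Ed d)) : Measure (Ed d) :=
  if s ≤ t then m
  else Measure.map (fun q : Ed d × Ed d => q.1 + q.2) (m.prod (gaussMeasure d (s - t)))

/-- The Laplacian of a function on `ℝ^d` (the spatial divergence of its gradient),
`div[∇g](x) = Σ_i ∂²g/∂x_i²(x)`. -/
def lapl (d : ℕ) (g : Ed d → ℝ) (x : Ed d) : ℝ :=
  ∑ i : Fin d, iteratedFDeriv ℝ 2 g x (fun _ => EuclideanSpace.single i (1:ℝ))

/-- A test function satisfying condition (A3): `φ` is lower semicontinuous (for `d₁`) and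
`d₂`-continuous, the derivatives `∂φ/∂t`, `δφ/δm`, `∇_x(δφ/δm)`, `∇²_x(δφ/δm)` exist and
are `d₂`-continuous on `[0,T) × 𝒫₂ × ℝ^d`, and `δφ/δm` and its first and second spatial
derivatives have at most quadratic growth in `x`, uniformly in `(t,m)`. -/
structure TestFn (d : ℕ) (T : ℝ) where
  /-- the test function `φ(t,m)` -/
  φ : ℝ → Measure (Ed d) → ℝ
  /-- the time derivative `∂φ/∂t` -/
  φt : ℝ → Measure (Ed d) → ℝ
  /-- the linear functional derivative `δφ/δm (t,m,x)` -/
  δφ : ℝ → Measure (Ed d) → Ed d → ℝ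
  lsc : ∀ t ∈ Set.Icc 0 T, ∀ m : Measure (Ed d), MemP d 2 m → ∀ ε > (0:ℝ), ∃ η > (0:ℝ),
    ∀ t' ∈ Set.Icc 0 T, ∀ m' : Measure (Ed d), MemP d 2 m' →
      |t' - t| < η → wdist d 1 m m' < η → φ t m - ε < φ t' m'
  d2cont : ∀ t ∈ Set.Icc 0 T, ∀ m : Measure (Ed d), MemP d 2 m → ∀ ε > (0:ℝ), ∃ η > (0:ℝ),
    ∀ t' ∈ Set.Icc 0 T, ∀ m' : Measure (Ed d), MemP d 2 m' →
      |t' - t| < η → wdist d 2 m m' < η → |φ t' m' - φ t m| < ε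
  timeDeriv : ∀ m : Measure (Ed d), MemP d 2 m → ∀ t ∈ Set.Ico 0 T,
    HasDerivWithinAt (fun s => φ s m) (φt t m) (Set.Icc 0 T) t
  measDeriv : ∀ t ∈ Set.Ico 0 T, ∀ m : Measure (Ed d), MemP d 2 m →
    ∀ m' : Measure (Ed d), MemP d 2 m' →
      Tendsto (fun r : ℝ =>
          (φ t ((1 - ENNReal.ofReal r) • m + ENNReal.ofReal r • m') - φ t m) / r)
        (𝓝[>] 0) (𝓝 (∫ x, δφ t m x ∂m'))
  normalized : ∀ t ∈ Set.Ico 0 T, ∀ m : Measure (Ed d), MemP d 2 m →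
    ∫ x, δφ t m x ∂m = 0
  smoothX : ∀ t ∈ Set.Ico 0 T, ∀ m : Measure (Ed d), MemP d 2 m → ContDiff ℝ 2 (δφ t m)
  quadGrowth : ∃ c : ℝ, ∀ t ∈ Set.Ico 0 T, ∀ m : Measure (Ed d), MemP d 2 m → ∀ x : Ed d,
    |δφ t m x| ≤ c * (1 + ‖x‖ ^ 2) ∧ ‖fderiv ℝ (δφ t m) x‖ ≤ c * (1 + ‖x‖ ^ 2) ∧
      ‖iteratedFDeriv ℝ 2 (δφ t m) x‖ ≤ c * (1 + ‖x‖ ^ 2)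
  d2contDeriv : ∀ t ∈ Set.Ico 0 T, ∀ m : Measure (Ed d), MemP d 2 m → ∀ x : Ed d,
    ∀ ε > (0:ℝ), ∃ η > (0:ℝ), ∀ t' ∈ Set.Ico 0 T, ∀ m' : Measure (Ed d), MemP d 2 m' →
      ∀ x' : Ed d, |t' - t| < η → wdist d 2 m m' < η → ‖x' - x‖ < η →
        |φt t' m' - φt t m| < ε ∧ |δφ t' m' x' - δφ t m x| < ε ∧
          ‖fderiv ℝ (δφ t' m') x' - fderiv ℝ (δφ t m) x‖ < ε ∧
          ‖iteratedFDeriv ℝ 2 (δφ t' m') x' - iteratedFDeriv ℝ 2 (δφ t m) x‖ < ε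

/-- `φ − u` has a local minimum at `(t,m)` (locality for `|·|` in time and `d₁` in measure). -/
def LocalMinAt (d : ℕ) (T : ℝ) (g : ℝ → Measure (Ed d) → ℝ)
    (t : ℝ) (m : Measure (Ed d)) : Prop :=
  ∃ η > (0:ℝ), ∀ t' ∈ Set.Icc 0 T, ∀ m' : Measure (Ed d), MemP d 2 m' →
    |t' - t| ≤ η → wdist d 1 m m' ≤ η → g t m ≤ g t' m'

/-- `u` is a (viscosity) subsolution on `[0,T) × 𝒫₂` of the Hamilton-Jacobi equation
`∂_t U(t,m) + ½ ∫ div[D_m U](t,m,x) dm(x) + F(t,m) = 0` : for every `(t,m) ∈ [0,T) × 𝒫₂`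
and every test function `φ` satisfying (A3) such that `φ − u` has a local minimum at
`(t,m)`, one has `∂_t φ(t,m) + ½ ∫ div[D_m φ](t,m,x) dm(x) + F(t,m) ≥ 0`. -/
def IsSubsolution (d : ℕ) (T : ℝ) (F : ℝ → Measure (Ed d) → ℝ)
    (u : ℝ → Measure (Ed d) → ℝ) : Prop :=
  ∀ t ∈ Set.Ico 0 T, ∀ m : Measure (Ed d), MemP d 2 m → ∀ ψ : TestFn d T,
    LocalMinAt d T (fun s μ => ψ.φ s μ - u s μ) t m →
      ψ.φt t m + (1 / 2) * (∫ x, lapl d (ψ.δφ t m) x ∂m) + F t m ≥ 0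

/-- `u : [0,T] × 𝒫₂ → ℝ` is (jointly) continuous for the distance `|·| + d₁`. -/
def ContD1 (d : ℕ) (T : ℝ) (u : ℝ → Measure (Ed d) → ℝ) : Prop :=
  ∀ t ∈ Set.Icc 0 T, ∀ m : Measure (Ed d), MemP d 2 m → ∀ ε > (0:ℝ), ∃ η > (0:ℝ),
    ∀ t' ∈ Set.Icc 0 T, ∀ m' : Measure (Ed d), MemP d 2 m' →
      |t' - t| < η → wdist d 1 m m' < η → |u t' m' - u t m| < ε

/-- `u : [0,T] × 𝒫₂ → ℝ` is bounded. -/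
def BddD1 (d : ℕ) (T : ℝ) (u : ℝ → Measure (Ed d) → ℝ) : Prop :=
  ∃ c : ℝ, ∀ t ∈ Set.Icc 0 T, ∀ m : Measure (Ed d), MemP d 2 m → |u t m| ≤ c

/-- The data of condition (A1) for a source term `F` : `F` is bounded and continuous, and
`δF/δm`, `∇_x(δF/δm)`, `∇²_x(δF/δm)` exist and are bounded and continuous. -/
structure A1Data (d : ℕ) (T : ℝ) where
  /-- the source term `F(t,m)` -/
  F : ℝ → Measure (Ed d) → ℝ
  /-- the linear functional derivative `δF/δm (t,m,x)` -/
  δF : ℝ → Measure (Ed d) → Ed d → ℝ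
  bddF : BddD1 d T F
  contF : ContD1 d T F
  measDeriv : ∀ t ∈ Set.Icc 0 T, ∀ m : Measure (Ed d), MemP d 2 m →
    ∀ m' : Measure (Ed d), MemP d 2 m' →
      Tendsto (fun r : ℝ =>
          (F t ((1 - ENNReal.ofReal r) • m + ENNReal.ofReal r • m') - F t m) / r)
        (𝓝[>] 0) (𝓝 (∫ x, δF t m x ∂m'))
  normalized : ∀ t ∈ Set.Icc 0 T, ∀ m : Measure (Ed d), MemP d 2 m →
    ∫ x, δF t m x ∂m = 0
  smoothX : ∀ t ∈ Set.Icc 0 T, ∀ m : Measure (Ed d), MemP d 2 m → ContDiff ℝ 2 (δF t m)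
  bddDeriv : ∃ c : ℝ, ∀ t ∈ Set.Icc 0 T, ∀ m : Measure (Ed d), MemP d 2 m → ∀ x : Ed d,
    |δF t m x| ≤ c ∧ ‖fderiv ℝ (δF t m) x‖ ≤ c ∧ ‖iteratedFDeriv ℝ 2 (δF t m) x‖ ≤ c
  contDeriv : ∀ t ∈ Set.Icc 0 T, ∀ m : Measure (Ed d), MemP d 2 m → ∀ x : Ed d,
    ∀ ε > (0:ℝ), ∃ η > (0:ℝ), ∀ t' ∈ Set.Icc 0 T, ∀ m' : Measure (Ed d), MemP d 2 m' →
      ∀ x' : Ed d, |t' - t| < η → wdist d 1 m m' < η → ‖x' - x‖ < η →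
        |δF t' m' x' - δF t m x| < ε ∧
          ‖fderiv ℝ (δF t' m') x' - fderiv ℝ (δF t m) x‖ < ε ∧
          ‖iteratedFDeriv ℝ 2 (δF t' m') x' - iteratedFDeriv ℝ 2 (δF t m) x‖ < ε

/-- The data of condition (A2) for a terminal condition `ψ` : `ψ` is continuous with at
most linear growth, and `δψ/δm`, `∇_x(δψ/δm)`, `∇²_x(δψ/δm)` exist, are continuous, and
have linear growth in `x` uniformly in `m`. -/
structure A2Data (d : ℕ) where
  /-- the terminal condition `ψ(m)` -/
  ψ : Measure (Ed d) → ℝ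
  /-- the linear functional derivative `δψ/δm (m,x)` -/
  δψ : Measure (Ed d) → Ed d → ℝ
  growth : ∃ c : ℝ, ∀ m : Measure (Ed d), MemP d 2 m → |ψ m| ≤ c * (1 + ∫ x, ‖x‖ ∂m)
  contψ : ∀ m : Measure (Ed d), MemP d 2 m → ∀ ε > (0:ℝ), ∃ η > (0:ℝ),
    ∀ m' : Measure (Ed d), MemP d 2 m' → wdist d 1 m m' < η → |ψ m' - ψ m| < ε
  measDeriv : ∀ m : Measure (Ed d), MemP d 2 m → ∀ m' : Measure (Ed d), MemP d 2 m' →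
    Tendsto (fun r : ℝ =>
        (ψ ((1 - ENNReal.ofReal r) • m + ENNReal.ofReal r • m') - ψ m) / r)
      (𝓝[>] 0) (𝓝 (∫ x, δψ m x ∂m'))
  normalized : ∀ m : Measure (Ed d), MemP d 2 m → ∫ x, δψ m x ∂m = 0
  smoothX : ∀ m : Measure (Ed d), MemP d 2 m → ContDiff ℝ 2 (δψ m)
  derivGrowth : ∃ c : ℝ, ∀ m : Measure (Ed d), MemP d 2 m → ∀ x : Ed d,
    |δψ m x| ≤ c * (1 + ‖x‖) ∧ ‖fderiv ℝ (δψ m) x‖ ≤ c * (1 + ‖x‖) ∧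
      ‖iteratedFDeriv ℝ 2 (δψ m) x‖ ≤ c * (1 + ‖x‖)
  contDeriv : ∀ m : Measure (Ed d), MemP d 2 m → ∀ x : Ed d, ∀ ε > (0:ℝ), ∃ η > (0:ℝ),
    ∀ m' : Measure (Ed d), MemP d 2 m' → ∀ x' : Ed d,
      wdist d 1 m m' < η → ‖x' - x‖ < η →
        |δψ m' x' - δψ m x| < ε ∧ ‖fderiv ℝ (δψ m') x' - fderiv ℝ (δψ m) x‖ < ε ∧
          ‖iteratedFDeriv ℝ 2 (δψ m') x' - iteratedFDeriv ℝ 2 (δψ m) x‖ < ε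

/-- The Hamiltonian `H(t,m) = inf_u sup_v ∫ f(t,x,u,v) dm(x)`. -/
def hamiltonian {d : ℕ} {A B : Type} (f : ℝ → Ed d → A → B → ℝ)
    (t : ℝ) (m : Measure (Ed d)) : ℝ :=
  ⨅ u : A, ⨆ v : B, ∫ x, f t x u v ∂m

/-! ### Neighbourhood filters for the distance `|·| + d₁` -/

/-- The trace on `[0,T] × 𝒫₂` of the neighbourhoods of `(t,m)` for the distance `|·| + d₁`. -/
def nhdsD1 (d : ℕ) (T t : ℝ) (m : Measure (Ed d)) : Filter (ℝ × Measure (Ed d)) :=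
  ⨅ η > (0 : ℝ), 𝓟 {p | p.1 ∈ Set.Icc 0 T ∧ MemP d 2 p.2 ∧ |p.1 - t| < η ∧ wdist d 1 m p.2 < η}

lemma nhdsD1_hasBasis (d : ℕ) (T t : ℝ) (m : Measure (Ed d)) :
    (nhdsD1 d T t m).HasBasis (fun η : ℝ => 0 < η) fun η =>
      {p | p.1 ∈ Set.Icc 0 T ∧ MemP d 2 p.2 ∧ |p.1 - t| < η ∧ wdist d 1 m p.2 < η} := by
  refine hasBasis_biInf_principal (s := fun η : ℝ => {p : ℝ × Measure (Ed d) |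
    p.1 ∈ Set.Icc 0 T ∧ MemP d 2 p.2 ∧ |p.1 - t| < η ∧ wdist d 1 m p.2 < η})
    (S := {η : ℝ | 0 < η}) ?_ ⟨1, one_pos (α := ℝ)⟩
  intro a ha b hb
  refine ⟨min a b, show 0 < min a b from lt_min ha hb, ?_, ?_⟩
  · rintro p ⟨h1, h2, h3, h4⟩
    exact ⟨h1, h2, h3.trans_le (min_le_left _ _), h4.trans_le (min_le_left _ _)⟩
  · rintro p ⟨h1, h2, h3, h4⟩
    exact ⟨h1, h2, h3.trans_le (min_le_right _ _), h4.trans_le (min_le_right _ _)⟩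

lemma nhdsD1_prod_hasBasis (d : ℕ) (T t : ℝ) (m : Measure (Ed d)) (x : Ed d) :
    (nhdsD1 d T t m ×ˢ 𝓝 x).HasBasis (fun η : ℝ => 0 < η) fun η =>
      {p | p.1 ∈ Set.Icc 0 T ∧ MemP d 2 p.2 ∧ |p.1 - t| < η ∧ wdist d 1 m p.2 < η} ×ˢ
        Metric.ball x η := by
  refine (nhdsD1_hasBasis d T t m).prod_same_index Metric.nhds_basis_ball ?_
  intro a b ha hb
  refine ⟨min a b, lt_min ha hb, ?_, Metric.ball_subset_ball (min_le_right _ _)⟩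
  rintro p ⟨h1, h2, h3, h4⟩
  exact ⟨h1, h2, h3.trans_le (min_le_left _ _), h4.trans_le (min_le_left _ _)⟩

lemma tendsto_nhdsD1_iff {d : ℕ} {T t : ℝ} {m : Measure (Ed d)} {u : ℝ → Measure (Ed d) → ℝ} :
    Tendsto (fun p : ℝ × Measure (Ed d) => u p.1 p.2) (nhdsD1 d T t m) (𝓝 (u t m)) ↔
      ∀ ε > (0:ℝ), ∃ η > (0:ℝ), ∀ t' ∈ Set.Icc 0 T, ∀ m' : Measure (Ed d), MemP d 2 m' →
        |t' - t| < η → wdist d 1 m m' < η → |u t' m' - u t m| < ε := by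
  rw [(nhdsD1_hasBasis d T t m).tendsto_iff Metric.nhds_basis_ball]
  simp only [mem_ofPred_eq, Metric.mem_ball, Real.dist_eq, Prod.forall, and_imp, gt_iff_lt]
  constructor
  · intro h ε hε
    obtain ⟨η, hη, H⟩ := h ε hε
    exact ⟨η, hη, fun t' ht' m' hm' h1 h2 => H t' m' ht' hm' h1 h2⟩
  · intro h ε hε
    obtain ⟨η, hη, H⟩ := h ε hε
    exact ⟨η, hη, fun t' m' ht' hm' h1 h2 => H t' ht' m' hm' h1 h2⟩

lemma tendsto_nhdsD1_prod_iff {d : ℕ} {T t : ℝ} {m : Measure (Ed d)} {x : Ed d}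
    {G : Type*} [NormedAddCommGroup G] {u : ℝ → Measure (Ed d) → Ed d → G} :
    Tendsto (fun p : (ℝ × Measure (Ed d)) × Ed d => u p.1.1 p.1.2 p.2)
        (nhdsD1 d T t m ×ˢ 𝓝 x) (𝓝 (u t m x)) ↔
      ∀ ε > (0:ℝ), ∃ η > (0:ℝ), ∀ t' ∈ Set.Icc 0 T, ∀ m' : Measure (Ed d), MemP d 2 m' →
        ∀ x' : Ed d, |t' - t| < η → wdist d 1 m m' < η → ‖x' - x‖ < η →
          ‖u t' m' x' - u t m x‖ < ε := by
  rw [(nhdsD1_prod_hasBasis d T t m x).tendsto_iff Metric.nhds_basis_ball]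
  simp only [mem_prod, mem_ofPred_eq, Metric.mem_ball, dist_eq_norm, Prod.forall, and_imp,
    gt_iff_lt]
  constructor
  · intro h ε hε
    obtain ⟨η, hη, H⟩ := h ε hε
    exact ⟨η, hη, fun t' ht' m' hm' x' h1 h2 h3 => H t' m' x' ht' hm' h1 h2 h3⟩
  · intro h ε hε
    obtain ⟨η, hη, H⟩ := h ε hε
    exact ⟨η, hη, fun t' m' x' ht' hm' h1 h2 h3 => H t' ht' m' hm' x' h1 h2 h3⟩

lemma tendsto_fst_nhdsD1 (d : ℕ) (T t : ℝ) (m : Measure (Ed d)) :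
    Tendsto Prod.fst (nhdsD1 d T t m) (𝓝 t) := by
  rw [(nhdsD1_hasBasis d T t m).tendsto_iff Metric.nhds_basis_ball]
  exact fun ε hε => ⟨ε, hε, fun p hp => by simpa [Real.dist_eq] using hp.2.2.1⟩

/-- The three `ε`-`η` conditions of `A1Data.contDeriv` follow from convergence along
`nhdsD1`. -/
lemma contDeriv_of_tendsto {d : ℕ} {T t : ℝ} {m : Measure (Ed d)} {x : Ed d}
    {δ : ℝ → Measure (Ed d) → Ed d → ℝ}
    (h0 : Tendsto (fun p : (ℝ × Measure (Ed d)) × Ed d => δ p.1.1 p.1.2 p.2)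
      (nhdsD1 d T t m ×ˢ 𝓝 x) (𝓝 (δ t m x)))
    (h1 : Tendsto (fun p : (ℝ × Measure (Ed d)) × Ed d => fderiv ℝ (δ p.1.1 p.1.2) p.2)
      (nhdsD1 d T t m ×ˢ 𝓝 x) (𝓝 (fderiv ℝ (δ t m) x)))
    (h2 : Tendsto (fun p : (ℝ × Measure (Ed d)) × Ed d => iteratedFDeriv ℝ 2 (δ p.1.1 p.1.2) p.2)
      (nhdsD1 d T t m ×ˢ 𝓝 x) (𝓝 (iteratedFDeriv ℝ 2 (δ t m) x)))
    (ε : ℝ) (hε : 0 < ε) :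
    ∃ η > (0:ℝ), ∀ t' ∈ Set.Icc 0 T, ∀ m' : Measure (Ed d), MemP d 2 m' →
      ∀ x' : Ed d, |t' - t| < η → wdist d 1 m m' < η → ‖x' - x‖ < η →
        |δ t' m' x' - δ t m x| < ε ∧
          ‖fderiv ℝ (δ t' m') x' - fderiv ℝ (δ t m) x‖ < ε ∧
          ‖iteratedFDeriv ℝ 2 (δ t' m') x' - iteratedFDeriv ℝ 2 (δ t m) x‖ < ε := by
  obtain ⟨a, ha, H0⟩ := tendsto_nhdsD1_prod_iff.1 h0 ε hε
  obtain ⟨b, hb, H1⟩ := (tendsto_nhdsD1_prod_iff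
    (u := fun t m x => fderiv ℝ (δ t m) x)).1 h1 ε hε
  obtain ⟨c, hc, H2⟩ := (tendsto_nhdsD1_prod_iff
    (u := fun t m x => iteratedFDeriv ℝ 2 (δ t m) x)).1 h2 ε hε
  refine ⟨min a (min b c), lt_min ha (lt_min hb hc), fun t' ht' m' hm' x' k1 k2 k3 => ?_⟩
  simp only [lt_min_iff] at k1 k2 k3
  exact ⟨H0 t' ht' m' hm' x' k1.1 k2.1 k3.1, H1 t' ht' m' hm' x' k1.2.1 k2.2.1 k3.2.1,
    H2 t' ht' m' hm' x' k1.2.2 k2.2.2 k3.2.2⟩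

namespace A1Data

variable {d : ℕ} {T t : ℝ} {m : Measure (Ed d)} (P : A1Data d T)

lemma tendsto_F (ht : t ∈ Set.Icc 0 T) (hm : MemP d 2 m) :
    Tendsto (fun p : ℝ × Measure (Ed d) => P.F p.1 p.2) (nhdsD1 d T t m) (𝓝 (P.F t m)) :=
  tendsto_nhdsD1_iff.2 (P.contF t ht m hm)

lemma tendsto_δF (ht : t ∈ Set.Icc 0 T) (hm : MemP d 2 m) (x : Ed d) :
    Tendsto (fun p : (ℝ × Measure (Ed d)) × Ed d => P.δF p.1.1 p.1.2 p.2)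
      (nhdsD1 d T t m ×ˢ 𝓝 x) (𝓝 (P.δF t m x)) :=
  tendsto_nhdsD1_prod_iff.2 fun ε hε =>
    let ⟨η, hη, H⟩ := P.contDeriv t ht m hm x ε hε
    ⟨η, hη, fun t' ht' m' hm' x' h1 h2 h3 => (H t' ht' m' hm' x' h1 h2 h3).1⟩

lemma tendsto_fderiv_δF (ht : t ∈ Set.Icc 0 T) (hm : MemP d 2 m) (x : Ed d) :
    Tendsto (fun p : (ℝ × Measure (Ed d)) × Ed d => fderiv ℝ (P.δF p.1.1 p.1.2) p.2)
      (nhdsD1 d T t m ×ˢ 𝓝 x) (𝓝 (fderiv ℝ (P.δF t m) x)) :=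
  (tendsto_nhdsD1_prod_iff (u := fun t m x => fderiv ℝ (P.δF t m) x)).2 fun ε hε =>
    let ⟨η, hη, H⟩ := P.contDeriv t ht m hm x ε hε
    ⟨η, hη, fun t' ht' m' hm' x' h1 h2 h3 => (H t' ht' m' hm' x' h1 h2 h3).2.1⟩

lemma tendsto_iteratedFDeriv_δF (ht : t ∈ Set.Icc 0 T) (hm : MemP d 2 m) (x : Ed d) :
    Tendsto (fun p : (ℝ × Measure (Ed d)) × Ed d => iteratedFDeriv ℝ 2 (P.δF p.1.1 p.1.2) p.2)
      (nhdsD1 d T t m ×ˢ 𝓝 x) (𝓝 (iteratedFDeriv ℝ 2 (P.δF t m) x)) :=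
  (tendsto_nhdsD1_prod_iff (u := fun t m x => iteratedFDeriv ℝ 2 (P.δF t m) x)).2 fun ε hε =>
    let ⟨η, hη, H⟩ := P.contDeriv t ht m hm x ε hε
    ⟨η, hη, fun t' ht' m' hm' x' h1 h2 h3 => (H t' ht' m' hm' x' h1 h2 h3).2.2⟩

lemma integrable_δF (ht : t ∈ Set.Icc 0 T) (hm : MemP d 2 m) (m' : Measure (Ed d))
    [IsProbabilityMeasure m'] : Integrable (P.δF t m) m' := by
  obtain ⟨c, hc⟩ := P.bddDeriv
  exact Integrable.of_bound (P.smoothX t ht m hm).continuous.aestronglyMeasurable c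
    (ae_of_all _ fun x => (hc t ht m hm x).1)

lemma hasDerivWithinAt_segment (ht : t ∈ Set.Icc 0 T) (hm : MemP d 2 m) {m' : Measure (Ed d)}
    (hm' : MemP d 2 m') :
    HasDerivWithinAt
      (fun r : ℝ => P.F t ((1 - ENNReal.ofReal r) • m + ENNReal.ofReal r • m'))
      (∫ x, P.δF t m x ∂m') (Set.Ioi 0) 0 := by
  rw [hasDerivWithinAt_iff_tendsto_slope' (by simp)]
  refine (P.measDeriv t ht m hm m' hm').congr fun r => ?_
  simp [slope_def_field]

end A1Data

/-! ### Smooth functions of two functionals -/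

/-- The partial derivative of `Φ` in its first argument. -/
def partialFst (Φ : ℝ × ℝ → ℝ) (p : ℝ × ℝ) : ℝ := fderiv ℝ Φ p (1, 0)

/-- The partial derivative of `Φ` in its second argument. -/
def partialSnd (Φ : ℝ × ℝ → ℝ) (p : ℝ × ℝ) : ℝ := fderiv ℝ Φ p (0, 1)

lemma continuous_partialFst {Φ : ℝ × ℝ → ℝ} (hΦ : ContDiff ℝ 1 Φ) :
    Continuous (partialFst Φ) :=
  (hΦ.continuous_fderiv one_ne_zero).clm_apply continuous_const

lemma continuous_partialSnd {Φ : ℝ × ℝ → ℝ} (hΦ : ContDiff ℝ 1 Φ) :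
    Continuous (partialSnd Φ) :=
  (hΦ.continuous_fderiv one_ne_zero).clm_apply continuous_const

lemma fderiv_apply_eq_partial (Φ : ℝ × ℝ → ℝ) (p : ℝ × ℝ) (a b : ℝ) :
    fderiv ℝ Φ p (a, b) = partialFst Φ p * a + partialSnd Φ p * b := by
  have : ((a, b) : ℝ × ℝ) = a • (1, 0) + b • (0, 1) := by simp
  rw [this, map_add, map_smul, map_smul, partialFst, partialSnd, smul_eq_mul, smul_eq_mul]
  ring

section LinearCombination

variable {E : Type*} [NormedAddCommGroup E] [NormedSpace ℝ E] {g₁ g₂ : E → ℝ}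

lemma fderiv_linear_combination (h₁ : ContDiff ℝ 2 g₁) (h₂ : ContDiff ℝ 2 g₂) (a b : ℝ) (x : E) :
    fderiv ℝ (fun y => a * g₁ y + b * g₂ y) x = a • fderiv ℝ g₁ x + b • fderiv ℝ g₂ x := by
  have d₁ := (h₁.differentiable two_ne_zero) x
  have d₂ := (h₂.differentiable two_ne_zero) x
  exact ((d₁.hasFDerivAt.const_mul a).add (d₂.hasFDerivAt.const_mul b)).fderiv

lemma iteratedFDeriv_linear_combination (h₁ : ContDiff ℝ 2 g₁) (h₂ : ContDiff ℝ 2 g₂)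
    (a b : ℝ) (x : E) :
    iteratedFDeriv ℝ 2 (fun y => a * g₁ y + b * g₂ y) x =
      a • iteratedFDeriv ℝ 2 g₁ x + b • iteratedFDeriv ℝ 2 g₂ x := by
  have e : (fun y => a * g₁ y + b * g₂ y) = a • g₁ + b • g₂ := rfl
  have s₁ : ContDiff ℝ 2 (a • g₁) := h₁.const_smul a
  have s₂ : ContDiff ℝ 2 (b • g₂) := h₂.const_smul b
  rw [e, iteratedFDeriv_add_apply s₁.contDiffAt s₂.contDiffAt,
    iteratedFDeriv_const_smul_apply h₁.contDiffAt, iteratedFDeriv_const_smul_apply h₂.contDiffAt]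

end LinearCombination

lemma norm_linear_combination_le {G : Type*} [NormedAddCommGroup G] [NormedSpace ℝ G]
    {a b A B : ℝ} {x y : G} {M N : ℝ} (ha : ‖a‖ ≤ A) (hb : ‖b‖ ≤ B) (hx : ‖x‖ ≤ M)
    (hy : ‖y‖ ≤ N) : ‖a • x + b • y‖ ≤ A * M + B * N := by
  refine (norm_add_le _ _).trans ?_
  rw [norm_smul, norm_smul]
  have := (norm_nonneg a).trans ha
  have := (norm_nonneg b).trans hb
  gcongr

/-- Condition (A1) is stable under composition with a `C¹` function of two variables. -/
def A1Data.comp₂ {d : ℕ} {T : ℝ} (P Q : A1Data d T) (Φ : ℝ × ℝ → ℝ) (hΦ : ContDiff ℝ 1 Φ) :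
    A1Data d T where
  F t m := Φ (P.F t m, Q.F t m)
  δF t m x := partialFst Φ (P.F t m, Q.F t m) * P.δF t m x +
    partialSnd Φ (P.F t m, Q.F t m) * Q.δF t m x
  bddF := by
    obtain ⟨c₁, h₁⟩ := P.bddF
    obtain ⟨c₂, h₂⟩ := Q.bddF
    obtain ⟨c, hc⟩ := (isCompact_Icc.prod isCompact_Icc : IsCompact
      (Set.Icc (-c₁) c₁ ×ˢ Set.Icc (-c₂) c₂)).exists_bound_of_continuousOn
        hΦ.continuous.continuousOn
    exact ⟨c, fun t ht m hm => hc _ ⟨abs_le.1 (h₁ t ht m hm), abs_le.1 (h₂ t ht m hm)⟩⟩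
  contF t ht m hm := (tendsto_nhdsD1_iff (u := fun t m => Φ (P.F t m, Q.F t m))).1
    ((hΦ.continuous.tendsto _).comp ((P.tendsto_F ht hm).prodMk_nhds (Q.tendsto_F ht hm)))
  measDeriv t ht m hm m' hm' := by
    have := hm'.1
    have hP := P.hasDerivWithinAt_segment ht hm hm'
    have hQ := Q.hasDerivWithinAt_segment ht hm hm'
    have hd := (hΦ.differentiable one_ne_zero (P.F t m, Q.F t m)).hasFDerivAt
    have key := HasFDerivAt.comp_hasDerivWithinAt_of_eq (0 : ℝ) hd (hP.prodMk hQ) (by simp)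
    rw [hasDerivWithinAt_iff_tendsto_slope' (by simp), fderiv_apply_eq_partial] at key
    rw [integral_add ((P.integrable_δF ht hm m').const_mul _)
      ((Q.integrable_δF ht hm m').const_mul _), integral_const_mul, integral_const_mul]
    refine key.congr fun r => ?_
    simp [slope_def_field]
  normalized t ht m hm := by
    have := hm.1
    rw [integral_add ((P.integrable_δF ht hm m).const_mul _)
      ((Q.integrable_δF ht hm m).const_mul _), integral_const_mul, integral_const_mul,
      P.normalized t ht m hm, Q.normalized t ht m hm]
    simp
  smoothX t ht m hm := (contDiff_const.mul (P.smoothX t ht m hm)).add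
    (contDiff_const.mul (Q.smoothX t ht m hm))
  bddDeriv := by
    obtain ⟨c₁, h₁⟩ := P.bddF
    obtain ⟨c₂, h₂⟩ := Q.bddF
    obtain ⟨M, hM⟩ := P.bddDeriv
    obtain ⟨N, hN⟩ := Q.bddDeriv
    have hK : IsCompact (Set.Icc (-c₁) c₁ ×ˢ Set.Icc (-c₂) c₂) := isCompact_Icc.prod isCompact_Icc
    obtain ⟨A, hA⟩ := hK.exists_bound_of_continuousOn (continuous_partialFst hΦ).continuousOn
    obtain ⟨B, hB⟩ := hK.exists_bound_of_continuousOn (continuous_partialSnd hΦ).continuousOn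
    refine ⟨A * M + B * N, fun t ht m hm x => ?_⟩
    have hp : (P.F t m, Q.F t m) ∈ Set.Icc (-c₁) c₁ ×ˢ Set.Icc (-c₂) c₂ :=
      ⟨abs_le.1 (h₁ t ht m hm), abs_le.1 (h₂ t ht m hm)⟩
    have sP := P.smoothX t ht m hm
    have sQ := Q.smoothX t ht m hm
    rw [fderiv_linear_combination sP sQ, iteratedFDeriv_linear_combination sP sQ]
    obtain ⟨hM0, hM1, hM2⟩ := hM t ht m hm x
    obtain ⟨hN0, hN1, hN2⟩ := hN t ht m hm x
    exact ⟨norm_linear_combination_le (G := ℝ) (hA _ hp) (hB _ hp) hM0 hN0,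
      norm_linear_combination_le (hA _ hp) (hB _ hp) hM1 hN1,
      norm_linear_combination_le (hA _ hp) (hB _ hp) hM2 hN2⟩
  contDeriv t ht m hm x := by
    have hF : Tendsto (fun p : (ℝ × Measure (Ed d)) × Ed d =>
        (P.F p.1.1 p.1.2, Q.F p.1.1 p.1.2)) (nhdsD1 d T t m ×ˢ 𝓝 x)
        (𝓝 (P.F t m, Q.F t m)) :=
      ((P.tendsto_F ht hm).prodMk_nhds (Q.tendsto_F ht hm)).comp tendsto_fst
    have h₁ := ((continuous_partialFst hΦ).tendsto _).comp hF
    have h₂ := ((continuous_partialSnd hΦ).tendsto _).comp hF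
    have hev : ∀ᶠ p : (ℝ × Measure (Ed d)) × Ed d in nhdsD1 d T t m ×ˢ 𝓝 x,
        p.1.1 ∈ Set.Icc 0 T ∧ MemP d 2 p.1.2 := by
      filter_upwards [(nhdsD1_prod_hasBasis d T t m x).mem_of_mem one_pos] with p hp
      exact ⟨hp.1.1, hp.1.2.1⟩
    refine contDeriv_of_tendsto ?_ ?_ ?_
    · exact (h₁.mul (P.tendsto_δF ht hm x)).add (h₂.mul (Q.tendsto_δF ht hm x))
    · rw [fderiv_linear_combination (P.smoothX t ht m hm) (Q.smoothX t ht m hm)]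
      refine ((h₁.smul (P.tendsto_fderiv_δF ht hm x)).add
        (h₂.smul (Q.tendsto_fderiv_δF ht hm x))).congr' ?_
      filter_upwards [hev] with p hp
      exact (fderiv_linear_combination (P.smoothX _ hp.1 _ hp.2) (Q.smoothX _ hp.1 _ hp.2)
        _ _ _).symm
    · rw [iteratedFDeriv_linear_combination (P.smoothX t ht m hm) (Q.smoothX t ht m hm)]
      refine ((h₁.smul (P.tendsto_iteratedFDeriv_δF ht hm x)).add
        (h₂.smul (Q.tendsto_iteratedFDeriv_δF ht hm x))).congr' ?_
      filter_upwards [hev] with p hp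
      exact (iteratedFDeriv_linear_combination (P.smoothX _ hp.1 _ hp.2)
        (Q.smoothX _ hp.1 _ hp.2) _ _ _).symm

/-! ### Linear functionals with smooth compactly supported integrand -/

lemma abs_integral_le_of_forall_abs_le {X : Type*} [MeasurableSpace X] {m : Measure X}
    [IsProbabilityMeasure m] {g : X → ℝ} {c : ℝ} (hg : ∀ x, |g x| ≤ c) : |∫ x, g x ∂m| ≤ c := by
  simpa using norm_integral_le_of_norm_le_const (μ := m) (f := g) (ae_of_all _ hg)

lemma integrable_norm_of_memP_two {d : ℕ} {m : Measure (Ed d)} (hm : MemP d 2 m) :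
    Integrable (fun x => ‖x‖) m := by
  have := hm.1
  refine ((integrable_const (1 : ℝ)).add hm.2).mono' continuous_norm.aestronglyMeasurable
    (ae_of_all _ fun x => ?_)
  simp only [norm_norm, Pi.add_apply, Real.rpow_two]
  nlinarith [sq_nonneg (‖x‖ - 1)]

/-- The easy half of Kantorovich duality. -/
lemma abs_integral_sub_le_wdist {d : ℕ} {m m' : Measure (Ed d)} (hm : MemP d 2 m)
    (hm' : MemP d 2 m') {g : Ed d → ℝ} (hg : Continuous g) {c : ℝ} (hc : ∀ x, |g x| ≤ c)
    {L : ℝ} (hL : 0 < L) (hgL : ∀ x y, |g x - g y| ≤ L * ‖x - y‖) :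
    |∫ x, g x ∂m - ∫ x, g x ∂m'| ≤ L * wdist d 1 m m' := by
  have := hm.1
  have := hm'.1
  rw [mul_comm, ← div_le_iff₀ hL]
  refine le_csInf ⟨_, m.prod m', inferInstance, ⟨by simp, by simp⟩, rfl⟩ ?_
  rintro _ ⟨γ, hγ, ⟨h₁, h₂⟩, rfl⟩
  rw [div_le_iff₀ hL, mul_comm]
  simp only [Real.rpow_one, div_one]
  have i₁ : Integrable (fun q : Ed d × Ed d => ‖q.1‖) γ := by
    have := integrable_norm_of_memP_two hm
    rw [← h₁] at this
    exact this.comp_measurable measurable_fst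
  have i₂ : Integrable (fun q : Ed d × Ed d => ‖q.2‖) γ := by
    have := integrable_norm_of_memP_two hm'
    rw [← h₂] at this
    exact this.comp_measurable measurable_snd
  have i : Integrable (fun q : Ed d × Ed d => ‖q.1 - q.2‖) γ :=
    (i₁.add i₂).mono' (by fun_prop) (ae_of_all _ fun q => by simpa using norm_sub_le q.1 q.2)
  have j₁ : Integrable (fun q : Ed d × Ed d => g q.1) γ :=
    Integrable.of_bound (by fun_prop) c (ae_of_all _ fun q => hc _)
  have j₂ : Integrable (fun q : Ed d × Ed d => g q.2) γ :=
    Integrable.of_bound (by fun_prop) c (ae_of_all _ fun q => hc _)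
  have e₁ : ∫ x, g x ∂m = ∫ q, g q.1 ∂γ := by
    rw [← h₁, integral_map measurable_fst.aemeasurable hg.aestronglyMeasurable]
  have e₂ : ∫ x, g x ∂m' = ∫ q, g q.2 ∂γ := by
    rw [← h₂, integral_map measurable_snd.aemeasurable hg.aestronglyMeasurable]
  rw [e₁, e₂, ← integral_sub j₁ j₂, ← integral_const_mul]
  exact norm_integral_le_of_norm_le (f := fun q : Ed d × Ed d => g q.1 - g q.2) (i.const_mul L)
    (ae_of_all _ fun q => hgL q.1 q.2)

section Slice

variable {d : ℕ} {h : ℝ × Ed d → ℝ}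

lemma contDiff_slice (hh : ContDiff ℝ 2 h) (t : ℝ) : ContDiff ℝ 2 fun x => h (t, x) := by
  fun_prop

lemma fderiv_slice_sub_const (hh : ContDiff ℝ 2 h) (t c : ℝ) (x : Ed d) :
    fderiv ℝ (fun y => h (t, y) - c) x =
      (fderiv ℝ h (t, x)).comp (ContinuousLinearMap.inr ℝ ℝ (Ed d)) := by
  rw [fderiv_sub_const]
  exact ((hh.differentiable two_ne_zero (t, x)).hasFDerivAt.comp x
    (hasFDerivAt_prodMk_right t x)).fderiv

lemma iteratedFDeriv_slice_sub_const (hh : ContDiff ℝ 2 h) (t c : ℝ) (x : Ed d) :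
    iteratedFDeriv ℝ 2 (fun y => h (t, y) - c) x =
      ContinuousMultilinearMap.compContinuousLinearMapL
        (fun _ : Fin 2 => ContinuousLinearMap.inr ℝ ℝ (Ed d)) (iteratedFDeriv ℝ 2 h (t, x)) := by
  have e : (fun y => h (t, y) - c) =
      ((fun z => h (z + (t, 0))) ∘ ContinuousLinearMap.inr ℝ ℝ (Ed d)) - fun _ => c := by
    ext y; simp
  have hs : ContDiff ℝ 2 fun z : ℝ × Ed d => h (z + (t, 0)) := by fun_prop
  rw [e, iteratedFDeriv_sub_apply (hs.comp (ContinuousLinearMap.contDiff _)).contDiffAt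
    contDiff_const.contDiffAt, iteratedFDeriv_const_of_ne two_ne_zero,
    ContinuousLinearMap.iteratedFDeriv_comp_right _ hs x le_rfl, iteratedFDeriv_comp_add_right]
  simp

variable {T : ℝ}

lemma exists_lipschitz_const (hh : ContDiff ℝ 2 h) (hc : HasCompactSupport h) :
    ∃ L > (0 : ℝ), ∀ p q, |h p - h q| ≤ L * ‖p - q‖ := by
  obtain ⟨L, hL⟩ := hh.lipschitzWith_of_hasCompactSupport hc two_ne_zero
  refine ⟨L + 1, by positivity, fun p q => ?_⟩
  have := hL.dist_le_mul p q
  rw [dist_eq_norm, dist_eq_norm, Real.norm_eq_abs] at this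
  nlinarith [norm_nonneg (p - q)]

lemma integrable_slice (hh : ContDiff ℝ 2 h) (hc : HasCompactSupport h) (t : ℝ)
    (m : Measure (Ed d)) [IsFiniteMeasure m] : Integrable (fun x => h (t, x)) m := by
  obtain ⟨c, h_bd⟩ := hc.exists_bound_of_continuous hh.continuous
  exact Integrable.of_bound (contDiff_slice hh t).continuous.aestronglyMeasurable c
    (ae_of_all _ fun x => h_bd _)

lemma tendsto_integral_slice (hh : ContDiff ℝ 2 h) (hc : HasCompactSupport h) {t : ℝ}
    {m : Measure (Ed d)} (hm : MemP d 2 m) :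
    Tendsto (fun p : ℝ × Measure (Ed d) => ∫ x, h (p.1, x) ∂p.2) (nhdsD1 d T t m)
      (𝓝 (∫ x, h (t, x) ∂m)) := by
  refine (tendsto_nhdsD1_iff (u := fun t m => ∫ x, h (t, x) ∂m)).2 fun ε hε => ?_
  obtain ⟨L, hL, hLip⟩ := exists_lipschitz_const hh hc
  obtain ⟨c, h_bd⟩ := hc.exists_bound_of_continuous hh.continuous
  refine ⟨ε / (2 * L), by positivity, fun t' ht' m' hm' h₁ h₂ => ?_⟩
  have := hm'.1
  have a₁ : |∫ x, h (t', x) ∂m' - ∫ x, h (t, x) ∂m'| ≤ L * |t' - t| := by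
    rw [← integral_sub (integrable_slice hh hc _ _) (integrable_slice hh hc _ _)]
    refine abs_integral_le_of_forall_abs_le fun x => ?_
    simpa [Prod.norm_def] using hLip (t', x) (t, x)
  have a₂ : |∫ x, h (t, x) ∂m - ∫ x, h (t, x) ∂m'| ≤ L * wdist d 1 m m' :=
    abs_integral_sub_le_wdist hm hm' (contDiff_slice hh t).continuous (fun x => h_bd (t, x)) hL
      fun x y => by simpa [Prod.norm_def] using hLip (t, x) (t, y)
  rw [abs_sub_comm] at a₂
  rw [lt_div_iff₀ (by positivity)] at h₁ h₂
  have := abs_sub_le (∫ x, h (t', x) ∂m') (∫ x, h (t, x) ∂m') (∫ x, h (t, x) ∂m)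
  nlinarith

/-- The functional `(t,m) ↦ ∫ h(t,x) dm(x)` satisfies (A1) when `h` is `C²` with compact
support. -/
def A1Data.ofSmooth (T : ℝ) (h : ℝ × Ed d → ℝ) (hh : ContDiff ℝ 2 h)
    (hc : HasCompactSupport h) : A1Data d T where
  F t m := ∫ x, h (t, x) ∂m
  δF t m x := h (t, x) - ∫ y, h (t, y) ∂m
  bddF := by
    obtain ⟨c, h_bd⟩ := hc.exists_bound_of_continuous hh.continuous
    refine ⟨c, fun t _ m hm => ?_⟩
    have := hm.1
    exact abs_integral_le_of_forall_abs_le fun x => h_bd (t, x)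
  contF t _ m hm := (tendsto_nhdsD1_iff (u := fun t m => ∫ x, h (t, x) ∂m)).1
    (tendsto_integral_slice hh hc hm)
  measDeriv t _ m hm m' hm' := by
    have := hm.1
    have := hm'.1
    rw [integral_sub (integrable_slice hh hc t m') (integrable_const _)]
    refine tendsto_const_nhds.congr' ?_
    filter_upwards [Ioo_mem_nhdsGT (one_pos (α := ℝ))] with r hr
    have e : (1 - ENNReal.ofReal r : ℝ≥0∞) = ENNReal.ofReal (1 - r) := by
      rw [ENNReal.ofReal_sub _ hr.1.le, ENNReal.ofReal_one]
    rw [e, integral_add_measure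
      ((integrable_slice hh hc t m).smul_measure ENNReal.ofReal_ne_top)
      ((integrable_slice hh hc t m').smul_measure ENNReal.ofReal_ne_top),
      integral_smul_measure, integral_smul_measure, ENNReal.toReal_ofReal hr.1.le,
      ENNReal.toReal_ofReal (by linarith [hr.2]), eq_div_iff hr.1.ne']
    simp
    ring
  normalized t _ m hm := by
    have := hm.1
    rw [integral_sub (integrable_slice hh hc t m) (integrable_const _)]
    simp
  smoothX t _ m _ := (contDiff_slice hh t).sub contDiff_const
  bddDeriv := by
    obtain ⟨c₀, b₀⟩ := hc.exists_bound_of_continuous hh.continuous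
    obtain ⟨c₁, b₁⟩ := (hc.fderiv ℝ).exists_bound_of_continuous
      (hh.continuous_fderiv two_ne_zero)
    obtain ⟨c₂, b₂⟩ := (hc.iteratedFDeriv (𝕜 := ℝ) 2).exists_bound_of_continuous
      (hh.continuous_iteratedFDeriv le_rfl)
    set A := ContinuousMultilinearMap.compContinuousLinearMapL (𝕜 := ℝ) (F := ℝ)
      (fun _ : Fin 2 => ContinuousLinearMap.inr ℝ ℝ (Ed d))
    refine ⟨max (c₀ + c₀) (max (c₁ * ‖ContinuousLinearMap.inr ℝ ℝ (Ed d)‖) (‖A‖ * c₂)),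
      fun t _ m hm x => ⟨le_max_of_le_left ?_, le_max_of_le_right (le_max_of_le_left ?_),
        le_max_of_le_right (le_max_of_le_right ?_)⟩⟩
    · have := hm.1
      have hF : |∫ y, h (t, y) ∂m| ≤ c₀ :=
        abs_integral_le_of_forall_abs_le fun x => b₀ (t, x)
      exact (abs_sub _ _).trans (add_le_add (b₀ _) hF)
    · rw [fderiv_slice_sub_const hh]
      exact (ContinuousLinearMap.opNorm_comp_le _ _).trans (by gcongr; exact b₁ _)
    · rw [iteratedFDeriv_slice_sub_const hh]
      exact (A.le_opNorm _).trans (by gcongr; exact b₂ _)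
  contDeriv t _ m hm x := by
    have hpt : Tendsto (fun p : (ℝ × Measure (Ed d)) × Ed d => (p.1.1, p.2))
        (nhdsD1 d T t m ×ˢ 𝓝 x) (𝓝 (t, x)) :=
      ((tendsto_fst_nhdsD1 d T t m).comp tendsto_fst).prodMk_nhds tendsto_snd
    refine contDeriv_of_tendsto ?_ ?_ ?_
    · exact ((hh.continuous.tendsto _).comp hpt).sub
        ((tendsto_integral_slice hh hc hm).comp tendsto_fst)
    · simp only [fderiv_slice_sub_const hh]
      exact (((hh.continuous_fderiv two_ne_zero).clm_comp continuous_const).tendsto _).comp hpt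
    · simp only [iteratedFDeriv_slice_sub_const hh]
      exact (((ContinuousLinearMap.continuous _).comp
        (hh.continuous_iteratedFDeriv le_rfl)).tendsto _).comp hpt

end Slice

/-! ### Uniform approximation on balls of `𝒫₂` -/

/-- `G` is a uniform limit, on `[0,T] × {m ∈ 𝒫₂ : |m|₂² ≤ K}`, of functionals satisfying
(A1). -/
def SmoothApproximable (d : ℕ) (T K : ℝ) (G : ℝ → Measure (Ed d) → ℝ) : Prop :=
  ∀ ε > (0 : ℝ), ∃ P : A1Data d T, ∀ t ∈ Set.Icc 0 T, ∀ m : Measure (Ed d), MemP d 2 m →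
    (∫ x, ‖x‖ ^ 2 ∂m) ≤ K → |G t m - P.F t m| ≤ ε

/-- `√(x² + η²)` is a smooth approximation of `|x|`. -/
lemma abs_abs_sub_sqrt_le {η : ℝ} (hη : 0 < η) (x : ℝ) : |(|x| - √(x ^ 2 + η ^ 2))| ≤ η := by
  have h₁ : |x| ≤ √(x ^ 2 + η ^ 2) := Real.abs_le_sqrt (by nlinarith)
  have h₂ : √(x ^ 2 + η ^ 2) ≤ |x| + η := by
    rw [Real.sqrt_le_left (by positivity)]
    nlinarith [sq_abs x, abs_nonneg x]
  rw [abs_le]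
  constructor <;> linarith

lemma contDiff_sqrt_sub {η : ℝ} (hη : 0 < η) (s : ℝ) :
    ContDiff ℝ 1 fun p : ℝ × ℝ => (p.1 + p.2 + s * √((p.1 - p.2) ^ 2 + η ^ 2)) / 2 := by
  have : ContDiff ℝ 1 fun p : ℝ × ℝ => √((p.1 - p.2) ^ 2 + η ^ 2) :=
    ContDiff.sqrt (by fun_prop) fun p => by positivity
  fun_prop

lemma abs_half_add_abs_sub_le {s a b a' b' η : ℝ} (hs : |s| = 1) (hη : 0 < η)
    (ha : |a - a'| ≤ η) (hb : |b - b'| ≤ η) :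
    |(a + b + s * |a - b|) / 2 - (a' + b' + s * √((a' - b') ^ 2 + η ^ 2)) / 2| ≤ 3 * η := by
  have h₁ := abs_abs_sub_sqrt_le hη (a' - b')
  have h₂ := abs_abs_sub_abs_le (a - b) (a' - b')
  have h₃ : |a - b - (a' - b')| ≤ 2 * η := by
    rw [abs_le] at *
    constructor <;> linarith
  have h₄ : |s * (|a - b| - √((a' - b') ^ 2 + η ^ 2))| ≤ 3 * η := by
    rw [abs_mul, hs, one_mul]
    have := abs_sub_le (|a - b|) (|a' - b'|) (√((a' - b') ^ 2 + η ^ 2))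
    linarith
  rw [abs_le] at *
  constructor <;> linarith

lemma SmoothApproximable.half_add_abs_sub {d : ℕ} {T K : ℝ} {G₁ G₂ : ℝ → Measure (Ed d) → ℝ}
    (h₁ : SmoothApproximable d T K G₁) (h₂ : SmoothApproximable d T K G₂) {s : ℝ}
    (hs : |s| = 1) :
    SmoothApproximable d T K fun t m => (G₁ t m + G₂ t m + s * |G₁ t m - G₂ t m|) / 2 := by
  intro ε hε
  obtain ⟨P, hP⟩ := h₁ (ε / 3) (by positivity)
  obtain ⟨Q, hQ⟩ := h₂ (ε / 3) (by positivity)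
  refine ⟨P.comp₂ Q _ (contDiff_sqrt_sub (η := ε / 3) (by positivity) s),
    fun t ht m hm hK => ?_⟩
  have := abs_half_add_abs_sub_le hs (by positivity) (hP t ht m hm hK) (hQ t ht m hm hK)
  exact this.trans (by linarith)

lemma SmoothApproximable.sup {d : ℕ} {T K : ℝ} {G₁ G₂ : ℝ → Measure (Ed d) → ℝ}
    (h₁ : SmoothApproximable d T K G₁) (h₂ : SmoothApproximable d T K G₂) :
    SmoothApproximable d T K (G₁ ⊔ G₂) := by
  convert h₁.half_add_abs_sub h₂ (s := 1) (by simp) using 3 with t m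
  simp only [Pi.sup_apply]
  rw [one_mul, max_def, abs_sub_comm]
  split_ifs with h
  · rw [abs_of_nonneg (by linarith)]; ring
  · rw [abs_of_nonpos (by linarith)]; ring

lemma SmoothApproximable.inf {d : ℕ} {T K : ℝ} {G₁ G₂ : ℝ → Measure (Ed d) → ℝ}
    (h₁ : SmoothApproximable d T K G₁) (h₂ : SmoothApproximable d T K G₂) :
    SmoothApproximable d T K (G₁ ⊓ G₂) := by
  convert h₁.half_add_abs_sub h₂ (s := -1) (by simp) using 3 with t m
  simp only [Pi.inf_apply]
  rw [min_def, abs_sub_comm]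
  split_ifs with h
  · rw [abs_of_nonneg (by linarith)]; ring
  · rw [abs_of_nonpos (by linarith)]; ring

lemma abs_integral_le_of_quadratic {d : ℕ} {K a b : ℝ} (hb : 0 ≤ b) {m : Measure (Ed d)}
    (hm : MemP d 2 m) (hK : (∫ x, ‖x‖ ^ 2 ∂m) ≤ K) {g : Ed d → ℝ}
    (hg : ∀ x, |g x| ≤ a + b * ‖x‖ ^ 2) : |∫ x, g x ∂m| ≤ a + b * K := by
  have := hm.1
  have hi : Integrable (fun x => ‖x‖ ^ 2) m := by simpa using hm.2
  refine (norm_integral_le_of_norm_le (f := g) ((integrable_const a).add (hi.const_mul b))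
    (ae_of_all _ hg)).trans ?_
  rw [integral_add' (integrable_const a) (hi.const_mul b), integral_const_mul]
  simp only [integral_const, probReal_univ, one_smul]
  gcongr

/-- A bound on the ball of radius `R` and a global bound combine into a quadratic bound. -/
lemma le_add_mul_sq {y a b r R : ℝ} (hb : 0 ≤ b) (hR : 0 < R)
    (h_in : r ≤ R → y ≤ a) (h_out : y ≤ a + b) : y ≤ a + b / R ^ 2 * r ^ 2 := by
  rcases le_or_gt r R with h | h
  · exact (h_in h).trans (le_add_of_nonneg_right (by positivity))
  · refine h_out.trans (add_le_add_right ?_ a)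
    rw [div_mul_eq_mul_div, le_div_iff₀ (by positivity)]
    gcongr

lemma exists_radius_div_sq_le (b K r₀ : ℝ) {ε : ℝ} (hε : 0 < ε) :
    ∃ R > 0, r₀ ≤ R ∧ b / R ^ 2 * K ≤ ε := by
  have h : Tendsto (fun R : ℝ => b / R ^ 2 * K) atTop (𝓝 0) := by
    simpa using (tendsto_const_nhds.div_atTop (tendsto_pow_atTop two_ne_zero)).mul_const K
  obtain ⟨R, hR, h₀, h₁⟩ := ((h.eventually_le_const hε).and
    ((eventually_gt_atTop 0).and (eventually_ge_atTop r₀))).exists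
  exact ⟨R, h₀, h₁, hR⟩

lemma smoothApproximable_integral {d : ℕ} {T K C : ℝ} {g : ℝ × Ed d → ℝ}
    (hbdd : ∀ p, |g p| ≤ C) (hg : UniformContinuous g) :
    SmoothApproximable d T K fun t m => ∫ x, g (t, x) ∂m := by
  intro ε hε
  have hC : 0 ≤ C := (abs_nonneg _).trans (hbdd 0)
  obtain ⟨h, hh, hgh⟩ := hg.exists_contDiff_dist_le (half_pos hε)
  obtain ⟨R, hR, hTR, hRK⟩ := exists_radius_div_sq_le (2 * C) K T (half_pos hε)
  let χ : ContDiffBump (0 : ℝ × Ed d) := ⟨R, R + 1, hR, by linarith⟩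
  have hs : ContDiff ℝ 2 (fun p => χ p * h p) := χ.contDiff.mul (hh.of_le (mod_cast le_top))
  have hcs : HasCompactSupport (fun p => χ p * h p) := χ.hasCompactSupport.mul_right
  refine ⟨A1Data.ofSmooth T _ hs hcs, fun t ht m hm hK => ?_⟩
  have := hm.1
  have hi : Integrable (fun x => g (t, x)) m :=
    Integrable.of_bound (hg.continuous.comp (by fun_prop)).aestronglyMeasurable C
      (ae_of_all _ fun x => hbdd _)
  change |∫ x, g (t, x) ∂m - ∫ x, χ (t, x) * h (t, x) ∂m| ≤ ε
  rw [← integral_sub hi (integrable_slice hs hcs t m)]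
  refine (abs_integral_le_of_quadratic (a := ε / 2) (b := 2 * C / R ^ 2) (by positivity) hm hK
    fun x => le_add_mul_sq (by positivity) hR (fun hx => ?_) ?_).trans
    (by linarith)
  · have : (t, x) ∈ Metric.closedBall (0 : ℝ × Ed d) R := by
      rw [mem_closedBall_zero_iff, Prod.norm_def, max_le_iff, Real.norm_eq_abs,
        abs_of_nonneg ht.1]
      exact ⟨ht.2.trans hTR, hx⟩
    rw [χ.one_of_mem_closedBall this, one_mul, abs_sub_comm]
    exact (hgh (t, x)).le
  · have e : g (t, x) - χ (t, x) * h (t, x) =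
        (1 - χ (t, x)) * g (t, x) + χ (t, x) * (g (t, x) - h (t, x)) := by ring
    have h₀ := χ.nonneg (x := (t, x))
    have h₁ := χ.le_one (x := (t, x))
    have h₂ := (hgh (t, x)).le
    rw [dist_comm, Real.dist_eq] at h₂
    rw [e]
    refine (abs_add_le _ _).trans ?_
    rw [abs_mul, abs_mul, abs_of_nonneg h₀, abs_of_nonneg (sub_nonneg.2 h₁)]
    nlinarith [hbdd (t, x), mul_le_mul (sub_le_self 1 h₀) (hbdd (t, x)) (abs_nonneg _) zero_le_one,
      mul_le_mul h₁ h₂ (abs_nonneg _) zero_le_one]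

/-! ### Reduction to finitely many controls -/

lemma abs_iInf_iSup_sub_inf'_sup'_le {A B : Type*} [Nonempty A] [Nonempty B] {I : A → B → ℝ}
    {C δ : ℝ} (hC : ∀ u v, |I u v| ≤ C) {U : Finset A} {V : Finset B} (hU : U.Nonempty)
    (hV : V.Nonempty) (hIU : ∀ u, ∃ u' ∈ U, ∀ v, |I u v - I u' v| ≤ δ)
    (hIV : ∀ v, ∃ v' ∈ V, ∀ u, |I u v - I u v'| ≤ δ) :
    |(⨅ u, ⨆ v, I u v) - U.inf' hU fun u => V.sup' hV fun v => I u v| ≤ δ := by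
  have ba : ∀ u, BddAbove (Set.range (I u)) := fun u =>
    ⟨C, by rintro _ ⟨v, rfl⟩; exact (abs_le.1 (hC u v)).2⟩
  have bb : BddBelow (Set.range fun u => ⨆ v, I u v) := by
    refine ⟨-C, ?_⟩
    rintro _ ⟨u, rfl⟩
    obtain ⟨v⟩ := ‹Nonempty B›
    exact (abs_le.1 (hC u v)).1.trans (le_ciSup (ba u) v)
  rw [abs_sub_le_iff]
  constructor
  · rw [sub_le_iff_le_add, ← sub_le_iff_le_add']
    refine Finset.le_inf' _ _ fun u hu => ?_
    rw [sub_le_iff_le_add']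
    refine (ciInf_le bb u).trans (ciSup_le fun v => ?_)
    obtain ⟨v', hv', h⟩ := hIV v
    have := Finset.le_sup' (fun v => I u v) hv'
    linarith [(abs_le.1 (h u)).2]
  · rw [sub_le_iff_le_add, ← sub_le_iff_le_add']
    refine le_ciInf fun u => ?_
    rw [sub_le_iff_le_add']
    obtain ⟨u', hu', h⟩ := hIU u
    refine (Finset.inf'_le _ hu').trans (Finset.sup'_le _ _ fun v _ => ?_)
    have := le_ciSup (ba u) v
    linarith [(abs_le.1 (h v)).1]

lemma exists_finset_dist_lt (X : Type*) [MetricSpace X] [CompactSpace X] [Nonempty X] {η : ℝ}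
    (hη : 0 < η) : ∃ S : Finset X, S.Nonempty ∧ ∀ x, ∃ y ∈ S, dist x y < η := by
  obtain ⟨S, -, hS, hcov⟩ := finite_cover_balls_of_compact (isCompact_univ (X := X)) hη
  have key : ∀ x, ∃ y ∈ hS.toFinset, dist x y < η := fun x => by
    simpa using hcov (mem_univ x)
  obtain ⟨y, hy, -⟩ := key (Classical.arbitrary X)
  exact ⟨hS.toFinset, ⟨y, hy⟩, key⟩

/-- For any `K > 0` and `ε > 0` there exists `H̃ : [0,T] × 𝒫₂ → ℝ`
satisfying (A1) such that `|H(t,m) − H̃(t,m)| ≤ ε` for all `t ∈ [0,T]` and all `m ∈ 𝒫₂`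
with `|m|₂² ≤ K`. -/
theorem hamiltonian_smooth_approx (d : ℕ) (T : ℝ) (hT : 0 ≤ T)
    {A B : Type} [MetricSpace A] [CompactSpace A] [Nonempty A]
    [MetricSpace B] [CompactSpace B] [Nonempty B]
    (f : ℝ → Ed d → A → B → ℝ) (C : ℝ)
    (hfbdd : ∀ s x u v, |f s x u v| ≤ C)
    (hfcont : Continuous fun q : ℝ × Ed d × A × B => f q.1 q.2.1 q.2.2.1 q.2.2.2)
    (hflip : ∀ (u : A) (v : B), ∀ s s' : ℝ, ∀ x x' : Ed d,
      |f s x u v - f s' x' u v| ≤ C * (‖x - x'‖ + |s - s'|))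
    (hIsaacs : ∀ s ∈ Set.Icc 0 T, ∀ μ : Measure (Ed d), MemP d 2 μ →
      (⨅ u : A, ⨆ v : B, ∫ x, f s x u v ∂μ) = ⨆ v : B, ⨅ u : A, ∫ x, f s x u v ∂μ)
    (K : ℝ) (hK : 0 < K) (ε : ℝ) (hε : 0 < ε) :
    ∃ HD : A1Data d T, ∀ t ∈ Set.Icc 0 T, ∀ m : Measure (Ed d), MemP d 2 m →
      (∫ x, ‖x‖ ^ 2 ∂m) ≤ K → |hamiltonian f t m - HD.F t m| ≤ ε := by
  have hC : 0 ≤ C :=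
    (abs_nonneg _).trans (hfbdd 0 0 (Classical.arbitrary A) (Classical.arbitrary B))
  have hsec : ∀ t u v, Continuous fun x => f t x u v := fun t u v =>
    hfcont.comp (f := fun x => (t, x, u, v)) (by fun_prop)
  have hint : ∀ (t : ℝ) (u : A) (v : B) (m : Measure (Ed d)), MemP d 2 m →
      Integrable (fun x => f t x u v) m := fun t u v m hm =>
    have := hm.1
    Integrable.of_bound (hsec t u v).aestronglyMeasurable C (ae_of_all _ fun x => hfbdd _ _ _ _)
  have happrox : ∀ u v, SmoothApproximable d T K fun t m => ∫ x, f t x u v ∂m := by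
    intro u v
    refine smoothApproximable_integral (g := fun p => f p.1 p.2 u v) (C := C)
      (fun p => hfbdd _ _ _ _) (LipschitzWith.uniformContinuous (K := (2 * C).toNNReal) ?_)
    refine LipschitzWith.of_dist_le_mul fun p q => ?_
    rw [Real.coe_toNNReal _ (by positivity), Real.dist_eq, dist_eq_norm, Prod.norm_def]
    refine (hflip u v p.1 q.1 p.2 q.2).trans ?_
    rw [mul_comm 2 C, mul_assoc]
    refine mul_le_mul_of_nonneg_left ?_ hC
    have h₁ := le_max_left ‖(p - q).1‖ ‖(p - q).2‖
    have h₂ := le_max_right ‖(p - q).1‖ ‖(p - q).2‖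
    simp only [Prod.fst_sub, Prod.snd_sub, Real.norm_eq_abs] at h₁ h₂ ⊢
    linarith
  obtain ⟨R, hR, -, hRK⟩ := exists_radius_div_sq_le (2 * C) K 0 (ε := ε / 4) (by positivity)
  have huc := ((isCompact_Icc (a := (0 : ℝ)) (b := T)).prod
    ((isCompact_closedBall (0 : Ed d) R).prod
      (isCompact_univ (X := A × B)))).uniformContinuousOn_of_continuous hfcont.continuousOn
  obtain ⟨η, hη, huc⟩ := Metric.uniformContinuousOn_iff_le.1 huc (ε / 4) (by positivity)
  have hclose : ∀ t ∈ Set.Icc 0 T, ∀ m : Measure (Ed d), MemP d 2 m →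
      (∫ x, ‖x‖ ^ 2 ∂m) ≤ K → ∀ (u u' : A) (v v' : B), dist u u' ≤ η → dist v v' ≤ η →
        |∫ x, f t x u v ∂m - ∫ x, f t x u' v' ∂m| ≤ ε / 2 := by
    intro t ht m hm hmK u u' v v' hu hv
    rw [← integral_sub (hint t u v m hm) (hint t u' v' m hm)]
    refine (abs_integral_le_of_quadratic (a := ε / 4) (b := 2 * C / R ^ 2) (by positivity) hm hmK
      fun x => le_add_mul_sq (by positivity) hR (fun hx => ?_) ?_).trans
      (by linarith)
    · have hx' : x ∈ Metric.closedBall (0 : Ed d) R := by simpa using hx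
      refine huc (t, x, u, v) ⟨ht, hx', mem_univ _⟩ (t, x, u', v') ⟨ht, hx', mem_univ _⟩ ?_
      simp [Prod.dist_eq, hu, hv]
    · have := abs_sub (f t x u v) (f t x u' v')
      linarith [hfbdd t x u v, hfbdd t x u' v']
  obtain ⟨U, hU, hUcov⟩ := exists_finset_dist_lt A hη
  obtain ⟨V, hV, hVcov⟩ := exists_finset_dist_lt B hη
  have hfin : SmoothApproximable d T K
      (U.inf' hU fun u => V.sup' hV fun v => fun t m => ∫ x, f t x u v ∂m) :=
    Finset.inf'_induction hU _ (fun _ h₁ _ h₂ => h₁.inf h₂) fun u _ =>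
      Finset.sup'_induction hV _ (fun _ h₁ _ h₂ => h₁.sup h₂) fun v _ => happrox u v
  obtain ⟨P, hP⟩ := hfin (ε / 2) (by positivity)
  refine ⟨P, fun t ht m hm hmK => ?_⟩
  have := hm.1
  have hPt := hP t ht m hm hmK
  simp only [Finset.inf'_apply, Finset.sup'_apply] at hPt
  have hH := abs_iInf_iSup_sub_inf'_sup'_le (I := fun u v => ∫ x, f t x u v ∂m) (C := C)
    (δ := ε / 2) (fun u v => abs_integral_le_of_forall_abs_le fun x => hfbdd t x u v) hU hV
    (fun u => by
      obtain ⟨u', hu', h⟩ := hUcov u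
      exact ⟨u', hu', fun v => hclose t ht m hm hmK u u' v v h.le (by simpa using hη.le)⟩)
    (fun v => by
      obtain ⟨v', hv', h⟩ := hVcov v
      exact ⟨v', hv', fun u => hclose t ht m hm hmK u u v v' (by simpa using hη.le) h.le⟩)
  have := abs_sub_le (hamiltonian f t m)
    (U.inf' hU fun u => V.sup' hV fun v => ∫ x, f t x u v ∂m) (P.F t m)
  unfold hamiltonian at *
  linarith

end
end

section
/- Suppose F : [0,T] × 𝒫₂ → ℝ satisfies (A1) and let U be a bounded, continuous subsolution of the equation ∂_t U(t,m) + (1/2) ∫_{ℝ^d} div[D_m U](t,m,x) dm(x) + F(t,m) = 0 on [0,T) × 𝒫₂. Then for all (t₀,m₀) ∈ [0,T] × 𝒫₂ and all s ∈ [t₀,T]: U(s, p^{t₀,m₀}_s) − U(t₀, m₀) + ∫_{t₀}^s F(r, p^{t₀,m₀}_r) dr ≥ 0. Moreover, the same inequality holds with F replaced by the Hamiltonian H (which need not satisfy (A1)) when U is a bounded continuous subsolution of the equation with source H. -/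
open MeasureTheory Filter Set
open scoped Topology ENNReal NNReal BoundedContinuousFunction

noncomputable section

/-- The second moment of a measure on `ℝ^d`. -/
def secondMoment (d : ℕ) (m : Measure (Ed d)) : ℝ := ∫ x, ‖x‖ ^ 2 ∂m

lemma secondMoment_nonneg (d : ℕ) (m : Measure (Ed d)) : 0 ≤ secondMoment d m :=
  integral_nonneg fun _ => by positivity

lemma memP_two_iff {d : ℕ} {m : Measure (Ed d)} :
    MemP d 2 m ↔ IsProbabilityMeasure m ∧ Integrable (fun x => ‖x‖ ^ 2) m := by
  simp only [MemP, Real.rpow_two]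

lemma MemP.integrable_sq {d : ℕ} {m : Measure (Ed d)} (h : MemP d 2 m) :
    Integrable (fun x => ‖x‖ ^ 2) m := (memP_two_iff.1 h).2

lemma MemP.integrable_of_le {d : ℕ} {m : Measure (Ed d)} (h : MemP d 2 m) {g : Ed d → ℝ}
    (hg : Continuous g) (c : ℝ) (hc : ∀ x, |g x| ≤ c * (1 + ‖x‖ ^ 2)) : Integrable g m := by
  have := h.1
  refine Integrable.mono' (((integrable_const (1 : ℝ)).add h.integrable_sq).const_mul c)
    hg.aestronglyMeasurable ?_
  exact ae_of_all _ fun x => by simpa using hc x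

lemma MemP.integrable_norm {d : ℕ} {m : Measure (Ed d)} (h : MemP d 2 m) :
    Integrable (fun x => ‖x‖) m := by
  refine h.integrable_of_le continuous_norm 1 fun x => ?_
  rw [abs_of_nonneg (norm_nonneg x)]
  nlinarith [sq_nonneg (‖x‖ - 1), sq_nonneg ‖x‖]

section Coupling

variable {d : ℕ} {m m' : Measure (Ed d)} {γ : Measure (Ed d × Ed d)}

lemma IsCoupling.integral_fst (hγ : IsCoupling d γ m m') {g : Ed d → ℝ}
    (hg : Integrable g m) : Integrable (fun q => g q.1) γ ∧ ∫ q, g q.1 ∂γ = ∫ x, g x ∂m := by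
  obtain ⟨h1, -⟩ := hγ
  rw [← h1] at hg ⊢
  exact ⟨hg.comp_measurable measurable_fst,
    (integral_map measurable_fst.aemeasurable hg.aestronglyMeasurable).symm⟩

lemma IsCoupling.integral_snd (hγ : IsCoupling d γ m m') {g : Ed d → ℝ}
    (hg : Integrable g m') : Integrable (fun q => g q.2) γ ∧ ∫ q, g q.2 ∂γ = ∫ x, g x ∂m' := by
  obtain ⟨-, h1⟩ := hγ
  rw [← h1] at hg ⊢
  exact ⟨hg.comp_measurable measurable_snd,
    (integral_map measurable_snd.aemeasurable hg.aestronglyMeasurable).symm⟩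

lemma isCoupling_prod [IsProbabilityMeasure m] [IsProbabilityMeasure m'] :
    IsCoupling d (m.prod m') m m' := by
  constructor
  · simp [Measure.map_fst_prod]
  · simp [Measure.map_snd_prod]

lemma IsCoupling.integrable_dist (hγ : IsCoupling d γ m m') (hm : MemP d 2 m)
    (hm' : MemP d 2 m') : Integrable (fun q => ‖q.1 - q.2‖) γ := by
  refine Integrable.mono' ((hγ.integral_fst hm.integrable_norm).1.add
    (hγ.integral_snd hm'.integrable_norm).1) (by fun_prop) ?_
  exact ae_of_all _ fun q => by simpa using norm_sub_le q.1 q.2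

lemma IsCoupling.integrable_dist_sq (hγ : IsCoupling d γ m m') (hm : MemP d 2 m)
    (hm' : MemP d 2 m') : Integrable (fun q => ‖q.1 - q.2‖ ^ 2) γ := by
  refine Integrable.mono' (((hγ.integral_fst hm.integrable_sq).1.const_mul 2).add
    ((hγ.integral_snd hm'.integrable_sq).1.const_mul 2)) (by fun_prop) ?_
  refine ae_of_all _ fun q => ?_
  have h1 := norm_sub_le q.1 q.2
  have h0 := norm_nonneg (q.1 - q.2)
  simp only [norm_pow, norm_norm, Pi.add_apply]
  nlinarith [sq_nonneg (‖q.1‖ - ‖q.2‖)]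

lemma wdist_one_le (hγ : IsCoupling d γ m m') [hp : IsProbabilityMeasure γ] :
    wdist d 1 m m' ≤ ∫ q, ‖q.1 - q.2‖ ∂γ := by
  refine csInf_le ⟨0, ?_⟩ ⟨γ, hp, hγ, by simp⟩
  rintro c ⟨γ', -, -, rfl⟩
  exact Real.rpow_nonneg (integral_nonneg fun q => by positivity) _

lemma wdist_nonneg (d : ℕ) (p : ℝ) (m m' : Measure (Ed d)) : 0 ≤ wdist d p m m' := by
  refine Real.sInf_nonneg ?_
  rintro c ⟨γ', -, -, rfl⟩
  exact Real.rpow_nonneg (integral_nonneg fun q => by positivity) _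

lemma exists_coupling_of_wdist_one_lt (hm : MemP d 2 m) (hm' : MemP d 2 m') {η : ℝ}
    (h : wdist d 1 m m' < η) : ∃ γ : Measure (Ed d × Ed d), IsProbabilityMeasure γ ∧
      IsCoupling d γ m m' ∧ ∫ q, ‖q.1 - q.2‖ ∂γ < η := by
  have := hm.1
  have := hm'.1
  unfold wdist at h
  obtain ⟨c, ⟨γ, h1, h2, rfl⟩, h3⟩ := exists_lt_of_csInf_lt
    (by exact ⟨_, m.prod m', inferInstance, isCoupling_prod, rfl⟩) h
  exact ⟨γ, h1, h2, by simpa using h3⟩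

lemma exists_coupling_of_wdist_two_lt (hm : MemP d 2 m) (hm' : MemP d 2 m') {η : ℝ}
    (h : wdist d 2 m m' < η) : ∃ γ : Measure (Ed d × Ed d), IsProbabilityMeasure γ ∧
      IsCoupling d γ m m' ∧ ∫ q, ‖q.1 - q.2‖ ^ 2 ∂γ < η ^ 2 := by
  have := hm.1
  have := hm'.1
  unfold wdist at h
  obtain ⟨c, ⟨γ, h1, h2, rfl⟩, h3⟩ := exists_lt_of_csInf_lt
    (by exact ⟨_, m.prod m', inferInstance, isCoupling_prod, rfl⟩) h
  refine ⟨γ, h1, h2, ?_⟩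
  simp only [Real.rpow_two, ← Real.sqrt_eq_rpow] at h3
  exact Real.lt_sq_of_sqrt_lt h3

lemma wdist_one_le_of_wdist_two_lt (hm : MemP d 2 m) (hm' : MemP d 2 m') {η : ℝ}
    (h : wdist d 2 m m' < η) : wdist d 1 m m' < η := by
  obtain ⟨γ, h1, h2, h3⟩ := exists_coupling_of_wdist_two_lt hm hm' h
  have hη : 0 < η := (wdist_nonneg d 2 m m').trans_lt h
  refine (wdist_one_le h2).trans_lt ?_
  have hi := h2.integrable_dist hm hm'
  have hi2 := h2.integrable_dist_sq hm hm'
  have key : ∫ q, 2 * η * ‖q.1 - q.2‖ ∂γ ≤ ∫ q, (η ^ 2 + ‖q.1 - q.2‖ ^ 2) ∂γ :=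
    integral_mono (hi.const_mul _) ((integrable_const _).add hi2) fun q => by
      nlinarith [sq_nonneg (η - ‖q.1 - q.2‖)]
  rw [integral_const_mul, integral_add (integrable_const _) hi2] at key
  simp only [integral_const, probReal_univ, smul_eq_mul, one_mul] at key
  nlinarith

lemma abs_integral_sub_le_of_wdist_one_lt (hm : MemP d 2 m) (hm' : MemP d 2 m') {η : ℝ}
    (h : wdist d 1 m m' < η) {g : Ed d → ℝ} {K : ℝ} (hK : 0 ≤ K)
    (hg : ∀ x y, |g x - g y| ≤ K * ‖x - y‖) (hgm : Integrable g m) (hgm' : Integrable g m') :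
    |∫ x, g x ∂m' - ∫ x, g x ∂m| ≤ K * η := by
  obtain ⟨γ, h1, h2, h3⟩ := exists_coupling_of_wdist_one_lt hm hm' h
  obtain ⟨i1, e1⟩ := h2.integral_fst hgm
  obtain ⟨i2, e2⟩ := h2.integral_snd hgm'
  rw [← e1, ← e2, ← integral_sub i2 i1]
  refine (abs_integral_le_integral_abs).trans ?_
  calc ∫ q, |g q.2 - g q.1| ∂γ ≤ ∫ q, K * ‖q.1 - q.2‖ ∂γ :=
        integral_mono (i2.sub i1).abs ((h2.integrable_dist hm hm').const_mul K) fun q => by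
          simpa [abs_sub_comm] using hg q.1 q.2
    _ ≤ K * η := by
        rw [integral_const_mul]
        exact mul_le_mul_of_nonneg_left h3.le hK

/-- The second moment is continuous for `d₂`. -/
lemma secondMoment_d2cont (hm : MemP d 2 m) {ε : ℝ} (hε : 0 < ε) : ∃ η > (0 : ℝ),
    ∀ m' : Measure (Ed d), MemP d 2 m' → wdist d 2 m m' < η →
      |secondMoment d m' - secondMoment d m| < ε := by
  set M := secondMoment d m with hM
  have hM0 : 0 ≤ M := secondMoment_nonneg d m
  set θ : ℝ := ε / (2 * (M + 1)) with hθ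
  have hθ0 : 0 < θ := by positivity
  set η : ℝ := √(ε / (2 * (1 + 1 / θ))) with hη
  have hη2 : η ^ 2 = ε / (2 * (1 + 1 / θ)) := Real.sq_sqrt (by positivity)
  refine ⟨η, Real.sqrt_pos.2 (by positivity), fun m' hm' h => ?_⟩
  obtain ⟨γ, h1, h2, h3⟩ := exists_coupling_of_wdist_two_lt hm hm' h
  obtain ⟨i1, e1⟩ := h2.integral_fst hm.integrable_sq
  obtain ⟨i2, e2⟩ := h2.integral_snd hm'.integrable_sq
  have i3 := h2.integrable_dist_sq hm hm'
  have e1' : ∫ q, ‖q.1‖ ^ 2 ∂γ = M := e1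
  rw [hM, secondMoment, secondMoment, ← e1, ← e2, ← integral_sub i2 i1]
  refine (abs_integral_le_integral_abs).trans_lt ?_
  calc ∫ q, |‖q.2‖ ^ 2 - ‖q.1‖ ^ 2| ∂γ
      ≤ ∫ q, ((1 + 1 / θ) * ‖q.1 - q.2‖ ^ 2 + θ * ‖q.1‖ ^ 2) ∂γ := by
        refine integral_mono (i2.sub i1).abs ((i3.const_mul _).add (i1.const_mul _)) fun q => ?_
        have ha : |‖q.2‖ - ‖q.1‖| ≤ ‖q.1 - q.2‖ := by
          rw [norm_sub_rev]; exact abs_norm_sub_norm_le _ _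
        have hy : 2 * ‖q.1‖ * ‖q.1 - q.2‖ ≤ 1 / θ * ‖q.1 - q.2‖ ^ 2 + θ * ‖q.1‖ ^ 2 := by
          have : 1 / θ * ‖q.1 - q.2‖ ^ 2 + θ * ‖q.1‖ ^ 2 - 2 * ‖q.1‖ * ‖q.1 - q.2‖ =
              (1 / θ) * (‖q.1 - q.2‖ - θ * ‖q.1‖) ^ 2 := by field_simp; ring
          have h0 : 0 ≤ (1 / θ) * (‖q.1 - q.2‖ - θ * ‖q.1‖) ^ 2 := by positivity
          linarith
        have hb : |‖q.2‖ ^ 2 - ‖q.1‖ ^ 2| ≤ ‖q.1 - q.2‖ * (‖q.1 - q.2‖ + 2 * ‖q.1‖) := by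
          have : ‖q.2‖ ^ 2 - ‖q.1‖ ^ 2 = (‖q.2‖ - ‖q.1‖) * (‖q.2‖ + ‖q.1‖) := by ring
          rw [this, abs_mul]
          have h5 := (abs_le.1 ha).2
          refine mul_le_mul ha ?_ (abs_nonneg _) (norm_nonneg _)
          rw [abs_of_nonneg (by positivity)]
          linarith
        simp only
        nlinarith
    _ = (1 + 1 / θ) * ∫ q, ‖q.1 - q.2‖ ^ 2 ∂γ + θ * M := by
        rw [integral_add (i3.const_mul _) (i1.const_mul _), integral_const_mul,
          integral_const_mul, e1']
    _ < ε := by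
        have t1 : (1 + 1 / θ) * ∫ q, ‖q.1 - q.2‖ ^ 2 ∂γ < (1 + 1 / θ) * η ^ 2 :=
          mul_lt_mul_of_pos_left h3 (by positivity)
        have t2 : (1 + 1 / θ) * η ^ 2 = ε / 2 := by rw [hη2]; field_simp
        have t3 : θ * M ≤ ε / 2 := by
          rw [hθ, div_mul_eq_mul_div, div_le_div_iff₀ (by positivity) (by positivity)]
          nlinarith
        linarith

/-- The second moment is lower semicontinuous for `d₁`. -/
lemma secondMoment_lsc (hm : MemP d 2 m) {ε : ℝ} (hε : 0 < ε) : ∃ η > (0 : ℝ),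
    ∀ m' : Measure (Ed d), MemP d 2 m' → wdist d 1 m m' < η →
      secondMoment d m - ε < secondMoment d m' := by
  have := hm.1
  let g : ℕ → Ed d → ℝ := fun R x => (min ‖x‖ R) ^ 2
  have hgc : ∀ R, Continuous (g R) := fun R => by fun_prop
  have hgle : ∀ R x, g R x ≤ ‖x‖ ^ 2 := fun R x =>
    pow_le_pow_left₀ (by positivity) (min_le_left _ _) 2
  have hg0 : ∀ R x, 0 ≤ g R x := fun R x => by positivity
  have hgi : ∀ R (ν : Measure (Ed d)), MemP d 2 ν → Integrable (g R) ν := fun R ν hν =>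
    hν.integrable_of_le (hgc R) 1 fun x => by
      rw [abs_of_nonneg (hg0 R x)]; linarith [hgle R x]
  have hlim : Tendsto (fun R => ∫ x, g R x ∂m) atTop (𝓝 (secondMoment d m)) := by
    refine tendsto_integral_of_dominated_convergence (fun x => ‖x‖ ^ 2)
      (fun R => (hgc R).aestronglyMeasurable) hm.integrable_sq
      (fun R => ae_of_all _ fun x => ?_) (ae_of_all _ fun x => ?_)
    · rw [Real.norm_of_nonneg (hg0 R x)]; exact hgle R x
    · refine tendsto_const_nhds.congr' ?_
      obtain ⟨N, hN⟩ := exists_nat_ge ‖x‖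
      filter_upwards [eventually_ge_atTop N] with R hR
      have : ‖x‖ ≤ R := hN.trans (by exact_mod_cast hR)
      simp [g, min_eq_left this]
  obtain ⟨R, hR⟩ := (hlim.eventually (lt_mem_nhds
    (show secondMoment d m - ε / 2 < secondMoment d m by linarith))).exists
  refine ⟨ε / (4 * (R + 1)), by positivity, fun m' hm' h => ?_⟩
  have hlip : ∀ x y, |g R x - g R y| ≤ (2 * R : ℝ) * ‖x - y‖ := fun x y => by
    have h1 : g R x - g R y = (min ‖x‖ R - min ‖y‖ R) * (min ‖x‖ R + min ‖y‖ R) := by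
      simp only [g]; ring
    rw [h1, abs_mul, mul_comm]
    refine mul_le_mul ?_ ?_ (abs_nonneg _) (by positivity)
    · rw [abs_of_nonneg (by positivity)]
      linarith [min_le_right ‖x‖ (R : ℝ), min_le_right ‖y‖ (R : ℝ)]
    · refine (abs_min_sub_min_le_max _ _ _ _).trans ?_
      simpa using abs_norm_sub_norm_le x y
  have h2 := abs_integral_sub_le_of_wdist_one_lt hm hm' h (by positivity) hlip
    (hgi R m hm) (hgi R m' hm')
  have h3 : (2 * R : ℝ) * (ε / (4 * (R + 1))) ≤ ε / 2 := by
    rw [mul_div_assoc', div_le_div_iff₀ (by positivity) (by positivity)]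
    nlinarith
  have h4 : ∫ x, g R x ∂m' ≤ secondMoment d m' :=
    integral_mono (hgi R m' hm') hm'.integrable_sq (hgle R)
  have := (abs_le.1 h2).1
  linarith

end Coupling

/-- Blockwise coupling of two measures decomposed along a common finite index set: up to the block
`i₀`, the mass which is not transported inside a block is controlled by the discrepancy of the
masses of the blocks. -/
lemma exists_block_coupling {X ι : Type*} [MeasurableSpace X] [Fintype ι] [DecidableEq ι]
    (μ ν : ι → Measure X) [∀ i, IsFiniteMeasure (μ i)] [∀ i, IsFiniteMeasure (ν i)]
    (htot : ∑ i, μ i univ = ∑ i, ν i univ) (i₀ : ι) :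
    ∃ w : ι → ι → ℝ≥0∞,
      (∑ i, ∑ j, w i j • (μ i).prod (ν j)).map Prod.fst = ∑ i, μ i ∧
      (∑ i, ∑ j, w i j • (μ i).prod (ν j)).map Prod.snd = ∑ i, ν i ∧
      ∑ i, ∑ j, (if i = j ∧ i ≠ i₀ then 0 else w i j * (μ i univ * ν j univ)) ≤
        μ i₀ univ + ∑ i, (μ i univ - ν i univ) := by
  set a : ι → ℝ≥0∞ := fun i => μ i univ with ha
  set b : ι → ℝ≥0∞ := fun i => ν i univ with hb
  have hafin : ∀ i, a i ≠ ∞ := fun i => measure_ne_top _ _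
  have hbfin : ∀ i, b i ≠ ∞ := fun i => measure_ne_top _ _
  have hmina : ∀ i, min (a i) (b i) + (a i - b i) = a i := fun i => by
    rcases le_total (a i) (b i) with h | h
    · rw [min_eq_left h, tsub_eq_zero_of_le h, add_zero]
    · rw [min_eq_right h, add_tsub_cancel_of_le h]
  have hminb : ∀ i, min (a i) (b i) + (b i - a i) = b i := fun i => by
    rcases le_total (a i) (b i) with h | h
    · rw [min_eq_left h, add_tsub_cancel_of_le h]
    · rw [min_eq_right h, tsub_eq_zero_of_le h, add_zero]
  set θ : ℝ≥0∞ := ∑ i, (a i - b i) with hθ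
  have hθ' : ∑ i, (b i - a i) = θ := by
    have h1 : ∑ i, min (a i) (b i) + θ = ∑ i, min (a i) (b i) + ∑ i, (b i - a i) := by
      rw [hθ, ← Finset.sum_add_distrib, ← Finset.sum_add_distrib]
      simp only [hmina, hminb]
      exact htot
    refine ((ENNReal.add_right_inj ?_).1 h1).symm
    exact (ENNReal.sum_lt_top.2 fun i _ => (min_le_left _ _).trans_lt (hafin i).lt_top).ne
  have hθfin : θ ≠ ∞ :=
    (ENNReal.sum_lt_top.2 fun i _ => tsub_le_self.trans_lt (hafin i).lt_top).ne
  have hθa : ∀ i, (a i - b i) * (θ / θ) = a i - b i := fun i => by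
    by_cases h : θ = 0
    · have : a i - b i = 0 := (Finset.sum_eq_zero_iff.1 h) i (Finset.mem_univ i)
      simp [this]
    · rw [ENNReal.div_self h hθfin, mul_one]
  have hθb : ∀ i, (b i - a i) * (θ / θ) = b i - a i := fun i => by
    by_cases h : θ = 0
    · have : b i - a i = 0 := (Finset.sum_eq_zero_iff.1 (hθ'.trans h)) i (Finset.mem_univ i)
      simp [this]
    · rw [ENNReal.div_self h hθfin, mul_one]
  let p : ι → ι → ℝ≥0∞ := fun i j =>
    (if i = j then min (a i) (b i) else 0) + (a i - b i) * (b j - a j) / θ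
  have hp1 : ∀ i, ∑ j, p i j = a i := fun i => by
    simp only [p, Finset.sum_add_distrib, Finset.sum_ite_eq, Finset.mem_univ, if_true,
      div_eq_mul_inv,
      mul_assoc, ← Finset.mul_sum, ← Finset.sum_mul]
    rw [hθ', ← div_eq_mul_inv, hθa, hmina]
  have hp2 : ∀ j, ∑ i, p i j = b j := fun j => by
    simp only [p, Finset.sum_add_distrib, Finset.sum_ite_eq', Finset.mem_univ, if_true,
      div_eq_mul_inv,
      ← Finset.sum_mul]
    rw [← hθ, mul_comm θ, mul_assoc, ← div_eq_mul_inv, hθb, hminb]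
  have hpa : ∀ i j, a i = 0 → p i j = 0 := fun i j h => by
    have : p i j ≤ a i := by
      rw [← hp1 i]; exact Finset.single_le_sum (fun _ _ => zero_le) (Finset.mem_univ j)
    exact le_antisymm (h ▸ this) zero_le
  have hpb : ∀ i j, b j = 0 → p i j = 0 := fun i j h => by
    have : p i j ≤ b j := by
      rw [← hp2 j]
      exact Finset.single_le_sum (f := fun i => p i j) (fun _ _ => zero_le) (Finset.mem_univ i)
    exact le_antisymm (h ▸ this) zero_le
  let w : ι → ι → ℝ≥0∞ := fun i j => p i j / (a i * b j)
  have hw : ∀ i j, w i j * (a i * b j) = p i j := fun i j => by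
    by_cases h : a i * b j = 0
    · rcases mul_eq_zero.1 h with h' | h'
      · simp [w, hpa i j h']
      · simp [w, hpb i j h']
    · exact ENNReal.div_mul_cancel h (ENNReal.mul_ne_top (hafin i) (hbfin j))
  refine ⟨w, ?_, ?_, ?_⟩
  · rw [Measure.map_finset_sum measurable_fst.aemeasurable]
    refine Finset.sum_congr rfl fun i _ => ?_
    rw [Measure.map_finset_sum measurable_fst.aemeasurable]
    simp only [Measure.map_smul, Measure.map_fst_prod, smul_smul]
    rw [← Finset.sum_smul]
    by_cases h : a i = 0
    · rw [Measure.measure_univ_eq_zero.1 h, smul_zero]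
    · have : ∑ j, w i j * b j = 1 := by
        have h1 : (∑ j, w i j * b j) * a i = 1 * a i := by
          rw [Finset.sum_mul, one_mul]
          refine Eq.trans (Finset.sum_congr rfl fun j _ => ?_) (hp1 i)
          rw [← hw]; ring
        exact (ENNReal.mul_left_inj h (hafin i)).1 h1
      change (∑ j, w i j * b j) • μ i = μ i
      rw [this, one_smul]
  · rw [Finset.sum_comm, Measure.map_finset_sum measurable_snd.aemeasurable]
    refine Finset.sum_congr rfl fun j _ => ?_
    rw [Measure.map_finset_sum measurable_snd.aemeasurable]
    simp only [Measure.map_smul, Measure.map_snd_prod, smul_smul]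
    rw [← Finset.sum_smul]
    by_cases h : b j = 0
    · rw [Measure.measure_univ_eq_zero.1 h, smul_zero]
    · have : ∑ i, w i j * a i = 1 := by
        have h1 : (∑ i, w i j * a i) * b j = 1 * b j := by
          rw [Finset.sum_mul, one_mul]
          refine Eq.trans (Finset.sum_congr rfl fun i _ => ?_) (hp2 j)
          rw [← hw]; ring
        exact (ENNReal.mul_left_inj h (hbfin j)).1 h1
      change (∑ i, w i j * a i) • ν j = ν j
      rw [this, one_smul]
  · calc ∑ i, ∑ j, (if i = j ∧ i ≠ i₀ then 0 else w i j * (a i * b j))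
        ≤ ∑ i, ∑ j, ((if i = j then (if i = i₀ then a i else 0) else 0) +
            (a i - b i) * (b j - a j) / θ) := by
          refine Finset.sum_le_sum fun i _ => Finset.sum_le_sum fun j _ => ?_
          rw [hw]
          by_cases hij : i = j
          · by_cases hi : i = i₀
            · subst hij; subst hi
              simp only [ne_eq, not_true_eq_false, and_false, if_false, p, if_true]
              gcongr
              exact min_le_left _ _
            · simp [hij, hij ▸ hi]
          · simp [hij, p]
      _ = a i₀ + θ := by
          simp only [Finset.sum_add_distrib, Finset.sum_ite_eq, Finset.sum_ite_eq',
            Finset.mem_univ, if_true,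
            div_eq_mul_inv, mul_assoc, ← Finset.mul_sum, ← Finset.sum_mul]
          rw [hθ', ← hθ, ← div_eq_mul_inv]
          congr 1
          by_cases h : θ = 0
          · simp [h]
          · rw [ENNReal.div_self h hθfin, mul_one]

/-- A finite continuous partition of unity of `ℝ^d` into small pieces and a piece near infinity. -/
lemma exists_partition_small (d : ℕ) (ρ : ℝ) {ε : ℝ} (hε : 0 < ε) :
    ∃ (t : Finset (Ed d)) (χ : Option t → Ed d → ℝ), (∀ i, Continuous (χ i)) ∧
      (∀ i x, 0 ≤ χ i x) ∧ (∀ x, ∑ i, χ i x = 1) ∧ (∀ x, χ none x ≠ 0 → ρ < ‖x‖) ∧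
      ∀ i : t, ∀ x y, χ (some i) x ≠ 0 → χ (some i) y ≠ 0 → ‖x - y‖ ≤ ε := by
  obtain ⟨t, -, ht, hcov⟩ := (isCompact_closedBall (0 : Ed d) ρ).finite_cover_balls
    (half_pos hε)
  lift t to Finset (Ed d) using ht
  let U : Option t → Set (Ed d) := fun i => i.elim (Metric.closedBall 0 ρ)ᶜ
    fun x => Metric.ball x (ε / 2)
  obtain ⟨χ, hχ⟩ := PartitionOfUnity.exists_isSubordinate (isClosed_univ (X := Ed d)) U
    (fun i => by
      cases i with
      | none => exact Metric.isClosed_closedBall.isOpen_compl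
      | some i => exact Metric.isOpen_ball)
    (fun x _ => by
      by_cases hx : x ∈ Metric.closedBall (0 : Ed d) ρ
      · obtain ⟨y, hy, hxy⟩ := mem_iUnion₂.1 (hcov hx)
        exact mem_iUnion.2 ⟨some ⟨y, hy⟩, hxy⟩
      · exact mem_iUnion.2 ⟨none, hx⟩)
  have hsub : ∀ i x, χ i x ≠ 0 → x ∈ U i := fun i x hx => hχ i (subset_tsupport _ hx)
  refine ⟨t, fun i => χ i, fun i => (χ i).continuous, fun i x => χ.nonneg i x, fun x => ?_,
    fun x hx => ?_, fun i x y hx hy => ?_⟩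
  · rw [← finsum_eq_sum_of_fintype]
    exact χ.sum_eq_one (mem_univ x)
  · simpa [U] using hsub none x hx
  · have h1 : dist x i < ε / 2 := hsub (some i) x hx
    have h2 : dist y i < ε / 2 := hsub (some i) y hy
    rw [← dist_eq_norm]
    linarith [dist_triangle_right x y i]

lemma sum_withDensity_partition {d : ℕ} {ι : Type*} [Fintype ι] (m : Measure (Ed d))
    {χ : ι → Ed d → ℝ} (hc : ∀ i, Continuous (χ i)) (h0 : ∀ i x, 0 ≤ χ i x)
    (h1 : ∀ x, ∑ i, χ i x = 1) :
    ∑ i, m.withDensity (fun x => ENNReal.ofReal (χ i x)) = m := by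
  ext s hs
  rw [Measure.finsetSum_apply]
  simp only [withDensity_apply _ hs]
  rw [← lintegral_finsetSum _ fun i _ => (hc i).measurable.ennreal_ofReal]
  simp only [← ENNReal.ofReal_sum_of_nonneg fun i _ => h0 i _, h1, ENNReal.ofReal_one]
  simp

lemma wdist_one_le_of_partition {d : ℕ} {m m' : Measure (Ed d)} (hm : MemP d 2 m)
    (hm' : MemP d 2 m') {ι : Type*} [Fintype ι] [DecidableEq ι] {χ : ι → Ed d → ℝ}
    (hc : ∀ i, Continuous (χ i)) (h0 : ∀ i x, 0 ≤ χ i x) (h1 : ∀ x, ∑ i, χ i x = 1) (i₀ : ι)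
    {ε L : ℝ} (hε : 0 ≤ ε) (hL : 0 < L)
    (hsmall : ∀ i, i ≠ i₀ → ∀ x y, χ i x ≠ 0 → χ i y ≠ 0 → ‖x - y‖ ≤ ε) :
    wdist d 1 m m' ≤ ε + L * (∫ x, χ i₀ x ∂m + ∑ i, |∫ x, χ i x ∂m - ∫ x, χ i x ∂m'|) +
      (2 * secondMoment d m + 2 * secondMoment d m') / L := by
  have := hm.1
  have := hm'.1
  have hle1 : ∀ i x, χ i x ≤ 1 := fun i x => by
    rw [← h1 x]; exact Finset.single_le_sum (fun j _ => h0 j x) (Finset.mem_univ i)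
  have hint : ∀ (ν : Measure (Ed d)), MemP d 2 ν → ∀ i, Integrable (χ i) ν := fun ν hν i =>
    hν.integrable_of_le (hc i) 1 fun x => by
      rw [abs_of_nonneg (h0 i x)]; nlinarith [hle1 i x, sq_nonneg ‖x‖]
  let D : Measure (Ed d) → ι → Measure (Ed d) := fun ν i =>
    ν.withDensity fun x => ENNReal.ofReal (χ i x)
  have hDuniv : ∀ (ν : Measure (Ed d)), MemP d 2 ν → ∀ i,
      D ν i univ = ENNReal.ofReal (∫ x, χ i x ∂ν) := fun ν hν i => by
    simp only [D, withDensity_apply _ MeasurableSet.univ, Measure.restrict_univ]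
    rw [ofReal_integral_eq_lintegral_ofReal (hint ν hν i) (ae_of_all _ (h0 i))]
  have f1 : ∀ i, IsFiniteMeasure (D m i) := fun i =>
    ⟨by rw [hDuniv m hm]; exact ENNReal.ofReal_lt_top⟩
  have f2 : ∀ i, IsFiniteMeasure (D m' i) := fun i =>
    ⟨by rw [hDuniv m' hm']; exact ENNReal.ofReal_lt_top⟩
  have s1 : ∑ i, D m i = m := sum_withDensity_partition m hc h0 h1
  have s2 : ∑ i, D m' i = m' := sum_withDensity_partition m' hc h0 h1
  have htot : ∑ i, D m i univ = ∑ i, D m' i univ := by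
    rw [← Measure.finsetSum_apply, ← Measure.finsetSum_apply, s1, s2, measure_univ, measure_univ]
  obtain ⟨w, w1, w2, w3⟩ := exists_block_coupling (D m) (D m') htot i₀
  rw [s1] at w1
  rw [s2] at w2
  set γ := ∑ i, ∑ j, w i j • (D m i).prod (D m' j) with hγdef
  have hγ : IsCoupling d γ m m' := ⟨w1, w2⟩
  have hγp : IsProbabilityMeasure γ := ⟨by
    have : γ.map Prod.fst univ = 1 := by rw [w1]; exact measure_univ
    rwa [Measure.map_apply measurable_fst MeasurableSet.univ] at this⟩
  refine (wdist_one_le hγ).trans ?_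
  have i1 := hγ.integrable_dist hm hm'
  have i2 := hγ.integrable_dist_sq hm hm'
  have hsq : ∫ q, ‖q.1 - q.2‖ ^ 2 / L ∂γ ≤
      (2 * secondMoment d m + 2 * secondMoment d m') / L := by
    rw [integral_div]
    refine div_le_div_of_nonneg_right ?_ hL.le
    obtain ⟨j1, e1⟩ := hγ.integral_fst hm.integrable_sq
    obtain ⟨j2, e2⟩ := hγ.integral_snd hm'.integrable_sq
    rw [secondMoment, secondMoment, ← e1, ← e2, ← integral_const_mul, ← integral_const_mul,
      ← integral_add (j1.const_mul _) (j2.const_mul _)]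
    refine integral_mono i2 ((j1.const_mul _).add (j2.const_mul _)) fun q => ?_
    have h1 := norm_sub_le q.1 q.2
    have h0 := norm_nonneg (q.1 - q.2)
    simp only
    nlinarith [sq_nonneg (‖q.1‖ - ‖q.2‖)]
  have hA : 0 ≤ ∫ x, χ i₀ x ∂m := integral_nonneg (h0 i₀)
  have hB : 0 ≤ ∑ i, |∫ x, χ i x ∂m - ∫ x, χ i x ∂m'| :=
    Finset.sum_nonneg fun i _ => abs_nonneg _
  have hMM : 0 ≤ (2 * secondMoment d m + 2 * secondMoment d m') / L := by
    have := secondMoment_nonneg d m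
    have := secondMoment_nonneg d m'
    positivity
  have hlin : ∀ g : Ed d × Ed d → ℝ≥0∞,
      ∫⁻ q, g q ∂γ = ∑ i, ∑ j, w i j * ∫⁻ q, g q ∂((D m i).prod (D m' j)) := fun g => by
    simp only [hγdef, lintegral_finsetSum_measure, lintegral_smul_measure, smul_eq_mul]
  have hbad : ∑ i, ∑ j, (if i = j ∧ i ≠ i₀ then 0 else w i j * (D m i univ * D m' j univ)) ≤
      ENNReal.ofReal (∫ x, χ i₀ x ∂m + ∑ i, |∫ x, χ i x ∂m - ∫ x, χ i x ∂m'|) := by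
    refine w3.trans ?_
    rw [ENNReal.ofReal_add hA hB, ENNReal.ofReal_sum_of_nonneg fun i _ => abs_nonneg _,
      hDuniv m hm]
    gcongr with i
    rw [hDuniv m hm, hDuniv m' hm', ← ENNReal.ofReal_sub _ (integral_nonneg (h0 i))]
    exact ENNReal.ofReal_le_ofReal (le_abs_self _)
  have hpt : ∀ i j, ∫⁻ q, ENNReal.ofReal ‖q.1 - q.2‖ ∂((D m i).prod (D m' j)) ≤
      ∫⁻ q, (ENNReal.ofReal ε + ENNReal.ofReal (‖q.1 - q.2‖ ^ 2 / L) +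
        if i = j ∧ i ≠ i₀ then 0 else ENNReal.ofReal L) ∂((D m i).prod (D m' j)) := by
    intro i j
    have hne : ∀ (ν : Measure (Ed d)) (i : ι), ∀ᵐ x ∂(D ν i), χ i x ≠ 0 := fun ν i => by
      rw [ae_withDensity_iff (hc i).measurable.ennreal_ofReal]
      exact ae_of_all _ fun x hx h => hx (by simp [h])
    refine lintegral_mono_ae ?_
    filter_upwards [Measure.quasiMeasurePreserving_fst.ae (hne m i),
      Measure.quasiMeasurePreserving_snd.ae (hne m' j)] with q hq1 hq2
    by_cases h : i = j ∧ i ≠ i₀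
    · obtain ⟨rfl, hi⟩ := h
      rw [if_pos ⟨rfl, hi⟩, add_zero]
      exact (ENNReal.ofReal_le_ofReal (hsmall i hi _ _ hq1 hq2)).trans le_self_add
    · rw [if_neg h, ← ENNReal.ofReal_add hε (by positivity),
        ← ENNReal.ofReal_add (by positivity) hL.le]
      refine ENNReal.ofReal_le_ofReal ?_
      have : ‖q.1 - q.2‖ ^ 2 / L + L - 2 * ‖q.1 - q.2‖ = (‖q.1 - q.2‖ - L) ^ 2 / L := by
        field_simp; ring
      have h0 : 0 ≤ (‖q.1 - q.2‖ - L) ^ 2 / L := by positivity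
      linarith [norm_nonneg (q.1 - q.2)]
  rw [← ENNReal.ofReal_le_ofReal_iff (by positivity),
    ofReal_integral_eq_lintegral_ofReal i1 (ae_of_all _ fun q => norm_nonneg _), hlin]
  calc ∑ i, ∑ j, w i j * ∫⁻ q, ENNReal.ofReal ‖q.1 - q.2‖ ∂((D m i).prod (D m' j))
      ≤ ∑ i, ∑ j, w i j * ∫⁻ q, (ENNReal.ofReal ε + ENNReal.ofReal (‖q.1 - q.2‖ ^ 2 / L) +
        if i = j ∧ i ≠ i₀ then 0 else ENNReal.ofReal L) ∂((D m i).prod (D m' j)) := by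
        exact Finset.sum_le_sum fun i _ => Finset.sum_le_sum fun j _ =>
          mul_le_mul_right (hpt i j) _
    _ = ∑ i, ∑ j, (w i j * ∫⁻ q, (ENNReal.ofReal ε + ENNReal.ofReal (‖q.1 - q.2‖ ^ 2 / L))
          ∂((D m i).prod (D m' j)) +
        ENNReal.ofReal L *
          (if i = j ∧ i ≠ i₀ then 0 else w i j * (D m i univ * D m' j univ))) := by
        refine Finset.sum_congr rfl fun i _ => Finset.sum_congr rfl fun j _ => ?_
        rw [lintegral_add_right _ measurable_const, mul_add, lintegral_const,
          ← univ_prod_univ, Measure.prod_prod]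
        split_ifs
        · simp
        · ring
    _ = ∫⁻ q, (ENNReal.ofReal ε + ENNReal.ofReal (‖q.1 - q.2‖ ^ 2 / L)) ∂γ +
        ENNReal.ofReal L * ∑ i, ∑ j,
          (if i = j ∧ i ≠ i₀ then 0 else w i j * (D m i univ * D m' j univ)) := by
        rw [hlin]
        simp only [Finset.sum_add_distrib, Finset.mul_sum]
    _ ≤ ENNReal.ofReal ε + ENNReal.ofReal ((2 * secondMoment d m + 2 * secondMoment d m') / L) +
        ENNReal.ofReal L *
          ENNReal.ofReal (∫ x, χ i₀ x ∂m + ∑ i, |∫ x, χ i x ∂m - ∫ x, χ i x ∂m'|) := by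
        rw [lintegral_add_left measurable_const, lintegral_const, measure_univ, mul_one,
          ← ofReal_integral_eq_lintegral_ofReal (i2.div_const L)
            (ae_of_all _ fun q => by positivity)]
        gcongr
    _ = ENNReal.ofReal (ε + L * (∫ x, χ i₀ x ∂m + ∑ i, |∫ x, χ i x ∂m - ∫ x, χ i x ∂m'|) +
      (2 * secondMoment d m + 2 * secondMoment d m') / L) := by
        rw [← ENNReal.ofReal_mul hL.le, ← ENNReal.ofReal_add hε hMM,
          ← ENNReal.ofReal_add (by positivity) (by positivity)]
        congr 1
        ring

/-- Weak convergence with bounded second moments implies convergence for `d₁`. -/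
lemma tendsto_wdist_one_of_tendsto {d : ℕ} {m : Measure (Ed d)} {μ : ℕ → Measure (Ed d)}
    (hm : MemP d 2 m) (hμ : ∀ n, MemP d 2 (μ n)) {R : ℝ} (hR : ∀ n, secondMoment d (μ n) ≤ R)
    (hw : ∀ g : Ed d →ᵇ ℝ, Tendsto (fun n => ∫ x, g x ∂(μ n)) atTop (𝓝 (∫ x, g x ∂m))) :
    Tendsto (fun n => wdist d 1 m (μ n)) atTop (𝓝 0) := by
  classical
  have := hm.1
  rw [Metric.tendsto_atTop]
  intro ε hε
  set M := 2 * secondMoment d m + 2 * R with hM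
  have hm0 := secondMoment_nonneg d m
  have hM0 : 0 ≤ M := by
    have := (secondMoment_nonneg d (μ 0)).trans (hR 0)
    positivity
  set L : ℝ := 5 * (M + 1) / ε with hL
  have hL0 : 0 < L := by positivity
  set ρ : ℝ := √(5 * L * (secondMoment d m + 1) / ε) with hρ
  have hρ0 : 0 < ρ := Real.sqrt_pos.2 (by positivity)
  have hρ2 : ρ ^ 2 = 5 * L * (secondMoment d m + 1) / ε := Real.sq_sqrt (by positivity)
  obtain ⟨t, χ, hc, h0, h1, hinf, hsm⟩ := exists_partition_small d ρ
    (show 0 < ε / 5 by positivity)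
  have hle1 : ∀ i x, χ i x ≤ 1 := fun i x => by
    rw [← h1 x]; exact Finset.single_le_sum (fun j _ => h0 j x) (Finset.mem_univ i)
  let g : Option t → Ed d →ᵇ ℝ := fun i =>
    BoundedContinuousFunction.ofNormedAddCommGroup (χ i) (hc i) 1 fun x => by
      rw [Real.norm_of_nonneg (h0 i x)]; exact hle1 i x
  have hlim : Tendsto (fun n => ∑ i, |∫ x, χ i x ∂m - ∫ x, χ i x ∂(μ n)|) atTop (𝓝 0) := by
    have : ∀ i, Tendsto (fun n => |∫ x, χ i x ∂m - ∫ x, χ i x ∂(μ n)|) atTop (𝓝 0) := fun i => by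
      have h2 := ((tendsto_const_nhds (x := ∫ x, χ i x ∂m)).sub (hw (g i))).abs
      simpa [g] using h2
    simpa using tendsto_finsetSum Finset.univ fun i _ => this i
  have hnone : ∫ x, χ none x ∂m ≤ ε / (5 * L) := by
    have hi : Integrable (χ none) m := hm.integrable_of_le (hc none) 1 fun x => by
      rw [abs_of_nonneg (h0 none x)]; nlinarith [hle1 none x, sq_nonneg ‖x‖]
    calc ∫ x, χ none x ∂m ≤ ∫ x, ‖x‖ ^ 2 / ρ ^ 2 ∂m := by
          refine integral_mono hi (hm.integrable_sq.div_const _) fun x => ?_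
          by_cases hx : χ none x = 0
          · simp only [hx]; positivity
          · have h3 := hinf x hx
            refine (hle1 none x).trans ?_
            rw [le_div_iff₀ (by positivity), one_mul]
            exact pow_le_pow_left₀ hρ0.le h3.le 2
      _ = secondMoment d m / ρ ^ 2 := integral_div _ _
      _ ≤ ε / (5 * L) := by
          rw [hρ2, div_div_eq_mul_div, div_le_div_iff₀ (by positivity) (by positivity)]
          have : 0 ≤ ε * (5 * L) := by positivity
          nlinarith
  obtain ⟨N, hN⟩ := (Metric.tendsto_atTop.1 hlim) (ε / (5 * L)) (by positivity)
  refine ⟨N, fun n hn => ?_⟩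
  rw [Real.dist_0_eq_abs, abs_of_nonneg (wdist_nonneg _ _ _ _)]
  have h4 := hN n hn
  rw [Real.dist_0_eq_abs, abs_of_nonneg (Finset.sum_nonneg fun i _ => abs_nonneg _)] at h4
  have h5 := wdist_one_le_of_partition hm (hμ n) hc h0 h1 none
    (show 0 ≤ ε / 5 by positivity) hL0 (fun i hi x y hx hy => by
      cases i with
      | none => exact absurd rfl hi
      | some i => exact hsm i x y hx hy)
  have h6 : L * (∫ x, χ none x ∂m + ∑ i, |∫ x, χ i x ∂m - ∫ x, χ i x ∂(μ n)|) ≤ 2 * ε / 5 := by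
    have : L * (ε / (5 * L) + ε / (5 * L)) = 2 * ε / 5 := by field_simp; ring
    rw [← this]
    gcongr
  have h7 : (2 * secondMoment d m + 2 * secondMoment d (μ n)) / L ≤ ε / 5 := by
    rw [div_le_iff₀ hL0, hL]
    have : ε / 5 * (5 * (M + 1) / ε) = M + 1 := by field_simp
    rw [this]
    linarith [hR n]
  linarith

/-- Sets of measures with bounded second moments are relatively compact for `d₁`. -/
lemma exists_subseq_tendsto_wdist_one {d : ℕ} {μ : ℕ → Measure (Ed d)}
    (hμ : ∀ n, MemP d 2 (μ n)) {R : ℝ} (hR : ∀ n, secondMoment d (μ n) ≤ R) :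
    ∃ m, MemP d 2 m ∧ ∃ σ : ℕ → ℕ, StrictMono σ ∧
      Tendsto (fun n => wdist d 1 m (μ (σ n))) atTop (𝓝 0) := by
  let P : ℕ → ProbabilityMeasure (Ed d) := fun n => ⟨μ n, (hμ n).1⟩
  have hR' : ∀ n, ∫⁻ x, ENNReal.ofReal (‖x‖ ^ 2) ∂(μ n) ≤ ENNReal.ofReal R := fun n => by
    rw [← ofReal_integral_eq_lintegral_ofReal (hμ n).integrable_sq
      (ae_of_all _ fun x => by positivity)]
    exact ENNReal.ofReal_le_ofReal (hR n)
  have htight : IsTightMeasureSet {((ν : ProbabilityMeasure (Ed d)) : Measure (Ed d)) |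
      ν ∈ Set.range P} := by
    refine isTightMeasureSet_of_tendsto_measure_norm_gt ?_
    have hlim : Tendsto (fun r : ℝ => ENNReal.ofReal (R / r ^ 2)) atTop (𝓝 0) := by
      have : Tendsto (fun r : ℝ => R / r ^ 2) atTop (𝓝 0) :=
        tendsto_const_nhds.div_atTop (tendsto_pow_atTop two_ne_zero)
      simpa using ENNReal.tendsto_ofReal this
    refine tendsto_of_tendsto_of_tendsto_of_le_of_le' tendsto_const_nhds hlim
      (Eventually.of_forall fun _ => zero_le) ?_
    filter_upwards [eventually_gt_atTop 0] with r hr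
    refine iSup₂_le ?_
    rintro _ ⟨_, ⟨n, rfl⟩, rfl⟩
    have hr2 : (0 : ℝ) < r ^ 2 := by positivity
    rw [ENNReal.ofReal_div_of_pos hr2]
    refine le_trans ?_ ((meas_ge_le_lintegral_div
      (f := fun x : Ed d => ENNReal.ofReal (‖x‖ ^ 2)) (by fun_prop)
      (ENNReal.ofReal_pos.2 hr2).ne' ENNReal.ofReal_ne_top).trans
        (ENNReal.div_le_div_right (hR' n) _))
    refine measure_mono fun x hx => ?_
    exact ENNReal.ofReal_le_ofReal (pow_le_pow_left₀ hr.le (le_of_lt hx) 2)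
  obtain ⟨m, -, σ, hσ, hlim⟩ := (isCompact_closure_of_isTightMeasureSet htight).tendsto_subseq
    (fun n => subset_closure (mem_range_self n))
  have hfin : ∫⁻ x, ENNReal.ofReal (‖x‖ ^ 2) ∂(m : Measure (Ed d)) ≤ ENNReal.ofReal R := by
    refine (lintegral_le_liminf_lintegral_of_forall_isOpen_measure_le_liminf_measure
      (μs := fun n => μ (σ n)) (by fun_prop) (fun x => by positivity) fun G hG => ?_).trans ?_
    · exact ProbabilityMeasure.le_liminf_measure_open_of_tendsto hlim hG
    · exact liminf_le_of_le (by isBoundedDefault) fun b hb => by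
        obtain ⟨n, hn⟩ := hb.exists
        exact hn.trans (hR' _)
  have hm : MemP d 2 (m : Measure (Ed d)) := by
    refine memP_two_iff.2 ⟨inferInstance, by fun_prop, ?_⟩
    rw [hasFiniteIntegral_iff_ofReal (ae_of_all _ fun x => by positivity)]
    exact hfin.trans_lt ENNReal.ofReal_lt_top
  refine ⟨m, hm, σ, hσ, ?_⟩
  exact tendsto_wdist_one_of_tendsto hm (fun n => hμ _) (fun n => hR _)
    (ProbabilityMeasure.tendsto_iff_forall_integral_tendsto.1 hlim)

section HeatFlow

variable {d : ℕ} {m : Measure (Ed d)}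

lemma gaussDensity_nonneg (d : ℕ) {δ : ℝ} (hδ : 0 < δ) (x : Ed d) : 0 ≤ gaussDensity d δ x := by
  unfold gaussDensity
  positivity

lemma continuous_gaussDensity (d : ℕ) (δ : ℝ) : Continuous (gaussDensity d δ) := by
  unfold gaussDensity
  fun_prop

lemma charFun_gaussMeasure {δ : ℝ} (hδ : 0 < δ) (ξ : Ed d) :
    charFun (gaussMeasure d δ) ξ = Complex.exp (-(δ * ‖ξ‖ ^ 2) / 2) := by
  have hm : Measurable fun x : Ed d => ENNReal.ofReal (gaussDensity d δ x) :=
    (continuous_gaussDensity d δ).measurable.ennreal_ofReal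
  rw [charFun_apply, gaussMeasure, integral_withDensity_eq_integral_toReal_smul hm (by simp)]
  have hb : 0 < ((1 / (2 * δ) : ℝ) : ℂ).re := by
    rw [Complex.ofReal_re]; positivity
  have key := GaussianFourier.integral_cexp_neg_mul_sq_norm_add hb Complex.I ξ
  have hfun : (fun x : Ed d => (ENNReal.ofReal (gaussDensity d δ x)).toReal •
      Complex.exp ((inner ℝ x ξ : ℝ) * Complex.I)) = fun x =>
      (((2 * Real.pi * δ) ^ (-(d : ℝ) / 2) : ℝ) : ℂ) *
        Complex.exp (-((1 / (2 * δ) : ℝ) : ℂ) * (‖x‖ : ℂ) ^ 2 +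
          Complex.I * (inner ℝ ξ x : ℝ)) := by
    funext x
    rw [ENNReal.toReal_ofReal (gaussDensity_nonneg d hδ x), gaussDensity, Complex.real_smul,
      Complex.ofReal_mul, mul_assoc, Complex.ofReal_exp, ← Complex.exp_add, real_inner_comm]
    congr 2
    push_cast
    field_simp
  rw [hfun, integral_const_mul, key, finrank_euclideanSpace_fin]
  have h1 : ((Real.pi : ℂ) / ((1 / (2 * δ) : ℝ) : ℂ)) ^ ((d : ℂ) / 2) =
      (((2 * Real.pi * δ) ^ ((d : ℝ) / 2) : ℝ) : ℂ) := by
    rw [Complex.ofReal_cpow (by positivity)]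
    congr 1
    · push_cast
      field_simp
    · push_cast
      rfl
  rw [h1, ← mul_assoc, ← Complex.ofReal_mul, ← Real.rpow_add (by positivity)]
  have h2 : -(d : ℝ) / 2 + d / 2 = 0 := by ring
  rw [h2, Real.rpow_zero, Complex.ofReal_one, one_mul]
  congr 1
  rw [Complex.I_sq]
  push_cast
  have : (δ : ℂ) ≠ 0 := by exact_mod_cast hδ.ne'
  field_simp
  norm_num

lemma integrable_gaussDensity {δ : ℝ} (hδ : 0 < δ) : Integrable (gaussDensity d δ) := by
  have hb : 0 < ((1 / (2 * δ) : ℝ) : ℂ).re := by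
    rw [Complex.ofReal_re]; positivity
  have h := (GaussianFourier.integrable_cexp_neg_mul_sq_norm_add hb 0 (0 : Ed d)).norm
  refine (h.const_mul ((2 * Real.pi * δ) ^ (-(d : ℝ) / 2))).congr (ae_of_all _ fun x => ?_)
  simp only [Complex.norm_exp, gaussDensity]
  congr 2
  have : (-((1 / (2 * δ) : ℝ) : ℂ) * (‖x‖ : ℂ) ^ 2 + 0 * ((inner ℝ (0 : Ed d) x : ℝ) : ℂ)) =
      ((-(1 / (2 * δ)) * ‖x‖ ^ 2 : ℝ) : ℂ) := by
    push_cast; ring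
  rw [this, Complex.ofReal_re]
  field_simp

lemma gaussMeasure_eq_map {δ : ℝ} (hδ : 0 < δ) :
    gaussMeasure d δ = (ProbabilityTheory.stdGaussian (Ed d)).map (fun x => √δ • x) := by
  have : IsFiniteMeasure (gaussMeasure d δ) := by
    refine isFiniteMeasure_withDensity ?_
    rw [← ofReal_integral_eq_lintegral_ofReal (integrable_gaussDensity hδ)
      (ae_of_all _ (gaussDensity_nonneg d hδ))]
    exact ENNReal.ofReal_ne_top
  refine Measure.ext_of_charFun (funext fun ξ => ?_)
  rw [charFun_gaussMeasure hδ, charFun_map_smul, ProbabilityTheory.charFun_stdGaussian]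
  congr 1
  rw [norm_smul, Real.norm_of_nonneg (Real.sqrt_nonneg _)]
  push_cast
  rw [mul_pow, ← Complex.ofReal_pow √δ, Real.sq_sqrt hδ.le]

lemma heatFlow_eq_map [IsProbabilityMeasure m] (t s : ℝ) :
    heatFlow d t s m = (m.prod (ProbabilityTheory.stdGaussian (Ed d))).map
      (fun q => q.1 + √(s - t) • q.2) := by
  unfold heatFlow
  split_ifs with h
  · rw [Real.sqrt_eq_zero_of_nonpos (by linarith)]
    simp [Measure.map_fst_prod]
  · rw [gaussMeasure_eq_map (by linarith)]
    conv_lhs => rw [← Measure.map_id (μ := m)]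
    rw [Measure.map_prod_map _ _ measurable_id (by fun_prop),
      Measure.map_map (by fun_prop) (by fun_prop)]
    rfl

lemma isProbabilityMeasure_heatFlow [IsProbabilityMeasure m] (t s : ℝ) :
    IsProbabilityMeasure (heatFlow d t s m) := by
  rw [heatFlow_eq_map]
  exact Measure.isProbabilityMeasure_map (by fun_prop)

lemma memP_stdGaussian (d : ℕ) : MemP d 2 (ProbabilityTheory.stdGaussian (Ed d)) := by
  refine memP_two_iff.2 ⟨inferInstance, ?_⟩
  have h : MemLp id 2 (ProbabilityTheory.stdGaussian (Ed d)) :=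
    ProbabilityTheory.IsGaussian.memLp_two_id
  exact h.integrable_norm_pow (by norm_num)

lemma heatFlow_moment (hm : MemP d 2 m) (t s : ℝ) :
    MemP d 2 (heatFlow d t s m) ∧ secondMoment d (heatFlow d t s m) ≤
      2 * secondMoment d m +
        2 * |s - t| * secondMoment d (ProbabilityTheory.stdGaussian (Ed d)) := by
  have := hm.1
  set Z := ProbabilityTheory.stdGaussian (Ed d)
  have hZ : MemP d 2 Z := memP_stdGaussian d
  have h1 : Integrable (fun q : Ed d × Ed d => ‖q.1‖ ^ 2) (m.prod Z) :=
    hm.integrable_sq.comp_fst Z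
  have h2 : Integrable (fun q : Ed d × Ed d => ‖q.2‖ ^ 2) (m.prod Z) :=
    hZ.integrable_sq.comp_snd m
  have hsq : √(s - t) ^ 2 ≤ |s - t| := by
    rcases le_total 0 (s - t) with h | h
    · rw [Real.sq_sqrt h]; exact le_abs_self _
    · rw [Real.sqrt_eq_zero_of_nonpos h]; simp
  have hle : ∀ q : Ed d × Ed d, ‖q.1 + √(s - t) • q.2‖ ^ 2 ≤
      2 * ‖q.1‖ ^ 2 + 2 * |s - t| * ‖q.2‖ ^ 2 := by
    intro q
    have h3 := norm_add_le q.1 (√(s - t) • q.2)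
    rw [norm_smul, Real.norm_of_nonneg (Real.sqrt_nonneg _)] at h3
    have h4 := pow_le_pow_left₀ (norm_nonneg _) h3 2
    have h5 : √(s - t) ^ 2 * ‖q.2‖ ^ 2 ≤ |s - t| * ‖q.2‖ ^ 2 := by gcongr
    nlinarith [sq_nonneg (‖q.1‖ - √(s - t) * ‖q.2‖)]
  have hI := (h1.const_mul 2).add (h2.const_mul (2 * |s - t|))
  have hint : Integrable (fun q : Ed d × Ed d => ‖q.1 + √(s - t) • q.2‖ ^ 2) (m.prod Z) :=
    hI.mono' (by fun_prop) (ae_of_all _ fun q => by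
      rw [Real.norm_of_nonneg (by positivity)]; exact hle q)
  refine ⟨memP_two_iff.2 ⟨isProbabilityMeasure_heatFlow t s, ?_⟩, ?_⟩
  · rw [heatFlow_eq_map, integrable_map_measure (by fun_prop) (by fun_prop)]
    exact hint
  · rw [secondMoment, heatFlow_eq_map, integral_map (by fun_prop) (by fun_prop)]
    refine (integral_mono hint hI hle).trans_eq ?_
    simp only [Pi.add_apply]
    rw [integral_add (h1.const_mul 2) (h2.const_mul _), integral_const_mul, integral_const_mul]
    have e1 := integral_fun_fst (μ := m) (ν := Z) (fun x : Ed d => ‖x‖ ^ 2)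
    have e2 := integral_fun_snd (μ := m) (ν := Z) (fun x : Ed d => ‖x‖ ^ 2)
    rw [e1, e2]
    simp [secondMoment]

lemma MemP.heatFlow (hm : MemP d 2 m) (t s : ℝ) : MemP d 2 (heatFlow d t s m) :=
  (heatFlow_moment hm t s).1

lemma wdist_one_heatFlow_le (hm : MemP d 2 m) (t s s' : ℝ) :
    wdist d 1 (heatFlow d t s m) (heatFlow d t s' m) ≤
      |√(s - t) - √(s' - t)| * ∫ x, ‖x‖ ∂(ProbabilityTheory.stdGaussian (Ed d)) := by
  have := hm.1
  set Z := ProbabilityTheory.stdGaussian (Ed d)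
  have hmeas : Measurable fun q : Ed d × Ed d =>
    (q.1 + √(s - t) • q.2, q.1 + √(s' - t) • q.2) := by fun_prop
  have hp : IsProbabilityMeasure ((m.prod Z).map fun q : Ed d × Ed d =>
    (q.1 + √(s - t) • q.2, q.1 + √(s' - t) • q.2)) :=
    Measure.isProbabilityMeasure_map hmeas.aemeasurable
  have hc : IsCoupling d ((m.prod Z).map fun q : Ed d × Ed d =>
      (q.1 + √(s - t) • q.2, q.1 + √(s' - t) • q.2))
      (heatFlow d t s m) (heatFlow d t s' m) := by
    constructor
    · rw [heatFlow_eq_map, Measure.map_map measurable_fst hmeas]; rfl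
    · rw [heatFlow_eq_map, Measure.map_map measurable_snd hmeas]; rfl
  refine (wdist_one_le hc).trans_eq ?_
  rw [integral_map hmeas.aemeasurable (by fun_prop)]
  have : ∀ q : Ed d × Ed d, ‖(q.1 + √(s - t) • q.2) - (q.1 + √(s' - t) • q.2)‖ =
      |√(s - t) - √(s' - t)| * ‖q.2‖ := by
    intro q
    rw [add_sub_add_left_eq_sub, ← sub_smul, norm_smul, Real.norm_eq_abs]
  simp only [this]
  rw [integral_const_mul, integral_fun_snd (μ := m) (ν := Z) (fun x : Ed d => ‖x‖)]
  simp

lemma tendsto_wdist_one_heatFlow (hm : MemP d 2 m) (t s : ℝ) :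
    Tendsto (fun s' => wdist d 1 (heatFlow d t s m) (heatFlow d t s' m)) (𝓝 s) (𝓝 0) := by
  have h : Continuous fun s' : ℝ => |√(s - t) - √(s' - t)| *
      ∫ x, ‖x‖ ∂(ProbabilityTheory.stdGaussian (Ed d)) := by fun_prop
  refine tendsto_of_tendsto_of_tendsto_of_le_of_le tendsto_const_nhds
    (by simpa using h.tendsto s) (fun _ => wdist_nonneg _ _ _ _)
    (fun s' => wdist_one_heatFlow_le hm t s s')

lemma charFun_heatFlow (hm : MemP d 2 m) {t s : ℝ} (hts : t ≤ s) (ξ : Ed d) :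
    charFun (heatFlow d t s m) ξ =
      charFun m ξ * (Real.exp (-(‖ξ‖ ^ 2 * (s - t) / 2)) : ℝ) := by
  have := hm.1
  rcases hts.eq_or_lt with h | h
  · subst h
    simp [heatFlow]
  · have hpos : 0 < s - t := by linarith
    have hprob : IsProbabilityMeasure (gaussMeasure d (s - t)) := by
      rw [gaussMeasure_eq_map hpos]
      exact Measure.isProbabilityMeasure_map (by fun_prop)
    have hc : heatFlow d t s m = m.conv (gaussMeasure d (s - t)) := by
      rw [heatFlow, if_neg (not_le.2 h)]; rfl
    rw [hc, charFun_conv, charFun_gaussMeasure hpos]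
    push_cast
    congr 2
    ring

/-- The cosine transform of a measure. -/
def cosMoment (d : ℕ) (ξ : Ed d) (m : Measure (Ed d)) : ℝ := ∫ x, Real.cos (inner ℝ ξ x) ∂m

/-- The sine transform of a measure. -/
def sinMoment (d : ℕ) (ξ : Ed d) (m : Measure (Ed d)) : ℝ := ∫ x, Real.sin (inner ℝ ξ x) ∂m

lemma charFun_eq_cosMoment_add_sinMoment [IsProbabilityMeasure m] (ξ : Ed d) :
    charFun m ξ = cosMoment d ξ m + sinMoment d ξ m * Complex.I := by
  have h1 : Integrable (fun x : Ed d => Real.cos (inner ℝ ξ x)) m :=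
    Integrable.of_bound (by fun_prop) 1 (ae_of_all _ fun x => Real.abs_cos_le_one _)
  have h2 : Integrable (fun x : Ed d => Real.sin (inner ℝ ξ x)) m :=
    Integrable.of_bound (by fun_prop) 1 (ae_of_all _ fun x => Real.abs_sin_le_one _)
  rw [charFun_apply, cosMoment, sinMoment, ← integral_complex_ofReal,
    ← integral_complex_ofReal, ← integral_mul_const, ← integral_add h1.ofReal
    (h2.ofReal.mul_const _)]
  refine integral_congr_ae (ae_of_all _ fun x => ?_)
  simp only [Complex.exp_mul_I, real_inner_comm]
  push_cast
  rfl

lemma cosMoment_heatFlow (hm : MemP d 2 m) {t s : ℝ} (hts : t ≤ s) (ξ : Ed d) :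
    cosMoment d ξ (heatFlow d t s m) =
      Real.exp (-(‖ξ‖ ^ 2 * (s - t) / 2)) * cosMoment d ξ m ∧
    sinMoment d ξ (heatFlow d t s m) =
      Real.exp (-(‖ξ‖ ^ 2 * (s - t) / 2)) * sinMoment d ξ m := by
  have := hm.1
  have := isProbabilityMeasure_heatFlow (m := m) t s
  have h := charFun_heatFlow hm hts ξ
  rw [charFun_eq_cosMoment_add_sinMoment, charFun_eq_cosMoment_add_sinMoment] at h
  have hre := congrArg Complex.re h
  have him := congrArg Complex.im h
  simp only [Complex.add_re, Complex.mul_re, Complex.ofReal_re, Complex.ofReal_im, Complex.I_re,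
    Complex.I_im, Complex.add_im, Complex.mul_im] at hre him
  constructor <;> linarith

/-- Two probability measures with the same cosine and sine transforms along a dense sequence of
frequencies coincide. -/
lemma eq_of_cosMoment_sinMoment_eq {m' : Measure (Ed d)} [IsProbabilityMeasure m]
    [IsProbabilityMeasure m']
    (h : ∀ k, cosMoment d (TopologicalSpace.denseSeq (Ed d) k) m =
        cosMoment d (TopologicalSpace.denseSeq (Ed d) k) m' ∧
      sinMoment d (TopologicalSpace.denseSeq (Ed d) k) m =
        sinMoment d (TopologicalSpace.denseSeq (Ed d) k) m') : m = m' := by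
  have hcont : ∀ μ : Measure (Ed d), IsProbabilityMeasure μ → Continuous (charFun μ) := by
    intro μ hμ
    rw [show charFun μ = fun ξ => _ from funext charFun_apply]
    refine continuous_of_dominated (fun ξ => by fun_prop) (bound := fun _ => 1)
      (fun ξ => ae_of_all _ fun x => ?_) (integrable_const _)
      (ae_of_all _ fun x => by fun_prop)
    rw [Complex.norm_exp_ofReal_mul_I]
  refine Measure.ext_of_charFun (Continuous.ext_on (TopologicalSpace.denseRange_denseSeq (Ed d))
    (hcont _ inferInstance) (hcont _ inferInstance) ?_)
  rintro _ ⟨k, rfl⟩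
  rw [charFun_eq_cosMoment_add_sinMoment, charFun_eq_cosMoment_add_sinMoment, (h k).1, (h k).2]

end HeatFlow

section TestFunctions

variable {d : ℕ} {T : ℝ}

/-- The operator `∂_t φ + ½ ∫ div[D_m φ] dm` applied to a test function. -/
def TestFn.gen (ψ : TestFn d T) (t : ℝ) (m : Measure (Ed d)) : ℝ :=
  ψ.φt t m + (1 / 2) * ∫ x, lapl d (ψ.δφ t m) x ∂m

lemma continuous_lapl {g : Ed d → ℝ} (hg : ContDiff ℝ 2 g) : Continuous (lapl d g) := by
  unfold lapl
  have := hg.continuous_iteratedFDeriv (m := 2) le_rfl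
  fun_prop

lemma abs_lapl_le {g : Ed d → ℝ} {c : ℝ} {x : Ed d}
    (hg : ‖iteratedFDeriv ℝ 2 g x‖ ≤ c * (1 + ‖x‖ ^ 2)) :
    |lapl d g x| ≤ (d * c) * (1 + ‖x‖ ^ 2) := by
  unfold lapl
  refine (Finset.abs_sum_le_sum_abs _ _).trans ?_
  refine (Finset.sum_le_sum (g := fun _ => c * (1 + ‖x‖ ^ 2)) fun i _ => ?_).trans ?_
  · have := (iteratedFDeriv ℝ 2 g x).le_opNorm (fun _ => EuclideanSpace.single i (1 : ℝ))
    simp only [Real.norm_eq_abs, PiLp.norm_single, abs_one, Finset.prod_const_one,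
      mul_one] at this
    exact this.trans hg
  · simp [mul_assoc]

lemma TestFn.integrable_δφ (ψ : TestFn d T) {t : ℝ} (ht : t ∈ Ico 0 T) {m m' : Measure (Ed d)}
    (hm : MemP d 2 m) (hm' : MemP d 2 m') : Integrable (ψ.δφ t m) m' := by
  obtain ⟨c, hc⟩ := ψ.quadGrowth
  exact hm'.integrable_of_le (ψ.smoothX t ht m hm).continuous c fun x => (hc t ht m hm x).1

lemma TestFn.integrable_lapl (ψ : TestFn d T) {t : ℝ} (ht : t ∈ Ico 0 T) {m : Measure (Ed d)}
    (hm : MemP d 2 m) : Integrable (lapl d (ψ.δφ t m)) m := by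
  obtain ⟨c, hc⟩ := ψ.quadGrowth
  exact hm.integrable_of_le (continuous_lapl (ψ.smoothX t ht m hm)) (d * c)
    fun x => abs_lapl_le (hc t ht m hm x).2.2

lemma fderiv_fun_add_of_contDiff {f g : Ed d → ℝ} (hf : ContDiff ℝ 2 f)
    (hg : ContDiff ℝ 2 g) (x : Ed d) :
    fderiv ℝ (fun y => f y + g y) x = fderiv ℝ f x + fderiv ℝ g x ∧
    iteratedFDeriv ℝ 2 (fun y => f y + g y) x =
      iteratedFDeriv ℝ 2 f x + iteratedFDeriv ℝ 2 g x :=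
  ⟨fderiv_fun_add (hf.differentiable (by norm_num) x) (hg.differentiable (by norm_num) x),
    iteratedFDeriv_add_apply hf.contDiffAt hg.contDiffAt⟩

lemma norm_add_sub_add_lt {E : Type*} [SeminormedAddCommGroup E] {a a' b b' : E} {ε : ℝ}
    (h : ‖a' - a‖ < ε / 2) (h' : ‖b' - b‖ < ε / 2) : ‖a' + b' - (a + b)‖ < ε := by
  rw [add_sub_add_comm]
  linarith [norm_add_le (a' - a) (b' - b)]

/-- The sum of two test functions. -/
def TestFn.add (ψ χ : TestFn d T) : TestFn d T where
  φ t m := ψ.φ t m + χ.φ t m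
  φt t m := ψ.φt t m + χ.φt t m
  δφ t m x := ψ.δφ t m x + χ.δφ t m x
  lsc t ht m hm ε hε := by
    obtain ⟨η, hη, h⟩ := ψ.lsc t ht m hm (ε / 2) (by positivity)
    obtain ⟨η', hη', h'⟩ := χ.lsc t ht m hm (ε / 2) (by positivity)
    refine ⟨min η η', lt_min hη hη', fun s hs μ hμ h1 h2 => ?_⟩
    have a := h s hs μ hμ (h1.trans_le (min_le_left _ _)) (h2.trans_le (min_le_left _ _))
    have b := h' s hs μ hμ (h1.trans_le (min_le_right _ _)) (h2.trans_le (min_le_right _ _))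
    linarith
  d2cont t ht m hm ε hε := by
    obtain ⟨η, hη, h⟩ := ψ.d2cont t ht m hm (ε / 2) (by positivity)
    obtain ⟨η', hη', h'⟩ := χ.d2cont t ht m hm (ε / 2) (by positivity)
    refine ⟨min η η', lt_min hη hη', fun s hs μ hμ h1 h2 => ?_⟩
    rw [← Real.norm_eq_abs]
    exact norm_add_sub_add_lt
      (h s hs μ hμ (h1.trans_le (min_le_left _ _)) (h2.trans_le (min_le_left _ _)))
      (h' s hs μ hμ (h1.trans_le (min_le_right _ _)) (h2.trans_le (min_le_right _ _)))
  timeDeriv m hm t ht := (ψ.timeDeriv m hm t ht).add (χ.timeDeriv m hm t ht)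
  measDeriv t ht m hm m' hm' := by
    rw [integral_add (ψ.integrable_δφ ht hm hm') (χ.integrable_δφ ht hm hm')]
    refine ((ψ.measDeriv t ht m hm m' hm').add (χ.measDeriv t ht m hm m' hm')).congr fun r => ?_
    rw [← add_div, add_sub_add_comm]
  normalized t ht m hm := by
    rw [integral_add (ψ.integrable_δφ ht hm hm) (χ.integrable_δφ ht hm hm),
      ψ.normalized t ht m hm, χ.normalized t ht m hm, add_zero]
  smoothX t ht m hm := (ψ.smoothX t ht m hm).add (χ.smoothX t ht m hm)
  quadGrowth := by
    obtain ⟨c, hc⟩ := ψ.quadGrowth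
    obtain ⟨c', hc'⟩ := χ.quadGrowth
    refine ⟨c + c', fun t ht m hm x => ?_⟩
    obtain ⟨h1, h2, h3⟩ := hc t ht m hm x
    obtain ⟨h1', h2', h3'⟩ := hc' t ht m hm x
    obtain ⟨e1, e2⟩ := fderiv_fun_add_of_contDiff (ψ.smoothX t ht m hm) (χ.smoothX t ht m hm) x
    rw [e1, e2, add_mul]
    exact ⟨(abs_add_le _ _).trans (add_le_add h1 h1'),
      (norm_add_le _ _).trans (add_le_add h2 h2'), (norm_add_le _ _).trans (add_le_add h3 h3')⟩
  d2contDeriv t ht m hm x ε hε := by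
    obtain ⟨η, hη, h⟩ := ψ.d2contDeriv t ht m hm x (ε / 2) (by positivity)
    obtain ⟨η', hη', h'⟩ := χ.d2contDeriv t ht m hm x (ε / 2) (by positivity)
    refine ⟨min η η', lt_min hη hη', fun s hs μ hμ y h1 h2 h3 => ?_⟩
    obtain ⟨a1, a2, a3, a4⟩ := h s hs μ hμ y (h1.trans_le (min_le_left _ _))
      (h2.trans_le (min_le_left _ _)) (h3.trans_le (min_le_left _ _))
    obtain ⟨b1, b2, b3, b4⟩ := h' s hs μ hμ y (h1.trans_le (min_le_right _ _))
      (h2.trans_le (min_le_right _ _)) (h3.trans_le (min_le_right _ _))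
    obtain ⟨e1, e2⟩ := fderiv_fun_add_of_contDiff (ψ.smoothX t ht m hm) (χ.smoothX t ht m hm) x
    obtain ⟨e3, e4⟩ := fderiv_fun_add_of_contDiff (ψ.smoothX s hs μ hμ) (χ.smoothX s hs μ hμ) y
    rw [e1, e2, e3, e4]
    rw [← Real.norm_eq_abs] at a1 a2 b1 b2
    rw [← Real.norm_eq_abs, ← Real.norm_eq_abs]
    exact ⟨norm_add_sub_add_lt a1 b1, norm_add_sub_add_lt a2 b2, norm_add_sub_add_lt a3 b3,
      norm_add_sub_add_lt a4 b4⟩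

lemma TestFn.gen_add (ψ χ : TestFn d T) {t : ℝ} (ht : t ∈ Ico 0 T) {m : Measure (Ed d)}
    (hm : MemP d 2 m) : (ψ.add χ).gen t m = ψ.gen t m + χ.gen t m := by
  have h : lapl d ((ψ.add χ).δφ t m) = fun x => lapl d (ψ.δφ t m) x + lapl d (χ.δφ t m) x := by
    funext x
    simp only [lapl, TestFn.add, (fderiv_fun_add_of_contDiff (ψ.smoothX t ht m hm)
      (χ.smoothX t ht m hm) x).2, _root_.add_apply, Finset.sum_add_distrib]
  simp only [TestFn.gen, h]
  rw [integral_add (ψ.integrable_lapl ht hm) (χ.integrable_lapl ht hm)]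
  simp only [TestFn.add]
  ring

lemma integral_mixture {m m' : Measure (Ed d)} {h : Ed d → ℝ} (hm : Integrable h m)
    (hm' : Integrable h m') {r : ℝ} (h0 : 0 ≤ r) (h1 : r ≤ 1) :
    ∫ x, h x ∂((1 - ENNReal.ofReal r) • m + ENNReal.ofReal r • m') =
      ∫ x, h x ∂m + r * (∫ x, h x ∂m' - ∫ x, h x ∂m) := by
  have hr : ENNReal.ofReal r ≤ 1 := ENNReal.ofReal_le_one.2 h1
  have e : (1 - ENNReal.ofReal r).toReal = 1 - r := by
    rw [ENNReal.toReal_sub_of_le hr ENNReal.one_ne_top, ENNReal.toReal_ofReal h0,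
      ENNReal.toReal_one]
  rw [integral_add_measure (hm.smul_measure (ENNReal.sub_ne_top ENNReal.one_ne_top))
    (hm'.smul_measure ENNReal.ofReal_ne_top), integral_smul_measure, integral_smul_measure, e,
    ENNReal.toReal_ofReal h0, smul_eq_mul, smul_eq_mul]
  ring

/-- The data defining a cylindrical test function `G(t, ∫ h dm)`. -/
structure CylData (d : ℕ) (T : ℝ) where
  /-- the inner integrand -/
  h : Ed d → ℝ
  /-- the outer function -/
  G : ℝ → ℝ → ℝ
  /-- the time derivative of the outer function -/
  Gt : ℝ → ℝ → ℝ
  /-- the space derivative of the outer function -/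
  Gz : ℝ → ℝ → ℝ
  contDiff_h : ContDiff ℝ 2 h
  growth_h : ∃ c, ∀ x, |h x| ≤ c * (1 + ‖x‖ ^ 2) ∧ ‖fderiv ℝ h x‖ ≤ c * (1 + ‖x‖ ^ 2) ∧
    ‖iteratedFDeriv ℝ 2 h x‖ ≤ c * (1 + ‖x‖ ^ 2)
  cont_integral : ∀ m : Measure (Ed d), MemP d 2 m → ∀ ε > (0 : ℝ), ∃ η > (0 : ℝ),
    ∀ m' : Measure (Ed d), MemP d 2 m' → wdist d 2 m m' < η →
      |∫ x, h x ∂m' - ∫ x, h x ∂m| < ε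
  cont_G : Continuous fun p : ℝ × ℝ => G p.1 p.2
  cont_Gt : Continuous fun p : ℝ × ℝ => Gt p.1 p.2
  cont_Gz : Continuous fun p : ℝ × ℝ => Gz p.1 p.2
  hasDerivAt_t : ∀ t z, HasDerivAt (fun s => G s z) (Gt t z) t
  hasDerivAt_z : ∀ t z, HasDerivAt (fun y => G t y) (Gz t z) z
  bound : ∃ K, ∀ t ∈ Ico 0 T, ∀ m : Measure (Ed d), MemP d 2 m →
    |Gz t (∫ x, h x ∂m)| ≤ K ∧ |Gz t (∫ x, h x ∂m) * ∫ x, h x ∂m| ≤ K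
  lsc : ∀ t ∈ Set.Icc 0 T, ∀ m : Measure (Ed d), MemP d 2 m → ∀ ε > (0:ℝ), ∃ η > (0:ℝ),
    ∀ t' ∈ Set.Icc 0 T, ∀ m' : Measure (Ed d), MemP d 2 m' →
      |t' - t| < η → wdist d 1 m m' < η →
        G t (∫ x, h x ∂m) - ε < G t' (∫ x, h x ∂m')

namespace CylData

variable (D : CylData d T)

lemma integrable_h {m : Measure (Ed d)} (hm : MemP d 2 m) : Integrable D.h m := by
  obtain ⟨c, hc⟩ := D.growth_h
  exact hm.integrable_of_le D.contDiff_h.continuous c fun x => (hc x).1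

lemma fderiv_aux (a b : ℝ) (x : Ed d) :
    fderiv ℝ (fun y => a * (D.h y - b)) x = a • fderiv ℝ D.h x ∧
    iteratedFDeriv ℝ 2 (fun y => a * (D.h y - b)) x = a • iteratedFDeriv ℝ 2 D.h x := by
  have hd : Differentiable ℝ D.h := D.contDiff_h.differentiable (by norm_num)
  constructor
  · rw [fderiv_const_mul ((hd x).sub_const b), fderiv_sub_const]
  · have e : (fun y => a * (D.h y - b)) = a • (D.h - fun _ => b) := rfl
    rw [e, iteratedFDeriv_const_smul_apply (f := D.h - fun _ => b)
        (D.contDiff_h.sub contDiff_const).contDiffAt,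
      iteratedFDeriv_sub_apply D.contDiff_h.contDiffAt contDiff_const.contDiffAt,
      iteratedFDeriv_const_of_ne (by norm_num)]
    simp

lemma lapl_aux (a b : ℝ) (x : Ed d) :
    lapl d (fun y => a * (D.h y - b)) x = a * lapl d D.h x := by
  simp only [lapl, (D.fderiv_aux a b x).2, _root_.smul_apply, smul_eq_mul,
    Finset.mul_sum]

lemma exists_close {E : Type*} [SeminormedAddCommGroup E] {K : ℝ × ℝ × Ed d → E}
    (hK : Continuous K) {m : Measure (Ed d)} (hm : MemP d 2 m) (t : ℝ) (x : Ed d) {ε : ℝ}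
    (hε : 0 < ε) : ∃ η > (0 : ℝ), ∀ t' : ℝ, ∀ m' : Measure (Ed d), MemP d 2 m' →
      ∀ x' : Ed d, |t' - t| < η → wdist d 2 m m' < η → ‖x' - x‖ < η →
        ‖K (t', ∫ y, D.h y ∂m', x') - K (t, ∫ y, D.h y ∂m, x)‖ < ε := by
  obtain ⟨η, hη, h⟩ := Metric.continuous_iff.1 hK (t, ∫ y, D.h y ∂m, x) ε hε
  obtain ⟨η', hη', h'⟩ := D.cont_integral m hm η hη
  refine ⟨min η η', lt_min hη hη', fun t' m' hm' x' h1 h2 h3 => ?_⟩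
  rw [← dist_eq_norm]
  refine h _ ?_
  rw [Prod.dist_eq, Prod.dist_eq, max_lt_iff, max_lt_iff, Real.dist_eq, Real.dist_eq,
    dist_eq_norm]
  exact ⟨h1.trans_le (min_le_left _ _), h' m' hm' (h2.trans_le (min_le_right _ _)),
    h3.trans_le (min_le_left _ _)⟩

/-- The test function `G(t, ∫ h dm)`. -/
def toTestFn : TestFn d T where
  φ t m := D.G t (∫ x, D.h x ∂m)
  φt t m := D.Gt t (∫ x, D.h x ∂m)
  δφ t m x := D.Gz t (∫ y, D.h y ∂m) * (D.h x - ∫ y, D.h y ∂m)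
  lsc := D.lsc
  d2cont t _ m hm ε hε := by
    obtain ⟨η, hη, h⟩ := D.exists_close (K := fun p => D.G p.1 p.2.1)
      (D.cont_G.comp (continuous_fst.prodMk (continuous_fst.comp continuous_snd))) hm t 0 hε
    exact ⟨η, hη, fun t' _ m' hm' h1 h2 => h t' m' hm' 0 h1 h2 (by simpa using hη)⟩
  timeDeriv m _ t _ := (D.hasDerivAt_t t _).hasDerivWithinAt
  measDeriv t _ m hm m' hm' := by
    have hI := D.integrable_h hm
    have hI' := D.integrable_h hm'
    have := hm'.1
    rw [integral_const_mul, integral_sub hI' (integrable_const _), integral_const]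
    simp only [probReal_univ, one_smul]
    set z := ∫ x, D.h x ∂m
    set w := ∫ x, D.h x ∂m' - z
    have hl : HasDerivAt (fun r : ℝ => z + r * w) w 0 := by
      simpa using ((hasDerivAt_id (0 : ℝ)).mul_const w).const_add z
    have hz : HasDerivAt (D.G t) (D.Gz t z) (z + 0 * w) := by
      simpa using D.hasDerivAt_z t z
    have hc : HasDerivAt (fun r : ℝ => D.G t (z + r * w)) (D.Gz t z * w) 0 :=
      hz.comp (0 : ℝ) hl
    refine hc.tendsto_slope_zero_right.congr' ?_
    have h1 : ∀ᶠ r : ℝ in 𝓝[>] 0, r < 1 :=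
      eventually_nhdsWithin_of_eventually_nhds (eventually_lt_nhds one_pos)
    filter_upwards [h1, self_mem_nhdsWithin] with r hr hr0
    rw [integral_mixture hI hI' (le_of_lt hr0) hr.le]
    simp only [zero_add, zero_mul, add_zero, smul_eq_mul, z, w]
    rw [div_eq_inv_mul]
  normalized t _ m hm := by
    have := hm.1
    rw [integral_const_mul, integral_sub (D.integrable_h hm) (integrable_const _)]
    simp
  smoothX t _ m _ := contDiff_const.mul (D.contDiff_h.sub contDiff_const)
  quadGrowth := by
    obtain ⟨c, hc⟩ := D.growth_h
    obtain ⟨K, hK⟩ := D.bound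
    refine ⟨K * c + K, fun t ht m hm x => ?_⟩
    obtain ⟨h1, h2⟩ := hK t ht m hm
    obtain ⟨g1, g2, g3⟩ := hc x
    have hK0 : 0 ≤ K := (abs_nonneg _).trans h1
    have hx : 1 ≤ 1 + ‖x‖ ^ 2 := by nlinarith [sq_nonneg ‖x‖]
    have hKx : 0 ≤ K * (1 + ‖x‖ ^ 2) := by positivity
    rw [(D.fderiv_aux _ _ x).1, (D.fderiv_aux _ _ x).2, norm_smul, norm_smul, Real.norm_eq_abs]
    refine ⟨?_, ?_, ?_⟩
    · rw [mul_sub]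
      refine (abs_sub _ _).trans ?_
      rw [abs_mul]
      have := mul_le_mul h1 g1 (abs_nonneg _) hK0
      nlinarith
    · have := mul_le_mul h1 g2 (norm_nonneg _) hK0
      nlinarith
    · have := mul_le_mul h1 g3 (norm_nonneg _) hK0
      nlinarith
  d2contDeriv t _ m hm x ε hε := by
    have hp : Continuous fun p : ℝ × ℝ × Ed d => (p.1, p.2.1) := by fun_prop
    have hx : Continuous fun p : ℝ × ℝ × Ed d => p.2.2 := by fun_prop
    have hz : Continuous fun p : ℝ × ℝ × Ed d => p.2.1 := by fun_prop
    obtain ⟨η₁, hη₁, h₁⟩ := D.exists_close (D.cont_Gt.comp hp) hm t x hε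
    obtain ⟨η₂, hη₂, h₂⟩ := D.exists_close
      ((D.cont_Gz.comp hp).mul ((D.contDiff_h.continuous.comp hx).sub hz)) hm t x hε
    obtain ⟨η₃, hη₃, h₃⟩ := D.exists_close ((D.cont_Gz.comp hp).smul
      ((D.contDiff_h.continuous_fderiv (by norm_num)).comp hx)) hm t x hε
    obtain ⟨η₄, hη₄, h₄⟩ := D.exists_close ((D.cont_Gz.comp hp).smul
      ((D.contDiff_h.continuous_iteratedFDeriv (m := 2) le_rfl).comp hx)) hm t x hε
    refine ⟨min (min η₁ η₂) (min η₃ η₄), by positivity, fun t' _ m' hm' x' a b c => ?_⟩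
    simp only [lt_min_iff] at a b c
    rw [(D.fderiv_aux _ _ x).1, (D.fderiv_aux _ _ x).2, (D.fderiv_aux _ _ x').1,
      (D.fderiv_aux _ _ x').2]
    exact ⟨h₁ t' m' hm' x' a.1.1 b.1.1 c.1.1, h₂ t' m' hm' x' a.1.2 b.1.2 c.1.2,
      h₃ t' m' hm' x' a.2.1 b.2.1 c.2.1, h₄ t' m' hm' x' a.2.2 b.2.2 c.2.2⟩

lemma gen_toTestFn (t : ℝ) (m : Measure (Ed d)) :
    D.toTestFn.gen t m = D.Gt t (∫ x, D.h x ∂m) +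
      (1 / 2) * (D.Gz t (∫ x, D.h x ∂m) * ∫ x, lapl d D.h x ∂m) := by
  simp only [TestFn.gen, toTestFn, D.lapl_aux, integral_const_mul]

end CylData

end TestFunctions

section PenaltyFunctions

variable {d : ℕ} {T : ℝ}

/-- The test function depending on time only. -/
def timeCyl (d : ℕ) (T : ℝ) (a a' : ℝ → ℝ) (ha' : Continuous a')
    (ha : ∀ t, HasDerivAt a (a' t) t) : CylData d T where
  h _ := 0
  G t _ := a t
  Gt t _ := a' t
  Gz _ _ := 0
  contDiff_h := contDiff_const
  growth_h := ⟨0, fun x => by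
    have : iteratedFDeriv ℝ 2 (fun _ : Ed d => (0 : ℝ)) = 0 :=
      iteratedFDeriv_const_of_ne (by norm_num) _
    rw [this]
    simp⟩
  cont_integral m _ ε hε := ⟨1, one_pos, fun m' _ _ => by simpa using hε⟩
  cont_G := by
    have : Continuous a := continuous_iff_continuousAt.2 fun t => (ha t).continuousAt
    fun_prop
  cont_Gt := by fun_prop
  cont_Gz := by fun_prop
  hasDerivAt_t t _ := ha t
  hasDerivAt_z t z := hasDerivAt_const z (a t)
  bound := ⟨0, by simp⟩
  lsc t _ m _ ε hε := by
    obtain ⟨η, hη, h⟩ := Metric.continuousAt_iff.1 (ha t).continuousAt ε hε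
    refine ⟨η, hη, fun t' _ m' _ h1 _ => ?_⟩
    have := (abs_lt.1 (h (by rwa [Real.dist_eq]))).1
    linarith

lemma exists_testFn_time (d : ℕ) (T : ℝ) (a a' : ℝ → ℝ) (ha' : Continuous a')
    (ha : ∀ t, HasDerivAt a (a' t) t) : ∃ ψ : TestFn d T, (∀ t m, ψ.φ t m = a t) ∧
      ∀ t m, ψ.gen t m = a' t :=
  ⟨(timeCyl d T a a' ha' ha).toTestFn, fun _ _ => rfl, fun t m => by
    rw [CylData.gen_toTestFn]
    simp [timeCyl]⟩

lemma iteratedFDeriv_two_norm_sq (x : Ed d) (v : Fin 2 → Ed d) :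
    iteratedFDeriv ℝ 2 (fun y : Ed d => ‖y‖ ^ 2) x v = 2 * inner ℝ (v 0) (v 1) := by
  rw [iteratedFDeriv_two_apply, fderiv_norm_sq]
  have : (2 • ⇑(innerSL ℝ (E := Ed d)) : Ed d → (Ed d →L[ℝ] ℝ)) =
      ⇑((2 : ℝ) • (innerSL ℝ (E := Ed d))) := by
    funext y
    ext z
    simp
  rw [this, ContinuousLinearMap.fderiv]
  rfl

lemma lapl_norm_sq (x : Ed d) : lapl d (fun y : Ed d => ‖y‖ ^ 2) x = 2 * d := by
  simp [lapl, iteratedFDeriv_two_norm_sq, mul_comm]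

/-- The test function `δ / 2 * log (1 + M₂(m) ^ 2)`, where `M₂` is the second moment. -/
def logCyl (d : ℕ) (T : ℝ) {δ : ℝ} (hδ : 0 < δ) : CylData d T where
  h x := ‖x‖ ^ 2
  G _ z := δ / 2 * Real.log (1 + z ^ 2)
  Gt _ _ := 0
  Gz _ z := δ * (z / (1 + z ^ 2))
  contDiff_h := contDiff_norm_sq ℝ
  growth_h := by
    refine ⟨2, fun x => ⟨?_, ?_, ?_⟩⟩
    · rw [abs_of_nonneg (by positivity)]
      nlinarith [sq_nonneg ‖x‖]
    · rw [fderiv_norm_sq_apply, ← Nat.cast_smul_eq_nsmul ℝ, norm_smul, innerSL_apply_norm]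
      simp only [Nat.cast_ofNat, Real.norm_ofNat]
      nlinarith [sq_nonneg (‖x‖ - 1)]
    · refine ContinuousMultilinearMap.opNorm_le_bound (by positivity) fun v => ?_
      rw [iteratedFDeriv_two_norm_sq, Fin.prod_univ_two, norm_mul, Real.norm_ofNat]
      have h1 := norm_inner_le_norm (𝕜 := ℝ) (v 0) (v 1)
      have h2 : 0 ≤ ‖v 0‖ * ‖v 1‖ := by positivity
      nlinarith [mul_nonneg (sq_nonneg ‖x‖) h2]
  cont_integral m hm ε hε := secondMoment_d2cont hm hε
  cont_G := by
    have : ∀ p : ℝ × ℝ, 1 + p.2 ^ 2 ≠ 0 := fun p => by positivity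
    fun_prop (disch := simpa using this)
  cont_Gt := continuous_const
  cont_Gz := by
    have : ∀ p : ℝ × ℝ, 1 + p.2 ^ 2 ≠ 0 := fun p => by positivity
    fun_prop (disch := simpa using this)
  hasDerivAt_t t z := hasDerivAt_const t _
  hasDerivAt_z t z := by
    have h : HasDerivAt (fun y : ℝ => 1 + y ^ 2) (2 * z) z := by
      simpa using (hasDerivAt_pow 2 z).const_add 1
    have h' := (h.log (by positivity)).const_mul (δ / 2)
    rwa [show δ / 2 * (2 * z / (1 + z ^ 2)) = δ * (z / (1 + z ^ 2)) by ring] at h'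
  bound := by
    refine ⟨δ, fun t _ m _ => ?_⟩
    have hz := secondMoment_nonneg d m
    rw [secondMoment] at hz
    set z := ∫ x, ‖x‖ ^ 2 ∂m
    rw [abs_of_nonneg (by positivity), abs_of_nonneg (by positivity), mul_assoc]
    constructor
    · refine mul_le_of_le_one_right hδ.le ?_
      rw [div_le_one (by positivity)]
      nlinarith [sq_nonneg (z - 1)]
    · refine mul_le_of_le_one_right hδ.le ?_
      rw [div_mul_eq_mul_div, div_le_one (by positivity)]
      nlinarith
  lsc t _ m hm ε hε := by
    have hc : ContinuousAt (fun z : ℝ => δ / 2 * Real.log (1 + z ^ 2)) (secondMoment d m) := by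
      have : 1 + secondMoment d m ^ 2 ≠ 0 := by positivity
      fun_prop (disch := assumption)
    obtain ⟨κ, hκ, h⟩ := Metric.continuousAt_iff.1 hc ε hε
    obtain ⟨η, hη, h'⟩ := secondMoment_lsc hm (half_pos hκ)
    refine ⟨η, hη, fun t' _ m' hm' _ h1 => ?_⟩
    have h2 := h' m' hm' h1
    have h3 := secondMoment_nonneg d m'
    have h4 := secondMoment_nonneg d m
    change δ / 2 * Real.log (1 + secondMoment d m ^ 2) - ε <
      δ / 2 * Real.log (1 + secondMoment d m' ^ 2)
    set z := max 0 (secondMoment d m - κ / 2)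
    have hz : |z - secondMoment d m| < κ := by
      rw [abs_lt]
      constructor
      · linarith [le_max_right 0 (secondMoment d m - κ / 2)]
      · have : z ≤ secondMoment d m := max_le h4 (by linarith)
        linarith
    have h5 := (abs_lt.1 (h (by rwa [Real.dist_eq]))).1
    have hz0 : 0 ≤ z := le_max_left _ _
    have hzm : z ≤ secondMoment d m' := max_le h3 h2.le
    have : δ / 2 * Real.log (1 + z ^ 2) ≤ δ / 2 * Real.log (1 + secondMoment d m' ^ 2) := by
      gcongr
    linarith

lemma exists_testFn_log (d : ℕ) (T : ℝ) {δ : ℝ} (hδ : 0 < δ) : ∃ ψ : TestFn d T,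
    (∀ t m, ψ.φ t m = δ / 2 * Real.log (1 + secondMoment d m ^ 2)) ∧
      ∀ t m, MemP d 2 m → ψ.gen t m ≤ δ * d := by
  refine ⟨(logCyl d T hδ).toTestFn, fun _ _ => rfl, fun t m hm => ?_⟩
  have := hm.1
  rw [CylData.gen_toTestFn]
  simp only [logCyl, lapl_norm_sq, integral_const, probReal_univ, one_smul, zero_add]
  set z := ∫ x, ‖x‖ ^ 2 ∂m
  have : z / (1 + z ^ 2) ≤ 1 := by
    rw [div_le_one (by positivity)]
    nlinarith [sq_nonneg (z - 1)]
  have hd : (0 : ℝ) ≤ δ * d := by positivity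
  nlinarith

/-- The real part of the rotated characteristic function of a measure. -/
def phaseMoment (d : ℕ) (ξ : Ed d) (θ : ℝ) (m : Measure (Ed d)) : ℝ :=
  ∫ x, Real.cos (inner ℝ ξ x - θ) ∂m

lemma phaseMoment_close {m : Measure (Ed d)} (hm : MemP d 2 m) (ξ : Ed d) (θ : ℝ) {ε : ℝ}
    (hε : 0 < ε) : ∃ η > (0 : ℝ), ∀ m' : Measure (Ed d), MemP d 2 m' → wdist d 1 m m' < η →
      |phaseMoment d ξ θ m' - phaseMoment d ξ θ m| < ε := by
  have hi : ∀ μ : Measure (Ed d), MemP d 2 μ →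
      Integrable (fun x : Ed d => Real.cos (inner ℝ ξ x - θ)) μ := fun μ hμ => by
    have := hμ.1
    exact Integrable.of_bound (by fun_prop) 1 (ae_of_all _ fun x => Real.abs_cos_le_one _)
  refine ⟨ε / (‖ξ‖ + 1), by positivity, fun m' hm' h => ?_⟩
  refine (abs_integral_sub_le_of_wdist_one_lt hm hm' h (norm_nonneg ξ) (fun x y => ?_)
    (hi m hm) (hi m' hm')).trans_lt ?_
  · refine (Real.abs_cos_sub_cos_le _ _).trans ?_
    rw [sub_sub_sub_cancel_right, ← inner_sub_right]
    exact abs_real_inner_le_norm _ _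
  · rw [← mul_div_assoc, div_lt_iff₀ (by positivity)]
    nlinarith [norm_nonneg ξ]

lemma abs_phaseMoment_le {m : Measure (Ed d)} (hm : MemP d 2 m) (ξ : Ed d) (θ : ℝ) :
    |phaseMoment d ξ θ m| ≤ 1 := by
  have := hm.1
  have h := norm_integral_le_of_norm_le_const (μ := m) (C := 1)
    (f := fun x : Ed d => Real.cos (inner ℝ ξ x - θ))
    (ae_of_all _ fun x => Real.abs_cos_le_one _)
  simpa [phaseMoment] using h

lemma iteratedDeriv_two_cos_sub (θ : ℝ) :
    iteratedDeriv 2 (fun y => Real.cos (y - θ)) = fun y => -Real.cos (y - θ) := by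
  have h1 : deriv (fun y => Real.cos (y - θ)) = fun y => -Real.sin (y - θ) := by
    funext y
    exact ((Real.hasDerivAt_cos (y - θ)).comp_sub_const y θ).deriv
  have h2 : deriv (fun y => -Real.sin (y - θ)) = fun y => -Real.cos (y - θ) := by
    funext y
    exact ((Real.hasDerivAt_sin (y - θ)).comp_sub_const y θ).neg.deriv
  rw [iteratedDeriv_succ, iteratedDeriv_one, h1, h2]

lemma iteratedFDeriv_two_cos_inner (ξ : Ed d) (θ : ℝ) (x : Ed d) :
    iteratedFDeriv ℝ 2 (fun y : Ed d => Real.cos (inner ℝ ξ y - θ)) x =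
      (iteratedFDeriv ℝ 2 (fun y => Real.cos (y - θ)) (inner ℝ ξ x)).compContinuousLinearMap
        fun _ => innerSL ℝ ξ :=
  (innerSL ℝ ξ).iteratedFDeriv_comp_right (f := fun y => Real.cos (y - θ)) (n := 2)
    (by fun_prop) x (i := 2) le_rfl

lemma lapl_cos_inner (ξ : Ed d) (θ : ℝ) (x : Ed d) :
    lapl d (fun y : Ed d => Real.cos (inner ℝ ξ y - θ)) x =
      -‖ξ‖ ^ 2 * Real.cos (inner ℝ ξ x - θ) := by
  simp only [lapl, iteratedFDeriv_two_cos_inner,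
    ContinuousMultilinearMap.compContinuousLinearMap_apply,
    iteratedFDeriv_apply_eq_iteratedDeriv_mul_prod, iteratedDeriv_two_cos_sub]
  rw [EuclideanSpace.norm_sq_eq, ← Finset.sum_smul]
  simp [pow_two, EuclideanSpace.inner_single_right]

lemma norm_fderiv_cos_inner_le (ξ : Ed d) (θ : ℝ) (x : Ed d) :
    ‖fderiv ℝ (fun y : Ed d => Real.cos (inner ℝ ξ y - θ)) x‖ ≤ ‖ξ‖ := by
  have h : HasFDerivAt (fun y : Ed d => Real.cos (inner ℝ ξ y - θ))
      (-Real.sin (inner ℝ ξ x - θ) • innerSL ℝ ξ) x := by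
    exact (((innerSL ℝ ξ).hasFDerivAt (x := x)).sub_const θ).cos
  rw [h.fderiv, norm_smul, innerSL_apply_norm, norm_neg]
  exact mul_le_of_le_one_left (norm_nonneg _) (Real.abs_sin_le_one _)

lemma norm_iteratedFDeriv_two_cos_inner_le (ξ : Ed d) (θ : ℝ) (x : Ed d) :
    ‖iteratedFDeriv ℝ 2 (fun y : Ed d => Real.cos (inner ℝ ξ y - θ)) x‖ ≤ ‖ξ‖ ^ 2 := by
  rw [iteratedFDeriv_two_cos_inner]
  refine (ContinuousMultilinearMap.norm_compContinuousLinearMap_le _ _).trans ?_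
  rw [norm_iteratedFDeriv_eq_norm_iteratedDeriv, iteratedDeriv_two_cos_sub, norm_neg]
  simp only [innerSL_apply_norm, Finset.prod_const, Finset.card_univ, Fintype.card_fin]
  exact mul_le_of_le_one_left (by positivity) (Real.abs_cos_le_one _)

/-- The test function `K * (exp (‖ξ‖² t / 2) ∫ cos (⟨ξ, x⟩ - θ) dm - c) ^ 2`. -/
def phaseCyl (d : ℕ) (T : ℝ) (ξ : Ed d) (θ K c : ℝ) : CylData d T where
  h x := Real.cos (inner ℝ ξ x - θ)
  G t z := K * (Real.exp (‖ξ‖ ^ 2 / 2 * t) * z - c) ^ 2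
  Gt t z := K * (2 * (Real.exp (‖ξ‖ ^ 2 / 2 * t) * z - c) *
    (Real.exp (‖ξ‖ ^ 2 / 2 * t) * (‖ξ‖ ^ 2 / 2) * z))
  Gz t z := K * (2 * (Real.exp (‖ξ‖ ^ 2 / 2 * t) * z - c) * Real.exp (‖ξ‖ ^ 2 / 2 * t))
  contDiff_h := ((innerSL ℝ ξ).contDiff.sub contDiff_const).cos
  growth_h := by
    refine ⟨1 + ‖ξ‖ + ‖ξ‖ ^ 2, fun x => ?_⟩
    have h0 := norm_nonneg ξ
    have h1 : 1 + ‖ξ‖ + ‖ξ‖ ^ 2 ≤ (1 + ‖ξ‖ + ‖ξ‖ ^ 2) * (1 + ‖x‖ ^ 2) :=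
      le_mul_of_one_le_right (by positivity) (by nlinarith [sq_nonneg ‖x‖])
    refine ⟨?_, ?_, ?_⟩
    · nlinarith [Real.abs_cos_le_one (inner ℝ ξ x - θ)]
    · nlinarith [norm_fderiv_cos_inner_le ξ θ x]
    · nlinarith [norm_iteratedFDeriv_two_cos_inner_le ξ θ x]
  cont_integral m hm ε hε := by
    obtain ⟨η, hη, h⟩ := phaseMoment_close hm ξ θ hε
    exact ⟨η, hη, fun m' hm' h' => h m' hm' (wdist_one_le_of_wdist_two_lt hm hm' h')⟩
  cont_G := by fun_prop
  cont_Gt := by fun_prop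
  cont_Gz := by fun_prop
  hasDerivAt_t t z := by
    have h : HasDerivAt (fun s : ℝ => Real.exp (‖ξ‖ ^ 2 / 2 * s))
        (Real.exp (‖ξ‖ ^ 2 / 2 * t) * (‖ξ‖ ^ 2 / 2)) t := by
      simpa using ((hasDerivAt_id t).const_mul (‖ξ‖ ^ 2 / 2)).exp
    simpa using (((h.mul_const z).sub_const c).pow 2).const_mul K
  hasDerivAt_z t z := by
    simpa using ((((hasDerivAt_id z).const_mul (Real.exp (‖ξ‖ ^ 2 / 2 * t))).sub_const c).pow
      2).const_mul K
  bound := by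
    have hc : ContinuousOn (fun p : ℝ × ℝ => K * (2 * (Real.exp (‖ξ‖ ^ 2 / 2 * p.1) * p.2 - c) *
        Real.exp (‖ξ‖ ^ 2 / 2 * p.1))) (Icc 0 T ×ˢ Icc (-1) 1) :=
      Continuous.continuousOn (by fun_prop)
    obtain ⟨M, hM⟩ := (isCompact_Icc.prod isCompact_Icc).exists_bound_of_continuousOn hc
    refine ⟨M, fun t ht m hm => ?_⟩
    have hz := abs_phaseMoment_le hm ξ θ
    have hb := hM (t, phaseMoment d ξ θ m) ⟨⟨ht.1, ht.2.le⟩, abs_le.1 hz⟩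
    refine ⟨hb, ?_⟩
    rw [abs_mul]
    exact (mul_le_of_le_one_right (abs_nonneg _) hz).trans hb
  lsc t _ m hm ε hε := by
    have hc : Continuous (fun p : ℝ × ℝ => K * (Real.exp (‖ξ‖ ^ 2 / 2 * p.1) * p.2 - c) ^ 2) := by
      fun_prop
    obtain ⟨κ, hκ, h⟩ := Metric.continuous_iff.1 hc (t, phaseMoment d ξ θ m) ε hε
    obtain ⟨η, hη, h'⟩ := phaseMoment_close hm ξ θ hκ
    refine ⟨min κ η, lt_min hκ hη, fun t' _ m' hm' h1 h2 => ?_⟩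
    have h3 : dist (t', phaseMoment d ξ θ m') (t, phaseMoment d ξ θ m) < κ := by
      rw [Prod.dist_eq, max_lt_iff]
      exact ⟨h1.trans_le (min_le_left _ _), h' m' hm' (h2.trans_le (min_le_right _ _))⟩
    have := (abs_lt.1 (h _ h3)).1
    rw [phaseMoment, phaseMoment] at this
    dsimp only at this
    linarith

lemma exists_testFn_phase (d : ℕ) (T : ℝ) (ξ : Ed d) (θ K c : ℝ) : ∃ ψ : TestFn d T,
    (∀ t m, ψ.φ t m = K * (Real.exp (‖ξ‖ ^ 2 / 2 * t) * phaseMoment d ξ θ m - c) ^ 2) ∧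
      ∀ t m, ψ.gen t m = 0 := by
  refine ⟨(phaseCyl d T ξ θ K c).toTestFn, fun _ _ => rfl, fun t m => ?_⟩
  rw [CylData.gen_toTestFn]
  simp only [phaseCyl, lapl_cos_inner, integral_const_mul]
  ring

/-- The penalisation `K ∑_{k < n} (...)²` of the distance to a solution of the heat equation,
measured through finitely many values of the characteristic function. -/
def phasePenalty (d : ℕ) (ξ : ℕ → Ed d) (c : ℕ → ℝ → ℝ) (n : ℕ) (t : ℝ)
    (m : Measure (Ed d)) : ℝ :=
  ∑ k ∈ Finset.range n,
    ((Real.exp (‖ξ k‖ ^ 2 / 2 * t) * phaseMoment d (ξ k) 0 m - c k 0) ^ 2 +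
      (Real.exp (‖ξ k‖ ^ 2 / 2 * t) * phaseMoment d (ξ k) (Real.pi / 2) m -
        c k (Real.pi / 2)) ^ 2)

lemma exists_testFn_phasePenalty (d : ℕ) (T : ℝ) (ξ : ℕ → Ed d) (c : ℕ → ℝ → ℝ) (K : ℝ)
    (n : ℕ) : ∃ ψ : TestFn d T, (∀ t m, ψ.φ t m = K * phasePenalty d ξ c n t m) ∧
      ∀ t ∈ Ico 0 T, ∀ m, MemP d 2 m → ψ.gen t m = 0 := by
  induction n with
  | zero =>
    obtain ⟨ψ, h1, h2⟩ := exists_testFn_time d T (fun _ => 0) (fun _ => 0) continuous_const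
      (fun t => hasDerivAt_const t 0)
    exact ⟨ψ, fun t m => by simp [h1, phasePenalty], fun t _ m _ => h2 t m⟩
  | succ n ih =>
    obtain ⟨ψ, h1, h2⟩ := ih
    obtain ⟨χ, h3, h4⟩ := exists_testFn_phase d T (ξ n) 0 K (c n 0)
    obtain ⟨ω, h5, h6⟩ := exists_testFn_phase d T (ξ n) (Real.pi / 2) K (c n (Real.pi / 2))
    refine ⟨ψ.add (χ.add ω), fun t m => ?_, fun t ht m hm => ?_⟩
    · simp only [TestFn.add, h1, h3, h5, phasePenalty, Finset.sum_range_succ]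
      ring
    · rw [TestFn.gen_add _ _ ht hm, TestFn.gen_add _ _ ht hm, h2 t ht m hm, h4, h6]
      simp

end PenaltyFunctions

section Comparison

variable {d : ℕ} {T : ℝ}

lemma abs_iInf_iSup_sub_le {A B : Type*} [Nonempty A] [Nonempty B] {a b : A → B → ℝ} {C ε : ℝ}
    (ha : ∀ u v, |a u v| ≤ C) (hb : ∀ u v, |b u v| ≤ C) (h : ∀ u v, |a u v - b u v| ≤ ε) :
    |(⨅ u, ⨆ v, a u v) - ⨅ u, ⨆ v, b u v| ≤ ε := by
  have key : ∀ a b : A → B → ℝ, (∀ u v, |a u v| ≤ C) → (∀ u v, |b u v| ≤ C) →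
      (∀ u v, |a u v - b u v| ≤ ε) → (⨅ u, ⨆ v, a u v) - (⨅ u, ⨆ v, b u v) ≤ ε := by
    intro a b ha hb h
    have hbdd : ∀ c : A → B → ℝ, (∀ u v, |c u v| ≤ C) → ∀ u, BddAbove (range (c u)) := by
      rintro c hc u
      refine ⟨C, ?_⟩
      rintro _ ⟨v, rfl⟩
      exact (abs_le.1 (hc u v)).2
    have hlow : BddBelow (range fun u => ⨆ v, a u v) := by
      refine ⟨-C, ?_⟩
      rintro _ ⟨u, rfl⟩
      obtain ⟨v⟩ := ‹Nonempty B›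
      exact (abs_le.1 (ha u v)).1.trans (le_ciSup (hbdd a ha u) v)
    suffices (⨅ u, ⨆ v, a u v) - ε ≤ ⨅ u, ⨆ v, b u v by linarith
    refine le_ciInf fun u => ?_
    have h1 : (⨅ u, ⨆ v, a u v) ≤ ⨆ v, a u v := ciInf_le hlow u
    have h2 : (⨆ v, a u v) ≤ (⨆ v, b u v) + ε := by
      refine ciSup_le fun v => ?_
      have := le_ciSup (hbdd b hb u) v
      have := (abs_le.1 (h u v)).2
      linarith
    linarith
  refine abs_sub_le_iff.2 ⟨key a b ha hb h, key b a hb ha fun u v => ?_⟩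
  rw [abs_sub_comm]
  exact h u v

lemma contD1_hamiltonian {A B : Type} [Nonempty A] [Nonempty B]
    {f : ℝ → Ed d → A → B → ℝ} {C : ℝ} (hfbdd : ∀ s x u v, |f s x u v| ≤ C)
    (hflip : ∀ (u : A) (v : B), ∀ s s' : ℝ, ∀ x x' : Ed d,
      |f s x u v - f s' x' u v| ≤ C * (‖x - x'‖ + |s - s'|)) :
    ContD1 d T (hamiltonian f) := by
  intro t _ m hm ε hε
  obtain ⟨u₀⟩ := ‹Nonempty A›
  obtain ⟨v₀⟩ := ‹Nonempty B›
  have hC : 0 ≤ C := (abs_nonneg _).trans (hfbdd 0 0 u₀ v₀)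
  have hcont : ∀ s u v, Continuous fun x => f s x u v := by
    intro s u v
    refine LipschitzWith.continuous (K := C.toNNReal) (LipschitzWith.of_dist_le_mul fun x y => ?_)
    rw [Real.dist_eq, dist_eq_norm, Real.coe_toNNReal _ hC]
    simpa using hflip u v s s x y
  have hint : ∀ s u v (μ : Measure (Ed d)), MemP d 2 μ → Integrable (fun x => f s x u v) μ := by
    intro s u v μ hμ
    have := hμ.1
    exact Integrable.of_bound (hcont s u v).aestronglyMeasurable C
      (ae_of_all _ fun x => hfbdd s x u v)
  have hle : ∀ s u v (μ : Measure (Ed d)), MemP d 2 μ → |∫ x, f s x u v ∂μ| ≤ C := by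
    intro s u v μ hμ
    have := hμ.1
    simpa using norm_integral_le_of_norm_le_const (μ := μ) (f := fun x => f s x u v)
      (ae_of_all _ fun x => hfbdd s x u v)
  refine ⟨ε / (4 * (C + 1)), by positivity, fun t' _ m' hm' ht hw => ?_⟩
  set η := ε / (4 * (C + 1))
  have hη : C * η ≤ ε / 4 := by
    simp only [η]
    rw [← mul_div_assoc, div_le_div_iff₀ (by positivity) (by norm_num)]
    nlinarith
  refine lt_of_le_of_lt (abs_iInf_iSup_sub_le (C := C) (ε := ε / 2) (fun u v => hle t' u v m' hm')
    (fun u v => hle t u v m hm) fun u v => ?_) (half_lt_self hε)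
  have h1 : |∫ x, f t x u v ∂m' - ∫ x, f t x u v ∂m| ≤ C * η :=
    abs_integral_sub_le_of_wdist_one_lt hm hm' hw hC
      (fun x y => by simpa using hflip u v t t x y) (hint t u v m hm) (hint t u v m' hm')
  have h2 : |∫ x, f t' x u v ∂m' - ∫ x, f t x u v ∂m'| ≤ C * η := by
    have := hm'.1
    rw [← integral_sub (hint t' u v m' hm') (hint t u v m' hm')]
    have := norm_integral_le_of_norm_le_const (μ := m') (f := fun x => f t' x u v - f t x u v)
      (C := C * η) (ae_of_all _ fun x => ?_)
    · simpa using this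
    · have h3 := hflip u v t' t x x
      rw [sub_self, norm_zero, zero_add] at h3
      exact h3.trans (mul_le_mul_of_nonneg_left ht.le hC)
  have := abs_sub_le (∫ x, f t' x u v ∂m') (∫ x, f t x u v ∂m') (∫ x, f t x u v ∂m)
  linarith

lemma ContD1.tendsto {g : ℝ → Measure (Ed d) → ℝ} (hg : ContD1 d T g) {ι : Type*} {l : Filter ι}
    {τ : ι → ℝ} {μ : ι → Measure (Ed d)} {t : ℝ} {m : Measure (Ed d)} (ht : t ∈ Icc 0 T)
    (hm : MemP d 2 m) (hτ : ∀ᶠ i in l, τ i ∈ Icc 0 T) (hμ : ∀ᶠ i in l, MemP d 2 (μ i))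
    (hτt : Tendsto τ l (𝓝 t)) (hμm : Tendsto (fun i => wdist d 1 m (μ i)) l (𝓝 0)) :
    Tendsto (fun i => g (τ i) (μ i)) l (𝓝 (g t m)) := by
  rw [Metric.tendsto_nhds]
  intro ε hε
  obtain ⟨η, hη, h⟩ := hg t ht m hm ε hε
  filter_upwards [hτ, hμ, Metric.tendsto_nhds.1 hτt η hη, hμm.eventually_lt_const hη]
    with i h1 h2 h3 h4
  exact h _ h1 _ h2 h3 h4

lemma ContD1.continuousOn_heatFlow {g : ℝ → Measure (Ed d) → ℝ} (hg : ContD1 d T g)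
    {m : Measure (Ed d)} (hm : MemP d 2 m) (t₀ : ℝ) :
    ContinuousOn (fun t => g t (heatFlow d t₀ t m)) (Icc 0 T) := fun t ht =>
  hg.tendsto ht (hm.heatFlow t₀ t) self_mem_nhdsWithin
    (Eventually.of_forall fun r => hm.heatFlow t₀ r) (tendsto_id.mono_left nhdsWithin_le_nhds)
    ((tendsto_wdist_one_heatFlow hm t₀ t).mono_left nhdsWithin_le_nhds)

lemma secondMoment_le_of_log_le {m : Measure (Ed d)} {δ B : ℝ} (hδ : 0 < δ)
    (h : δ / 2 * Real.log (1 + secondMoment d m ^ 2) ≤ B) :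
    secondMoment d m ≤ Real.exp (B / δ) := by
  have hpos : 0 < 1 + secondMoment d m ^ 2 := by positivity
  refine le_of_sq_le_sq ?_ (Real.exp_pos _).le
  have h1 : Real.log (1 + secondMoment d m ^ 2) ≤ 2 * (B / δ) := by
    rw [← mul_div_assoc, le_div_iff₀ hδ]
    linarith
  have h2 := (Real.log_le_iff_le_exp hpos).1 h1
  rw [← Real.exp_nat_mul]
  push_cast
  linarith

/-- A coercive penalisation of a bounded continuous function attains its minimum. -/
lemma exists_minimizer {u : ℝ → Measure (Ed d) → ℝ} (hub : BddD1 d T u) (huc : ContD1 d T u)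
    (ψ : TestFn d T) {δ c s : ℝ} (hδ : 0 < δ) (hs : s ∈ Icc 0 T)
    (hψ : ∀ t ∈ Icc 0 T, ∀ m : Measure (Ed d), MemP d 2 m →
      δ / 2 * Real.log (1 + secondMoment d m ^ 2) - c ≤ ψ.φ t m) :
    ∃ t ∈ Icc 0 s, ∃ m : Measure (Ed d), MemP d 2 m ∧ ∀ t' ∈ Icc 0 s, ∀ m' : Measure (Ed d),
      MemP d 2 m' → ψ.φ t m - u t m ≤ ψ.φ t' m' - u t' m' := by
  obtain ⟨b, hb⟩ := hub
  have hsub : Icc 0 s ⊆ Icc 0 T := Icc_subset_Icc_right hs.2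
  set S : Set ℝ := {y | ∃ t ∈ Icc 0 s, ∃ m : Measure (Ed d), MemP d 2 m ∧ y = ψ.φ t m - u t m}
  have hlow : ∀ t ∈ Icc 0 s, ∀ m : Measure (Ed d), MemP d 2 m →
      δ / 2 * Real.log (1 + secondMoment d m ^ 2) ≤ ψ.φ t m - u t m + (c + b) := by
    intro t ht m hm
    have h1 := hψ t (hsub ht) m hm
    have h2 := (abs_le.1 (hb t (hsub ht) m hm)).2
    linarith
  have hS : BddBelow S := by
    refine ⟨-(c + b), ?_⟩
    rintro _ ⟨t, ht, m, hm, rfl⟩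
    have h1 := hlow t ht m hm
    have h2 : 0 ≤ δ / 2 * Real.log (1 + secondMoment d m ^ 2) :=
      mul_nonneg (by positivity) (Real.log_nonneg (by nlinarith [sq_nonneg (secondMoment d m)]))
    linarith
  have hne : S.Nonempty :=
    ⟨_, 0, ⟨le_rfl, hs.1⟩, _, memP_stdGaussian d, rfl⟩
  have hex : ∀ n : ℕ, ∃ t ∈ Icc 0 s, ∃ m : Measure (Ed d), MemP d 2 m ∧
      ψ.φ t m - u t m < sInf S + 1 / ((n : ℝ) + 1) := by
    intro n
    have hn : (0 : ℝ) < 1 / ((n : ℝ) + 1) := by positivity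
    obtain ⟨_, ⟨t, ht, m, hm, rfl⟩, h⟩ := exists_lt_of_csInf_lt hne (lt_add_of_pos_right _ hn)
    exact ⟨t, ht, m, hm, h⟩
  choose τ hτ μ hμ hval using hex
  have hR : ∀ n, secondMoment d (μ n) ≤ Real.exp ((sInf S + 1 + (c + b)) / δ) := by
    intro n
    refine secondMoment_le_of_log_le hδ ((hlow _ (hτ n) _ (hμ n)).trans ?_)
    have h1 := hval n
    have h2 : 1 / ((n : ℝ) + 1) ≤ 1 := by
      rw [div_le_one (by positivity)]
      linarith [n.cast_nonneg (α := ℝ)]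
    linarith
  obtain ⟨m, hm, σ, hσ, hσm⟩ := exists_subseq_tendsto_wdist_one hμ hR
  obtain ⟨t, ht, σ', hσ', hσt⟩ := isCompact_Icc.tendsto_subseq fun n => hτ (σ n)
  have hw := hσm.comp hσ'.tendsto_atTop
  refine ⟨t, ht, m, hm, fun t' ht' m' hm' => ?_⟩
  refine le_trans ?_ (csInf_le hS ⟨t', ht', m', hm', rfl⟩)
  refine le_of_forall_pos_le_add fun ε hε => ?_
  obtain ⟨η, hη, h⟩ := ψ.lsc t (hsub ht) m hm (ε / 3) (by positivity)
  obtain ⟨η', hη', h'⟩ := huc t (hsub ht) m hm (ε / 3) (by positivity)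
  have hn : Tendsto (fun n => 1 / ((σ (σ' n) : ℝ) + 1)) atTop (𝓝 0) :=
    tendsto_one_div_add_atTop_nhds_zero_nat.comp (hσ.tendsto_atTop.comp hσ'.tendsto_atTop)
  obtain ⟨n, h1, h2, h3, h4, h5⟩ := ((Metric.tendsto_nhds.1 hσt η hη).and
    ((Metric.tendsto_nhds.1 hσt η' hη').and ((hw.eventually_lt_const hη).and
      ((hw.eventually_lt_const hη').and
        (hn.eventually_lt_const (show 0 < ε / 3 by positivity)))))).exists
  have a1 := h _ (hsub (hτ (σ (σ' n)))) _ (hμ (σ (σ' n))) h1 h3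
  have a2 := (abs_lt.1 (h' _ (hsub (hτ (σ (σ' n)))) _ (hμ (σ (σ' n))) h2 h4)).2
  have a3 := hval (σ (σ' n))
  linarith

lemma phaseMoment_zero (ξ : Ed d) (m : Measure (Ed d)) :
    phaseMoment d ξ 0 m = cosMoment d ξ m := by
  simp [phaseMoment, cosMoment]

lemma phaseMoment_pi_div_two (ξ : Ed d) (m : Measure (Ed d)) :
    phaseMoment d ξ (Real.pi / 2) m = sinMoment d ξ m := by
  simp [phaseMoment, sinMoment, Real.cos_sub_pi_div_two]

lemma exp_mul_phaseMoment_heatFlow {m : Measure (Ed d)} (hm : MemP d 2 m) {t₀ t : ℝ}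
    (ht : t₀ ≤ t) (ξ : Ed d) :
    Real.exp (‖ξ‖ ^ 2 / 2 * t) * phaseMoment d ξ 0 (heatFlow d t₀ t m) =
      Real.exp (‖ξ‖ ^ 2 / 2 * t₀) * phaseMoment d ξ 0 m ∧
    Real.exp (‖ξ‖ ^ 2 / 2 * t) * phaseMoment d ξ (Real.pi / 2) (heatFlow d t₀ t m) =
      Real.exp (‖ξ‖ ^ 2 / 2 * t₀) * phaseMoment d ξ (Real.pi / 2) m := by
  obtain ⟨h1, h2⟩ := cosMoment_heatFlow hm ht ξ
  have e : Real.exp (‖ξ‖ ^ 2 / 2 * t) * Real.exp (-(‖ξ‖ ^ 2 * (t - t₀) / 2)) =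
      Real.exp (‖ξ‖ ^ 2 / 2 * t₀) := by
    rw [← Real.exp_add]
    congr 1
    ring
  simp only [phaseMoment_zero, phaseMoment_pi_div_two, h1, h2, ← mul_assoc, e, and_self]

/-- The penalisation of the distance to the heat flow issued from `m₀` at time `t₀`. -/
def flowPenalty (d : ℕ) (t₀ : ℝ) (m₀ : Measure (Ed d)) (n : ℕ) (t : ℝ) (m : Measure (Ed d)) : ℝ :=
  phasePenalty d (TopologicalSpace.denseSeq (Ed d)) (fun k θ =>
    Real.exp (‖TopologicalSpace.denseSeq (Ed d) k‖ ^ 2 / 2 * t₀) *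
      phaseMoment d (TopologicalSpace.denseSeq (Ed d) k) θ m₀) n t m

lemma flowPenalty_nonneg (t₀ : ℝ) (m₀ : Measure (Ed d)) (n : ℕ) (t : ℝ) (m : Measure (Ed d)) :
    0 ≤ flowPenalty d t₀ m₀ n t m := by
  unfold flowPenalty phasePenalty
  exact Finset.sum_nonneg fun _ _ => by positivity

lemma flowPenalty_heatFlow {m₀ : Measure (Ed d)} (hm₀ : MemP d 2 m₀) {t₀ t : ℝ} (ht : t₀ ≤ t)
    (n : ℕ) : flowPenalty d t₀ m₀ n t (heatFlow d t₀ t m₀) = 0 := by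
  unfold flowPenalty phasePenalty
  refine Finset.sum_eq_zero fun k _ => ?_
  obtain ⟨h1, h2⟩ := exp_mul_phaseMoment_heatFlow hm₀ ht (TopologicalSpace.denseSeq (Ed d) k)
  rw [h1, h2]
  ring

lemma contD1_phaseMoment (T : ℝ) (ξ : Ed d) (θ : ℝ) :
    ContD1 d T fun _ m => phaseMoment d ξ θ m := by
  intro t _ m hm ε hε
  obtain ⟨η, hη, h⟩ := phaseMoment_close hm ξ θ hε
  exact ⟨η, hη, fun _ _ μ hμ _ => h μ hμ⟩

/-- Limits of points at which the penalisation vanishes asymptotically lie on the heat flow. -/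
lemma eq_heatFlow_of_flowPenalty_le {m₀ : Measure (Ed d)} (hm₀ : MemP d 2 m₀) {t₀ t B : ℝ}
    {τ : ℕ → ℝ} {μ : ℕ → Measure (Ed d)} {σ : ℕ → ℕ} {m : Measure (Ed d)} (ht : t₀ ≤ t)
    (hm : MemP d 2 m) (hμ : ∀ n, MemP d 2 (μ n)) (hσ : Tendsto σ atTop atTop)
    (hτt : Tendsto τ atTop (𝓝 t)) (hμm : Tendsto (fun n => wdist d 1 m (μ n)) atTop (𝓝 0))
    (hB : ∀ n, σ n * flowPenalty d t₀ m₀ (σ n) (τ n) (μ n) ≤ B) :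
    m = heatFlow d t₀ t m₀ := by
  have := hm.1
  have := (hm₀.heatFlow t₀ t).1
  refine eq_of_cosMoment_sinMoment_eq fun k => ?_
  set ξ := TopologicalSpace.denseSeq (Ed d) k with hξ
  set e : ℝ → ℝ := fun r => Real.exp (‖ξ‖ ^ 2 / 2 * r) with he
  have hphase : ∀ θ, Tendsto (fun n => phaseMoment d ξ θ (μ n)) atTop (𝓝 (phaseMoment d ξ θ m)) :=
    fun θ => (contD1_phaseMoment 0 ξ θ).tendsto (t := 0) (τ := fun _ => 0) ⟨le_rfl, le_rfl⟩ hm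
      (by simp) (Eventually.of_forall hμ) tendsto_const_nhds hμm
  have hexp : Tendsto (fun n => e (τ n)) atTop (𝓝 (e t)) :=
    (show Continuous e by fun_prop).continuousAt.tendsto.comp hτt
  have hlim : Tendsto (fun n =>
      (e (τ n) * phaseMoment d ξ 0 (μ n) - e t₀ * phaseMoment d ξ 0 m₀) ^ 2 +
      (e (τ n) * phaseMoment d ξ (Real.pi / 2) (μ n) -
        e t₀ * phaseMoment d ξ (Real.pi / 2) m₀) ^ 2) atTop
      (𝓝 ((e t * phaseMoment d ξ 0 m - e t₀ * phaseMoment d ξ 0 m₀) ^ 2 +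
      (e t * phaseMoment d ξ (Real.pi / 2) m -
        e t₀ * phaseMoment d ξ (Real.pi / 2) m₀) ^ 2)) :=
    (((hexp.mul (hphase _)).sub_const _).pow 2).add
      (((hexp.mul (hphase _)).sub_const _).pow 2)
  have hzero : Tendsto (fun n => B / (σ n : ℝ)) atTop (𝓝 0) :=
    (tendsto_const_div_atTop_nhds_zero_nat B).comp hσ
  have hle := le_of_tendsto_of_tendsto hlim hzero (by
    filter_upwards [hσ.eventually_gt_atTop k] with n hn
    have hpos : (0 : ℝ) < σ n := by exact_mod_cast (Nat.zero_le k).trans_lt hn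
    rw [le_div_iff₀ hpos, mul_comm]
    refine le_trans (mul_le_mul_of_nonneg_left ?_ hpos.le) (hB n)
    exact Finset.single_le_sum (f := fun k =>
      (Real.exp (‖TopologicalSpace.denseSeq (Ed d) k‖ ^ 2 / 2 * τ n) *
          phaseMoment d (TopologicalSpace.denseSeq (Ed d) k) 0 (μ n) -
        Real.exp (‖TopologicalSpace.denseSeq (Ed d) k‖ ^ 2 / 2 * t₀) *
          phaseMoment d (TopologicalSpace.denseSeq (Ed d) k) 0 m₀) ^ 2 +
      (Real.exp (‖TopologicalSpace.denseSeq (Ed d) k‖ ^ 2 / 2 * τ n) *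
          phaseMoment d (TopologicalSpace.denseSeq (Ed d) k) (Real.pi / 2) (μ n) -
        Real.exp (‖TopologicalSpace.denseSeq (Ed d) k‖ ^ 2 / 2 * t₀) *
          phaseMoment d (TopologicalSpace.denseSeq (Ed d) k) (Real.pi / 2) m₀) ^ 2)
      (fun _ _ => by positivity) (Finset.mem_range.2 hn))
  obtain ⟨h1, h2⟩ := exp_mul_phaseMoment_heatFlow hm₀ ht ξ
  set x := e t * phaseMoment d ξ 0 m - e t₀ * phaseMoment d ξ 0 m₀ with hx
  set y := e t * phaseMoment d ξ (Real.pi / 2) m - e t₀ * phaseMoment d ξ (Real.pi / 2) m₀ with hy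
  have hx0 : x = 0 := by
    refine pow_eq_zero_iff (two_ne_zero) |>.1 (le_antisymm ?_ (sq_nonneg x))
    nlinarith [sq_nonneg y]
  have hy0 : y = 0 := by
    refine pow_eq_zero_iff (two_ne_zero) |>.1 (le_antisymm ?_ (sq_nonneg y))
    nlinarith [sq_nonneg x]
  have het : e t ≠ 0 := (Real.exp_pos _).ne'
  rw [← phaseMoment_zero, ← phaseMoment_zero, ← phaseMoment_pi_div_two, ← phaseMoment_pi_div_two]
  constructor
  · refine mul_left_cancel₀ het ?_
    rw [hx, sub_eq_zero] at hx0
    rw [hx0, ← h1]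
  · refine mul_left_cancel₀ het ?_
    rw [hy, sub_eq_zero] at hy0
    rw [hy0, ← h2]

end Comparison

section Monotonicity

variable {d : ℕ} {T : ℝ}

/-- A bounded continuous subsolution, corrected by the integrated source term, is nondecreasing
along the heat flow. -/
theorem IsSubsolution.le_along_heatFlow {G u : ℝ → Measure (Ed d) → ℝ} (hG : ContD1 d T G)
    (hub : BddD1 d T u) (huc : ContD1 d T u) (hsub : IsSubsolution d T G u)
    {t₀ : ℝ} (ht₀ : t₀ ∈ Icc 0 T) {m₀ : Measure (Ed d)} (hm₀ : MemP d 2 m₀)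
    {s : ℝ} (hs : s ∈ Icc t₀ T) :
    0 ≤ u s (heatFlow d t₀ s m₀) - u t₀ m₀ + ∫ r in t₀..s, G r (heatFlow d t₀ r m₀) := by
  by_contra! hneg
  have hT : 0 ≤ T := ht₀.1.trans ht₀.2
  have hp : ∀ t, MemP d 2 (heatFlow d t₀ t m₀) := hm₀.heatFlow t₀
  have hself : heatFlow d t₀ t₀ m₀ = m₀ := if_pos le_rfl
  -- the source along the flow, extended to a continuous function on the line
  set g : ℝ → ℝ := fun r => G (max 0 (min T r)) (heatFlow d t₀ (max 0 (min T r)) m₀) with hg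
  have hgc : Continuous g :=
    (hG.continuousOn_heatFlow hm₀ t₀).comp_continuous (f := fun r : ℝ => max 0 (min T r))
      (by fun_prop) fun r => ⟨le_max_left _ _, max_le hT (min_le_left _ _)⟩
  have hgeq : ∀ r ∈ Icc 0 T, g r = G r (heatFlow d t₀ r m₀) := by
    intro r hr
    simp only [hg, min_eq_right hr.2, max_eq_right hr.1]
  set A : ℝ → ℝ := fun t => ∫ r in t₀..t, g r with hA
  have hAderiv : ∀ t, HasDerivAt A (g t) t := fun t =>
    (hgc.integral_hasStrictDerivAt t₀ t).hasDerivAt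
  have hAc : Continuous A := continuous_iff_continuousAt.2 fun t => (hAderiv t).continuousAt
  have hAs : A s = ∫ r in t₀..s, G r (heatFlow d t₀ r m₀) := by
    refine intervalIntegral.integral_congr fun r hr => ?_
    rw [uIcc_of_le hs.1] at hr
    exact hgeq r ⟨ht₀.1.trans hr.1, hr.2.trans hs.2⟩
  have hA0 : A t₀ = 0 := intervalIntegral.integral_same
  have hlt : t₀ < s := by
    refine lt_of_le_of_ne hs.1 ?_
    rintro rfl
    rw [hself, intervalIntegral.integral_same] at hneg
    simp at hneg
  have hs0 : s ∈ Icc 0 T := ⟨ht₀.1.trans hs.1, hs.2⟩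
  set w : ℝ → ℝ := fun t => u t (heatFlow d t₀ t m₀) + A t with hw
  have hws : w s < w t₀ := by
    simp only [hw, hself, hA0, hAs]
    linarith
  set κ : ℝ := (w t₀ - w s) / (2 * (s - t₀)) with hκ
  have hκpos : 0 < κ := div_pos (by linarith) (by linarith)
  have hκmul : κ * (s - t₀) = (w t₀ - w s) / 2 := by
    have : s - t₀ ≠ 0 := by linarith
    rw [hκ]
    field_simp
  set W : ℝ → ℝ := fun t => w t + κ * t with hW
  have hWs : W s < W t₀ := by
    simp only [hW]
    nlinarith
  have hWc : ContinuousOn W (Icc 0 T) :=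
    ((huc.continuousOn_heatFlow hm₀ t₀).add hAc.continuousOn).add (by fun_prop)
  obtain ⟨t₁, ⟨h01, h1s⟩, hWt₁⟩ : ∃ t₁ ∈ Ioo t₀ s, W s < W t₁ := by
    have h1 : Tendsto W (𝓝[Ioo t₀ s] t₀) (𝓝 (W t₀)) :=
      (hWc t₀ ht₀).mono_left (nhdsWithin_mono _ fun r hr =>
        ⟨ht₀.1.trans hr.1.le, hr.2.le.trans hs.2⟩)
    rw [nhdsWithin_Ioo_eq_nhdsGT hlt] at h1
    obtain ⟨r, hr1, hr2⟩ := ((h1.eventually_const_lt hWs).and (Ioo_mem_nhdsGT hlt)).exists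
    exact ⟨r, hr2, hr1⟩
  have ht₁ : t₁ ∈ Icc 0 s := ⟨ht₀.1.trans h01.le, h1s.le⟩
  have hsT : Icc 0 s ⊆ Icc 0 T := Icc_subset_Icc_right hs.2
  set γ : ℝ := W t₁ - W s with hγ
  have hγpos : 0 < γ := sub_pos.2 hWt₁
  set L : ℝ := Real.log (1 + secondMoment d (heatFlow d t₀ t₁ m₀) ^ 2) with hL
  -- the parameters of the penalisation
  obtain ⟨δ, ⟨hδκ, hδL⟩, hδ⟩ : ∃ δ : ℝ, (δ * d < κ ∧ δ / 2 * L < γ / 3) ∧ 0 < δ := by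
    have h1 : Tendsto (fun δ : ℝ => δ * d) (𝓝[>] 0) (𝓝 0) :=
      ((by fun_prop : Continuous fun δ : ℝ => δ * d).tendsto' 0 0 (by simp)).mono_left
        nhdsWithin_le_nhds
    have h2 : Tendsto (fun δ : ℝ => δ / 2 * L) (𝓝[>] 0) (𝓝 0) :=
      ((by fun_prop : Continuous fun δ : ℝ => δ / 2 * L).tendsto' 0 0 (by simp)).mono_left
        nhdsWithin_le_nhds
    exact (((h1.eventually_lt_const hκpos).and
      (h2.eventually_lt_const (by positivity : 0 < γ / 3))).and self_mem_nhdsWithin).exists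
  obtain ⟨cA, hcA⟩ : ∃ c : ℝ, ∀ t ∈ Icc 0 T, |A t + κ * t| ≤ c :=
    isCompact_Icc.exists_bound_of_continuousOn (f := fun t => A t + κ * t)
      (hAc.add (by fun_prop)).continuousOn
  obtain ⟨cu, hcu⟩ := id hub
  set V : ℝ := -W t₁ + 2 * γ / 3 with hV
  set B : ℝ := V + cA + cu with hB
  set τ : ℝ := (t₀ + t₁) / 2 with hτ
  obtain ⟨l, ⟨hl1, hl0⟩, hl⟩ : ∃ l : ℝ, (Real.exp (l * (τ - t₁)) < γ / 3 ∧
      B < Real.exp (l * (τ - t₀))) ∧ 0 < l := by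
    have h1 : Tendsto (fun l : ℝ => Real.exp (l * (τ - t₁))) atTop (𝓝 0) :=
      Real.tendsto_exp_atBot.comp (tendsto_id.atTop_mul_const_of_neg (by linarith))
    have h2 : Tendsto (fun l : ℝ => Real.exp (l * (τ - t₀))) atTop atTop :=
      Real.tendsto_exp_atTop.comp (tendsto_id.atTop_mul_const (by linarith))
    exact (((h1.eventually_lt_const (by positivity : 0 < γ / 3)).and
      (h2.eventually_gt_atTop B)).and (eventually_gt_atTop 0)).exists
  set e : ℝ → ℝ := fun t => Real.exp (l * (τ - t)) with he
  have hepos : ∀ t, 0 < e t := fun t => Real.exp_pos _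
  have hederiv : ∀ t, HasDerivAt e (-(l * e t)) t := by
    intro t
    have h1 : HasDerivAt (fun t => l * (τ - t)) (l * (-1)) t :=
      ((hasDerivAt_id t).const_sub τ).const_mul l
    have h2 := h1.exp
    convert h2 using 1
    ring
  have hec : Continuous e := by fun_prop
  obtain ⟨ψt, hψt, hψtgen⟩ := exists_testFn_time d T (fun t => -(A t + κ * t) + e t)
    (fun t => -(g t + κ * 1) + -(l * e t)) (by fun_prop) fun t =>
      (((hAderiv t).add ((hasDerivAt_id t).const_mul κ)).neg).add (hederiv t)
  obtain ⟨ψl, hψl, hψlgen⟩ := exists_testFn_log d T hδ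
  have hex : ∀ n : ℕ, ∃ ψ : TestFn d T,
      (∀ t m, ψ.φ t m = -(A t + κ * t) + e t + δ / 2 * Real.log (1 + secondMoment d m ^ 2) +
        n * flowPenalty d t₀ m₀ n t m) ∧
      ∀ t ∈ Ico 0 T, ∀ m, MemP d 2 m → ψ.gen t m ≤ -(g t + κ) + δ * d := by
    intro n
    obtain ⟨ψp, hψp, hψpgen⟩ := exists_testFn_phasePenalty d T
      (TopologicalSpace.denseSeq (Ed d)) (fun k θ =>
        Real.exp (‖TopologicalSpace.denseSeq (Ed d) k‖ ^ 2 / 2 * t₀) *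
          phaseMoment d (TopologicalSpace.denseSeq (Ed d) k) θ m₀) n n
    refine ⟨(ψt.add ψl).add ψp, fun t m => ?_, fun t ht m hm => ?_⟩
    · change ψt.φ t m + ψl.φ t m + ψp.φ t m = _
      rw [hψt, hψl, hψp]
      rfl
    · rw [TestFn.gen_add _ _ ht hm, TestFn.gen_add _ _ ht hm, hψtgen, hψpgen t ht m hm]
      have h1 := hψlgen t m hm
      have h2 : 0 < l * e t := mul_pos hl (hepos t)
      linarith
  choose ψ hψ hψgen using hex
  have hlog : ∀ m : Measure (Ed d), 0 ≤ δ / 2 * Real.log (1 + secondMoment d m ^ 2) := fun m =>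
    mul_nonneg (by positivity) (Real.log_nonneg (by nlinarith [sq_nonneg (secondMoment d m)]))
  have hpen : ∀ (n : ℕ) (t : ℝ) (m : Measure (Ed d)), 0 ≤ n * flowPenalty d t₀ m₀ n t m :=
    fun n t m => mul_nonneg n.cast_nonneg (flowPenalty_nonneg t₀ m₀ n t m)
  have hmin : ∀ n, ∃ t ∈ Icc 0 s, ∃ m : Measure (Ed d), MemP d 2 m ∧ ∀ t' ∈ Icc 0 s,
      ∀ m' : Measure (Ed d), MemP d 2 m' →
        (ψ n).φ t m - u t m ≤ (ψ n).φ t' m' - u t' m' := by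
    intro n
    refine exists_minimizer (c := cA) hub huc (ψ n) hδ hs0 fun t ht m _ => ?_
    rw [hψ]
    have h1 := (abs_le.1 (hcA t ht)).2
    have h2 := hepos t
    have h3 := hpen n t m
    linarith
  choose t ht m hm hmin using hmin
  have hval : ∀ n, -(A (t n) + κ * t n) + e (t n) +
      δ / 2 * Real.log (1 + secondMoment d (m n) ^ 2) +
      n * flowPenalty d t₀ m₀ n (t n) (m n) - u (t n) (m n) ≤ V := by
    intro n
    have h1 := hmin n t₁ ht₁ _ (hp t₁)
    rw [hψ, hψ, flowPenalty_heatFlow hm₀ h01.le] at h1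
    refine h1.trans ?_
    simp only [hV, hW, hw, he]
    linarith
  have hbound : ∀ n, e (t n) + δ / 2 * Real.log (1 + secondMoment d (m n) ^ 2) +
      n * flowPenalty d t₀ m₀ n (t n) (m n) ≤ B := by
    intro n
    have h1 := hval n
    have h2 := (abs_le.1 (hcA _ (hsT (ht n)))).2
    have h3 := (abs_le.1 (hcu _ (hsT (ht n)) _ (hm n))).2
    linarith
  have hgt : ∀ n, t₀ < t n := by
    intro n
    by_contra! hle
    have h1 : e t₀ ≤ e (t n) := Real.exp_le_exp.2 (mul_le_mul_of_nonneg_left (by linarith) hl.le)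
    have h2 := hbound n
    have h3 := hlog (m n)
    have h4 := hpen n (t n) (m n)
    linarith
  have hR : ∀ n, secondMoment d (m n) ≤ Real.exp (B / δ) := by
    intro n
    refine secondMoment_le_of_log_le hδ ?_
    have h1 := hbound n
    have h2 := hepos (t n)
    have h3 := hpen n (t n) (m n)
    linarith
  obtain ⟨m', hm', σ, hσ, hσm⟩ := exists_subseq_tendsto_wdist_one hm hR
  obtain ⟨t', ht', σ', hσ', hσt⟩ := isCompact_Icc.tendsto_subseq fun n =>
    (⟨(hgt (σ n)).le, (ht (σ n)).2⟩ : t (σ n) ∈ Icc t₀ s)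
  have ht'T : t' ∈ Icc 0 T := ⟨ht₀.1.trans ht'.1, ht'.2.trans hs.2⟩
  have hwd : Tendsto (fun n => wdist d 1 m' (m (σ (σ' n)))) atTop (𝓝 0) :=
    hσm.comp hσ'.tendsto_atTop
  have heq : m' = heatFlow d t₀ t' m₀ := by
    refine eq_heatFlow_of_flowPenalty_le (B := B) (σ := fun n => σ (σ' n))
      (τ := fun n => t (σ (σ' n))) (μ := fun n => m (σ (σ' n))) hm₀ ht'.1 hm' (fun n => hm _)
      (hσ.tendsto_atTop.comp hσ'.tendsto_atTop) hσt hwd fun n => ?_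
    have h1 := hbound (σ (σ' n))
    have h2 := hepos (t (σ (σ' n)))
    have h3 := hlog (m (σ (σ' n)))
    linarith
  have hev : ∀ {k : ℝ → Measure (Ed d) → ℝ}, ContD1 d T k →
      Tendsto (fun n => k (t (σ (σ' n))) (m (σ (σ' n)))) atTop
        (𝓝 (k t' (heatFlow d t₀ t' m₀))) := by
    intro k hk
    rw [← heq]
    exact hk.tendsto ht'T hm' (Eventually.of_forall fun n => hsT (ht _))
      (Eventually.of_forall fun n => hm _) hσt hwd
  have ht's : t' < s := by
    refine lt_of_le_of_ne ht'.2 ?_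
    intro h
    have h1 : Tendsto (fun n => -(A (t (σ (σ' n))) + κ * t (σ (σ' n))) -
        u (t (σ (σ' n))) (m (σ (σ' n)))) atTop
        (𝓝 (-(A t' + κ * t') - u t' (heatFlow d t₀ t' m₀))) :=
      (((hAc.tendsto t').comp hσt).add (hσt.const_mul κ)).neg.sub (hev huc)
    have h2 := le_of_tendsto' (b := V) h1 fun n => by
      have h1 := hval (σ (σ' n))
      have h2 := hepos (t (σ (σ' n)))
      have h3 := hlog (m (σ (σ' n)))
      have h4 := hpen (σ (σ' n)) (t (σ (σ' n))) (m (σ (σ' n)))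
      linarith
    rw [h] at h2
    simp only [hV, hγ, hW, hw] at h2 hγpos
    linarith
  have hfin : ∀ᶠ n in atTop, g (t (σ (σ' n))) + κ ≤
      δ * d + G (t (σ (σ' n))) (m (σ (σ' n))) := by
    filter_upwards [hσt.eventually_lt_const ht's] with n hn
    have hn' : t (σ (σ' n)) < s := hn
    have hIco : t (σ (σ' n)) ∈ Ico 0 T := ⟨(ht _).1, hn'.trans_le hs.2⟩
    have h1 : 0 ≤ (ψ (σ (σ' n))).gen (t (σ (σ' n))) (m (σ (σ' n))) +
        G (t (σ (σ' n))) (m (σ (σ' n))) := by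
      refine hsub _ hIco _ (hm _) (ψ (σ (σ' n))) ⟨s - t (σ (σ' n)), by linarith, ?_⟩
      intro r hr μ hμ hrt _
      exact hmin _ r ⟨hr.1, by linarith [(abs_le.1 hrt).2]⟩ μ hμ
    have h2 := hψgen (σ (σ' n)) _ hIco _ (hm (σ (σ' n)))
    linarith
  have hlim := le_of_tendsto_of_tendsto (((hgc.tendsto t').comp hσt).add_const κ)
    ((hev hG).const_add (δ * d)) hfin
  rw [hgeq t' ht'T] at hlim
  linarith

end Monotonicity

/-- If `F` satisfies (A1) and `u` is a bounded continuous subsolution of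
`∂_t u + ½ ∫ div[D_m u](t,m,x) dm(x) + F(t,m) = 0` on `[0,T) × 𝒫₂`, then for all
`(t₀,m₀) ∈ [0,T] × 𝒫₂` and `s ∈ [t₀,T]`,
`u(s,p^{t₀,m₀}_s) − u(t₀,m₀) + ∫_{t₀}^s F(r,p^{t₀,m₀}_r) dr ≥ 0`.
Moreover the same holds with `F` replaced by the Hamiltonian `H` (which need not satisfy
(A1)) for bounded continuous subsolutions of the equation with source `H`. -/
theorem subsolution_increasing_along_heatFlow (d : ℕ) (T : ℝ) (hT : 0 ≤ T)
    {A B : Type} [MetricSpace A] [CompactSpace A] [Nonempty A]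
    [MetricSpace B] [CompactSpace B] [Nonempty B]
    (f : ℝ → Ed d → A → B → ℝ) (C : ℝ)
    (hfbdd : ∀ s x u v, |f s x u v| ≤ C)
    (hfcont : Continuous fun q : ℝ × Ed d × A × B => f q.1 q.2.1 q.2.2.1 q.2.2.2)
    (hflip : ∀ (u : A) (v : B), ∀ s s' : ℝ, ∀ x x' : Ed d,
      |f s x u v - f s' x' u v| ≤ C * (‖x - x'‖ + |s - s'|))
    (hIsaacs : ∀ s ∈ Set.Icc 0 T, ∀ μ : Measure (Ed d), MemP d 2 μ →
      (⨅ u : A, ⨆ v : B, ∫ x, f s x u v ∂μ) = ⨆ v : B, ⨅ u : A, ∫ x, f s x u v ∂μ) :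
    -- the statement for a source term `F` satisfying (A1)
    (∀ FD : A1Data d T, ∀ u : ℝ → Measure (Ed d) → ℝ,
      BddD1 d T u → ContD1 d T u → IsSubsolution d T FD.F u →
      ∀ t₀ ∈ Set.Icc 0 T, ∀ m₀ : Measure (Ed d), MemP d 2 m₀ → ∀ s ∈ Set.Icc t₀ T,
        0 ≤ u s (heatFlow d t₀ s m₀) - u t₀ m₀ +
          ∫ r in t₀..s, FD.F r (heatFlow d t₀ r m₀)) ∧
    -- the statement for the Hamiltonian `H`
    (∀ u : ℝ → Measure (Ed d) → ℝ,
      BddD1 d T u → ContD1 d T u → IsSubsolution d T (hamiltonian f) u →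
      ∀ t₀ ∈ Set.Icc 0 T, ∀ m₀ : Measure (Ed d), MemP d 2 m₀ → ∀ s ∈ Set.Icc t₀ T,
        0 ≤ u s (heatFlow d t₀ s m₀) - u t₀ m₀ +
          ∫ r in t₀..s, hamiltonian f r (heatFlow d t₀ r m₀)) := by
  exact ⟨fun FD _ hub huc hsub _ ht₀ _ hm₀ _ hs =>
      hsub.le_along_heatFlow FD.contF hub huc ht₀ hm₀ hs,
    fun _ hub huc hsub _ ht₀ _ hm₀ _ hs =>
      hsub.le_along_heatFlow (contD1_hamiltonian hfbdd hflip) hub huc ht₀ hm₀ hs⟩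

end
end
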